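/- arXiv:1607.06136 — 3 statements merged into one kernel-verified Lean document; each statement's English description precedes it below -/
import Mathlib

section
/- There exists an absolute constant c > 0 such that the following holds: for every finite set L of N lines in ℝ³ and every integer D with 1 ≤ D ≤ √(cN), there exists a nonzero polynomial f ∈ ℝ[x,y,z] of degree at most D such that every connected component of ℝ³ \ Z(f) is intersected by at most cN/D² of the lines of L. -/
/-- A line in `ℝ³`: a one-dimensional affine subspace, given as the set of points
`p + t • v` for a direction vector `v ≠ 0`. -/
def IsLine (L : Set (Fin 3 → ℝ)) : Prop :=
  ∃ (p v : Fin 3 → ℝ), v ≠ 0 ∧ L = {q | ∃ t : ℝ, q = p + t • v}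

open Classical

/-! ### Cubical cochains modulo two -/

section Cubical

variable {ι β : Type*}

/-- Negation of all coordinates in the block `i`. -/
def negBlock {A : Type*} [Neg A] [DecidableEq β] (blk : ι → β) (i : β) (x : ι → A) : ι → A :=
  fun p => if blk p = i then -x p else x p

lemma negBlock_update [DecidableEq ι] [DecidableEq β] (blk : ι → β) (i : β)
    (u : ι → ℤ) (p : ι) (m : ℤ) :
    negBlock blk i (Function.update u p m) =
      Function.update (negBlock blk i u) p (if blk p = i then -m else m) := by
  funext q
  by_cases h : q = p
  · subst h; simp [negBlock]
  · simp [negBlock, h]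

/-- The cells having in each block a coordinate of absolute value `R`. -/
def blockCells [DecidableEq β] (blk : ι → β) (R : ℤ) : Set (ι → ℤ) :=
  {c | ∀ i, ∃ p, blk p = i ∧ |c p| = R}

/-- `v` is a face of the cell `u`. -/
def IsFace (v u : ι → ℤ) : Prop :=
  ∀ p, v p = u p ∨ (Odd (u p) ∧ Even (v p) ∧ |v p - u p| ≤ 1)

lemma IsFace.refl (u : ι → ℤ) : IsFace u u := fun _ => Or.inl rfl

lemma IsFace.trans {w v u : ι → ℤ} (h : IsFace w v) (h' : IsFace v u) : IsFace w u := by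
  intro p
  rcases h p with h1 | ⟨h1, h2, h3⟩
  · rw [h1]; exact h' p
  · rcases h' p with h4 | ⟨h4, h5, h6⟩
    · rw [← h4]; exact Or.inr ⟨h1, h2, h3⟩
    · exact absurd h1 (by rwa [Int.not_odd_iff_even])

lemma isFace_update_sub [DecidableEq ι] {u : ι → ℤ} {p : ι} (hp : Odd (u p)) :
    IsFace (Function.update u p (u p - 1)) u := by
  intro q
  by_cases h : q = p
  · subst h
    right
    simp only [Function.update_self]
    refine ⟨hp, by grind, by simp⟩
  · simp [h]

lemma isFace_update_add [DecidableEq ι] {u : ι → ℤ} {p : ι} (hp : Odd (u p)) :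
    IsFace (Function.update u p (u p + 1)) u := by
  intro q
  by_cases h : q = p
  · subst h
    right
    simp only [Function.update_self]
    refine ⟨hp, by grind, by simp⟩
  · simp [h]

lemma IsFace.mem_blockCells {blk : ι → β} {R : ℤ} (hR : Even R) {v u : ι → ℤ} (h : IsFace v u)
    (hu : u ∈ blockCells blk R) : v ∈ blockCells blk R := by
  intro i
  obtain ⟨p, hp, hup⟩ := hu i
  refine ⟨p, hp, ?_⟩
  rcases h p with h1 | ⟨h1, -, -⟩
  · rwa [h1]
  · exact absurd hR (by rw [← hup, even_abs]; simpa using h1)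

variable [Fintype ι] [DecidableEq ι]

/-- The mod 2 cellular coboundary on the cubical complex of `ℤ^ι`. A point `u : ι → ℤ` encodes
the cell whose coordinate at `p` is the vertex `u p` if `u p` is even, and the open interval
`(u p - 1, u p + 1)` if `u p` is odd. -/
def coboundary (a : (ι → ℤ) → ZMod 2) (u : ι → ℤ) : ZMod 2 :=
  ∑ p, if Odd (u p) then
    a (Function.update u p (u p - 1)) + a (Function.update u p (u p + 1)) else 0

lemma coboundary_add (a b : (ι → ℤ) → ZMod 2) :
    coboundary (a + b) = coboundary a + coboundary b := by
  funext u
  simp only [coboundary, Pi.add_apply, ← Finset.sum_add_distrib]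
  refine Finset.sum_congr rfl fun p _ => ?_
  split_ifs <;> ring

lemma coboundary_coboundary (a : (ι → ℤ) → ZMod 2) : coboundary (coboundary a) = 0 := by
  funext u
  have h : coboundary (coboundary a) u = ∑ x : ι × ι,
      if Odd (u x.1) ∧ Odd (u x.2) ∧ x.1 ≠ x.2 then
        a (Function.update (Function.update u x.1 (u x.1 - 1)) x.2 (u x.2 - 1)) +
        a (Function.update (Function.update u x.1 (u x.1 - 1)) x.2 (u x.2 + 1)) +
        (a (Function.update (Function.update u x.1 (u x.1 + 1)) x.2 (u x.2 - 1)) +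
        a (Function.update (Function.update u x.1 (u x.1 + 1)) x.2 (u x.2 + 1))) else 0 := by
    rw [Fintype.sum_prod_type]
    refine Finset.sum_congr rfl fun p _ => ?_
    by_cases hp : Odd (u p)
    · rw [if_pos hp, coboundary, coboundary, ← Finset.sum_add_distrib]
      refine Finset.sum_congr rfl fun q _ => ?_
      by_cases hpq : p = q
      · subst hpq
        have h1 : ¬ Odd (u p - 1) := by grind
        have h2 : ¬ Odd (u p + 1) := by grind
        simp [h1, h2]
      · rw [Function.update_of_ne (Ne.symm hpq), Function.update_of_ne (Ne.symm hpq)]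
        by_cases hq : Odd (u q) <;> simp [hp, hq, hpq]
    · simp [hp]
  rw [h]
  refine Finset.sum_involution (fun x _ => x.swap) ?_ ?_ (fun _ _ => Finset.mem_univ _)
    (fun _ _ => rfl)
  · rintro ⟨p, q⟩ -
    by_cases hpq : p = q
    · simp [hpq]
    · have e : ∀ m n : ℤ, Function.update (Function.update u q m) p n =
          Function.update (Function.update u p n) q m :=
        fun m n => (Function.update_comm hpq _ _ _).symm
      by_cases hc : Odd (u p) ∧ Odd (u q)
      · simp only [Prod.swap, ne_eq, hc.1, hc.2, hpq, Ne.symm hpq, e, not_false_eq_true, and_self,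
          if_true]
        generalize a _ = x1
        generalize a _ = x2
        generalize a _ = x3
        generalize a _ = x4
        revert x1 x2 x3 x4
        decide
      · rw [if_neg (fun h => hc ⟨h.1, h.2.1⟩), if_neg (fun h => hc ⟨h.2.1, h.1⟩), add_zero]
  · rintro ⟨p, q⟩ - h0 h1
    simp only [Prod.swap, Prod.mk.injEq] at h1
    exact h0 (by simp [h1.2])

lemma coboundary_one : coboundary (fun _ : ι → ℤ => 1) = 0 := by
  funext u
  refine Finset.sum_eq_zero fun p _ => ?_
  split_ifs
  · exact CharTwo.add_self_eq_zero _
  · rfl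

lemma coboundary_congr {a b : (ι → ℤ) → ZMod 2} {u : ι → ℤ}
    (h : ∀ v, IsFace v u → a v = b v) : coboundary a u = coboundary b u := by
  refine Finset.sum_congr rfl fun p _ => ?_
  split_ifs with hp
  · rw [h _ (isFace_update_sub hp), h _ (isFace_update_add hp)]
  · rfl

lemma coboundary_const_mul (z : ZMod 2) (a : (ι → ℤ) → ZMod 2) (u : ι → ℤ) :
    coboundary (fun v => z * a v) u = z * coboundary a u := by
  simp only [coboundary, Finset.mul_sum]
  refine Finset.sum_congr rfl fun p _ => ?_
  split_ifs <;> ring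

lemma coboundary_negBlock [DecidableEq β] {blk : ι → β} {R : ℤ} (hR : Even R) (i : β)
    {a b : (ι → ℤ) → ZMod 2}
    (h : ∀ c ∈ blockCells blk R, a (negBlock blk i c) = b c) :
    ∀ c ∈ blockCells blk R, coboundary a (negBlock blk i c) = coboundary b c := by
  intro c hc
  refine Finset.sum_congr rfl fun p _ => ?_
  have hodd : Odd (negBlock blk i c p) ↔ Odd (c p) := by
    rw [negBlock]; split_ifs <;> simp
  by_cases hp : Odd (c p)
  · rw [if_pos hp, if_pos (hodd.2 hp)]
    have h1 := h _ ((isFace_update_sub hp).mem_blockCells hR hc)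
    have h2 := h _ ((isFace_update_add hp).mem_blockCells hR hc)
    rw [negBlock_update] at h1 h2
    rw [← h1, ← h2]
    by_cases hi : blk p = i
    · rw [add_comm]
      simp only [hi, if_true]
      congr 3 <;> simp [negBlock, hi] <;> ring
    · simp [negBlock, hi]
  · rw [if_neg hp, if_neg (fun h => hp (hodd.1 h))]

/-- A cochain is invariant if its restriction to `blockCells` is unchanged by all flips. -/
def IsNegInvariant [DecidableEq β] (blk : ι → β) (R : ℤ) (a : (ι → ℤ) → ZMod 2) : Prop :=
  ∀ i, ∀ c ∈ blockCells blk R, a (negBlock blk i c) = a c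

end Cubical

section Iterated

variable {ι β κ : Type*} [Fintype ι] [DecidableEq ι] [DecidableEq β]

/-- A family of mod 2 sign functions such that `s k` changes under negation of the block `i`
exactly when `i ∈ χ k`. -/
def IsEquivariantSign (blk : ι → β) (R : ℤ) (χ : κ → Finset β)
    (s : κ → (ι → ℤ) → ZMod 2) : Prop :=
  ∀ k i, ∀ c ∈ blockCells blk R, s k (negBlock blk i c) = s k c + if i ∈ χ k then 1 else 0

/-- The cochain representing the product of the cocycles `δ (s k)` along a list. -/
def iteratedCoboundary (s : κ → (ι → ℤ) → ZMod 2) : List κ → (ι → ℤ) → ZMod 2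
  | [] => fun _ => 1
  | k :: ks => coboundary (s k * iteratedCoboundary s ks)

lemma coboundary_iteratedCoboundary (s : κ → (ι → ℤ) → ZMod 2) :
    ∀ ks, coboundary (iteratedCoboundary s ks) = 0
  | [] => coboundary_one
  | _ :: _ => coboundary_coboundary _

lemma IsEquivariantSign.isNegInvariant_iteratedCoboundary {blk : ι → β} {R : ℤ} (hR : Even R)
    {χ : κ → Finset β} {s : κ → (ι → ℤ) → ZMod 2} (hs : IsEquivariantSign blk R χ s)
    (ks : List κ) : IsNegInvariant blk R (iteratedCoboundary s ks) := by
  induction ks with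
  | nil => intro i c _; rfl
  | cons k ks ih =>
    intro i c hc
    rw [iteratedCoboundary, coboundary_negBlock hR i (b := s k * iteratedCoboundary s ks +
      fun v => (if i ∈ χ k then 1 else 0) * iteratedCoboundary s ks v) ?_ c hc, coboundary_add,
      Pi.add_apply, coboundary_const_mul, coboundary_iteratedCoboundary]
    · simp
    · intro c hc
      simp only [Pi.mul_apply, Pi.add_apply, hs k i c hc, ih i c hc]
      ring

lemma IsEquivariantSign.exists_iteratedCoboundary_eq {blk : ι → β} {R : ℤ} (hR : Even R)
    {χ : κ → Finset β} {s s' : κ → (ι → ℤ) → ZMod 2} (hs : IsEquivariantSign blk R χ s)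
    (hs' : IsEquivariantSign blk R χ s') (ks : List κ) :
    ∃ η, IsNegInvariant blk R η ∧
      iteratedCoboundary s' ks = iteratedCoboundary s ks + coboundary η := by
  induction ks with
  | nil =>
    refine ⟨0, fun _ _ _ => rfl, ?_⟩
    have h : coboundary (0 : (ι → ℤ) → ZMod 2) = 0 := by funext u; simp [coboundary]
    rw [h, add_zero]; rfl
  | cons k ks ih =>
    obtain ⟨η, hη, h⟩ := ih
    have two : ∀ z : ZMod 2, z + z = 0 := CharTwo.add_self_eq_zero
    refine ⟨(s' k + s k) * iteratedCoboundary s ks +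
      (s' k * coboundary η + coboundary (s' k * η)), ?_, ?_⟩
    · intro i c hc
      have h1 := coboundary_negBlock hR i (a := η) (b := η) (hη i) c hc
      have h2 := coboundary_negBlock hR i (a := s' k * η)
        (b := s' k * η + fun v => (if i ∈ χ k then 1 else 0) * η v) (fun c hc => by
          simp only [Pi.mul_apply, Pi.add_apply, hs' k i c hc, hη i c hc]; ring) c hc
      rw [coboundary_add, Pi.add_apply, coboundary_const_mul] at h2
      simp only [Pi.add_apply, Pi.mul_apply, h1, h2, hs k i c hc, hs' k i c hc,
        hs.isNegInvariant_iteratedCoboundary hR ks i c hc]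
      linear_combination (two (if i ∈ χ k then 1 else 0)) * (iteratedCoboundary s ks c) +
        (two ((if i ∈ χ k then 1 else 0) * coboundary η c))
    · rw [iteratedCoboundary, iteratedCoboundary, h, coboundary_add, coboundary_add,
        coboundary_coboundary, add_zero, ← coboundary_add, ← coboundary_add]
      congr 1
      funext c
      simp only [Pi.add_apply, Pi.mul_apply]
      linear_combination - two (s k c * iteratedCoboundary s ks c)

lemma iteratedCoboundary_eq_zero_of_forall_face {s : κ → (ι → ℤ) → ZMod 2} {k : κ} {u : ι → ℤ}
    {z : ZMod 2} (h : ∀ v, IsFace v u → s k v = z) {ks : List κ} (hk : k ∈ ks) :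
    iteratedCoboundary s ks u = 0 := by
  suffices H : ∀ v, IsFace v u → iteratedCoboundary s ks v = 0 from H u (IsFace.refl u)
  induction ks with
  | nil => simp at hk
  | cons j ks ih =>
    intro v hv
    by_cases hjk : j = k
    · subst hjk
      rw [iteratedCoboundary, coboundary_congr (b := fun w => z * iteratedCoboundary s ks w),
        coboundary_const_mul, coboundary_iteratedCoboundary]
      · simp
      · intro w hw
        rw [Pi.mul_apply, h w (hw.trans hv)]
    · have hk' : k ∈ ks := by
        rcases List.mem_cons.1 hk with h | h
        · exact absurd h.symm hjk
        · exact h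
      rw [iteratedCoboundary, coboundary_congr (b := fun w => 0 * iteratedCoboundary s ks w),
        coboundary_const_mul, zero_mul]
      intro w hw
      rw [Pi.mul_apply, ih hk' w (hw.trans hv), mul_zero, mul_zero]

/-- Representatives, modulo negation of blocks, of the top-dimensional cells of the product over
the blocks of the boundaries of the cubes `[-R, R]`; `x.1 i` is the coordinate of the
block `i` which equals `R`. -/
noncomputable def topCells [Fintype β] (blk : ι → β) (R : ℤ) : Finset ((β → ι) × (ι → ℤ)) :=
  (Finset.univ ×ˢ Fintype.piFinset fun _ => Finset.Icc (-R) R).filter fun x =>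
    (∀ i, blk (x.1 i) = i ∧ x.2 (x.1 i) = R) ∧
      ∀ p, p ≠ x.1 (blk p) → Odd (x.2 p) ∧ -R < x.2 p ∧ x.2 p < R

lemma mem_topCells [Fintype β] {blk : ι → β} {R : ℤ} (hR : 0 < R) {x : (β → ι) × (ι → ℤ)} :
    x ∈ topCells blk R ↔ (∀ i, blk (x.1 i) = i ∧ x.2 (x.1 i) = R) ∧
      ∀ p, p ≠ x.1 (blk p) → Odd (x.2 p) ∧ -R < x.2 p ∧ x.2 p < R := by
  simp only [topCells, Finset.mem_filter, Finset.mem_product, Finset.mem_univ, true_and,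
    Fintype.mem_piFinset, Finset.mem_Icc, and_iff_right_iff_imp]
  rintro ⟨h1, h2⟩ p
  by_cases hp : p = x.1 (blk p)
  · have := (h1 (blk p)).2
    rw [← hp] at this
    constructor <;> linarith
  · have := h2 p hp
    constructor <;> linarith

/-- The partner of the facet `u + ε e_p` of the top cell `(l, u)`. -/
def facetPartner (blk : ι → β) (R : ℤ) (y : ((β → ι) × (ι → ℤ)) × ι × ℤ) :
    ((β → ι) × (ι → ℤ)) × ι × ℤ :=
  if y.1.2 y.2.1 + y.2.2 < R ∧ -R < y.1.2 y.2.1 + y.2.2 then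
    ((y.1.1, Function.update y.1.2 y.2.1 (y.1.2 y.2.1 + 2 * y.2.2)), y.2.1, -y.2.2)
  else ((Function.update y.1.1 (blk y.2.1) y.2.1, fun r =>
    if r = y.1.1 (blk y.2.1) then y.2.2 * (R - 1) else if r = y.2.1 then R else
    if blk r = blk y.2.1 then y.2.2 * y.1.2 r else y.1.2 r), y.1.1 (blk y.2.1), y.2.2)

lemma sum_topCells_coboundary [Fintype β] {blk : ι → β} {R : ℤ} (hR : Even R) (hR0 : 0 < R)
    {ω : (ι → ℤ) → ZMod 2} (hω : IsNegInvariant blk R ω) :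
    ∑ x ∈ topCells blk R, coboundary ω x.2 = 0 := by
  have hodd : ∀ x ∈ topCells blk R, ∀ p, Odd (x.2 p) ↔ p ≠ x.1 (blk p) := by
    intro x hx p
    rw [mem_topCells hR0] at hx
    refine ⟨fun h hp => ?_, fun h => (hx.2 p h).1⟩
    rw [hp, (hx.1 (blk p)).2] at h
    exact (Int.not_odd_iff_even.2 hR) h
  have h : ∑ x ∈ topCells blk R, coboundary ω x.2 =
      ∑ y ∈ (topCells blk R ×ˢ ((Finset.univ : Finset ι) ×ˢ ({1, -1} : Finset ℤ))).filter
        (fun y => y.2.1 ≠ y.1.1 (blk y.2.1)),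
        ω (Function.update y.1.2 y.2.1 (y.1.2 y.2.1 + y.2.2)) := by
    rw [Finset.sum_filter, Finset.sum_product]
    refine Finset.sum_congr rfl fun x hx => ?_
    rw [Finset.sum_product]
    refine Finset.sum_congr rfl fun p _ => ?_
    rw [Finset.sum_pair (by norm_num)]
    simp only [hodd x hx p]
    split_ifs
    · rw [add_comm]; rfl
    · rfl
  rw [h]
  have key : ∀ l u p ε, (l, u) ∈ topCells blk R → ε = 1 ∨ ε = -1 → p ≠ l (blk p) →
      ¬ (u p + ε < R ∧ -R < u p + ε) → u p = ε * (R - 1) := by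
    intro l u p ε hx he hp hn
    have := ((mem_topCells hR0).1 hx).2 p hp
    rcases he with rfl | rfl <;> grind
  refine Finset.sum_involution (fun y _ => facetPartner blk R y) ?_ ?_ ?_ ?_
  · rintro ⟨⟨l, u⟩, p, ε⟩ hy
    simp only [Finset.mem_filter, Finset.mem_product, Finset.mem_univ, true_and,
      Finset.mem_insert, Finset.mem_singleton] at hy
    obtain ⟨⟨hx, he⟩, hp⟩ := hy
    have hx' := (mem_topCells hR0).1 hx
    simp only at hx'
    by_cases hc : u p + ε < R ∧ -R < u p + ε
    · rw [facetPartner, if_pos hc]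
      simp only [Function.update_self, Function.update_idem]
      rw [show u p + 2 * ε + -ε = u p + ε by ring]
      exact CharTwo.add_self_eq_zero _
    · have hup := key l u p ε hx he hp hc
      rw [facetPartner, if_neg hc]
      have hq := hx'.1 (blk p)
      have hmem : Function.update u p (u p + ε) ∈ blockCells blk R := by
        intro i
        by_cases hi : i = blk p
        · refine ⟨p, hi.symm, ?_⟩
          rw [Function.update_self, hup]
          rcases he with rfl | rfl
          · simp [abs_of_pos hR0]
          · rw [show -1 * (R - 1) + -1 = -R by ring, abs_neg, abs_of_pos hR0]
        · refine ⟨l i, (hx'.1 i).1, ?_⟩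
          rw [Function.update_of_ne, (hx'.1 i).2, abs_of_pos hR0]
          intro h
          exact hi (by rw [← h, (hx'.1 i).1])
      have hinv := hω (blk p) _ hmem
      have two : ∀ a b : ZMod 2, a = b → a + b = 0 := fun a b h => h ▸ CharTwo.add_self_eq_zero a
      rcases he with rfl | rfl
      · refine two _ _ (congrArg ω (funext fun r => ?_))
        dsimp only
        by_cases h1 : r = l (blk p)
        · subst h1
          simp [hp.symm, hq.2]
        · by_cases h2 : r = p
          · subst h2
            simp [h1, hup]
          · simp [h1, h2]
      · refine two _ _ (hinv.symm.trans (congrArg ω (funext fun r => ?_)))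
        dsimp only
        by_cases h1 : r = l (blk p)
        · subst h1
          simp [hp.symm, hq, negBlock]
          ring
        · by_cases h2 : r = p
          · subst h2
            simp [h1, hup, negBlock]
          · simp [h1, h2, negBlock]
  · rintro ⟨⟨l, u⟩, p, ε⟩ hy _ h
    simp only [Finset.mem_filter, Finset.mem_product, Finset.mem_univ, true_and,
      Finset.mem_insert, Finset.mem_singleton] at hy
    obtain ⟨⟨hx, he⟩, hp⟩ := hy
    rw [facetPartner] at h
    split_ifs at h
    · simp only [Prod.mk.injEq] at h
      have := h.2.2
      omega
    · simp only [Prod.mk.injEq] at h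
      exact hp h.2.1.symm
  · rintro ⟨⟨l, u⟩, p, ε⟩ hy
    simp only [Finset.mem_filter, Finset.mem_product, Finset.mem_univ, true_and,
      Finset.mem_insert, Finset.mem_singleton] at hy ⊢
    obtain ⟨⟨hx, he⟩, hp⟩ := hy
    have hx' := (mem_topCells hR0).1 hx
    simp only at hx'
    by_cases hc : u p + ε < R ∧ -R < u p + ε
    · rw [facetPartner, if_pos hc]
      refine ⟨⟨(mem_topCells hR0).2 ⟨fun i => ⟨(hx'.1 i).1, ?_⟩, fun r hr => ?_⟩, by grind⟩, hp⟩
      · have : l i ≠ p := by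
          rintro rfl
          rw [(hx'.1 i).1] at hp
          exact hp rfl
        simp [this, (hx'.1 i).2]
      · by_cases h : r = p
        · subst h
          have := hx'.2 r hr
          simp only [Function.update_self]
          rcases he with rfl | rfl <;> grind
        · simpa [h] using hx'.2 r hr
    · rw [facetPartner, if_neg hc]
      have hq := (hx'.1 (blk p)).1
      refine ⟨⟨(mem_topCells hR0).2 ⟨fun i => ?_, fun r hr => ?_⟩, he⟩, ?_⟩
      · simp only
        by_cases hi : i = blk p
        · subst hi
          simp [hp]
        · rw [Function.update_of_ne hi]
          have h1 : l i ≠ l (blk p) := fun h => hi (by rw [← (hx'.1 i).1, h, hq])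
          have h2 : l i ≠ p := fun h => hi (by rw [← h, (hx'.1 i).1])
          simp [h1, h2, hx'.1 i, hi]
      · simp only at hr ⊢
        by_cases h1 : r = l (blk p)
        · rw [if_pos h1]
          rcases he with rfl | rfl <;> grind
        · have h2 : r ≠ p := by
            rintro rfl
            simp at hr
          have hr' : r ≠ l (blk r) := by
            by_cases h : blk r = blk p
            · rwa [h]
            · rwa [Function.update_of_ne h] at hr
          have := hx'.2 r hr'
          rw [if_neg h1, if_neg h2]
          split_ifs
          · rcases he with rfl | rfl
            · simpa using this
            · simp only [neg_mul, one_mul]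
              exact ⟨this.1.neg, by linarith, by linarith⟩
          · exact this
      · simpa [hq] using hp.symm
  · rintro ⟨⟨l, u⟩, p, ε⟩ hy
    simp only [Finset.mem_filter, Finset.mem_product, Finset.mem_univ, true_and,
      Finset.mem_insert, Finset.mem_singleton] at hy
    obtain ⟨⟨hx, he⟩, hp⟩ := hy
    have hx' := (mem_topCells hR0).1 hx
    simp only at hx'
    by_cases hc : u p + ε < R ∧ -R < u p + ε
    · have hc' : u p + 2 * ε + -ε < R ∧ -R < u p + 2 * ε + -ε := by
        constructor <;> linarith [hc.1, hc.2]
      simp [facetPartner, hc, hc']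
    · have hup := key l u p ε hx he hp hc
      have hq := hx'.1 (blk p)
      have hc' : ¬ (ε * (R - 1) + ε < R ∧ -R < ε * (R - 1) + ε) := by
        rcases he with rfl | rfl <;> grind
      have hee : ε * ε = 1 := by rcases he with rfl | rfl <;> rfl
      have e1 : facetPartner blk R ((l, u), p, ε) = ((Function.update l (blk p) p, fun r =>
          if r = l (blk p) then ε * (R - 1) else if r = p then R else
          if blk r = blk p then ε * u r else u r), l (blk p), ε) := by
        rw [facetPartner, if_neg hc]
      rw [e1, facetPartner]
      simp only [if_true]
      rw [if_neg hc', hq.1]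
      simp only [Function.update_self, Function.update_idem, Function.update_eq_self]
      congr 2
      funext r
      by_cases h1 : r = p
      · subst h1
        rw [if_pos rfl, hup]
      · rw [if_neg h1]
        by_cases h2 : r = l (blk p)
        · rw [if_pos h2, h2, hq.2]
        · simp only [if_neg h2, if_neg h1]
          split_ifs
          · rw [← mul_assoc, hee, one_mul]
          · rfl

end Iterated

section CommonZero

lemma exists_antisymmetric_sign (ι : Type*) :
    ∃ ε : (ι → ℤ) → ZMod 2, ∀ x, x ≠ 0 → ε (-x) = ε x + 1 := by
  refine ⟨fun x => if WellOrderingRel x (-x) then 1 else 0, fun x hx => ?_⟩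
  have hne : x ≠ -x := by
    intro h
    apply hx
    funext p
    have := congrFun h p
    simp only [Pi.neg_apply] at this
    simp only [Pi.zero_apply]
    omega
  simp only [neg_neg]
  rcases trichotomous_of WellOrderingRel x (-x) with h | h | h
  · have h' : ¬ WellOrderingRel (-x) x := fun h' => asymm_of WellOrderingRel h h'
    rw [if_neg h', if_pos h]; rfl
  · exact absurd h hne
  · have h' : ¬ WellOrderingRel x (-x) := fun h' => asymm_of WellOrderingRel h h'
    rw [if_pos h, if_neg h']; rfl

variable {κ β : Type*} [LinearOrder β]

lemma exists_model_sign (b : κ → β) (χ : κ → Finset β) (hb : ∀ k, b k ∈ χ k) {R : ℤ}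
    (hR : 0 < R) :
    ∃ s : κ → (κ ⊕ β → ℤ) → ZMod 2, IsEquivariantSign (Sum.elim b id) R χ s ∧
      ∀ k c, (∀ i ∈ χ k, i ≠ b k → 0 < c (.inr i)) →
        0 < c (.inl k) ∨ 0 < c (.inr (b k)) → s k c = if c (.inl k) < 0 then 1 else 0 := by
  obtain ⟨ε, hε⟩ := exists_antisymmetric_sign (κ ⊕ β)
  let blk : κ ⊕ β → β := Sum.elim b id
  let τ : β → (κ ⊕ β → ℤ) → ZMod 2 := fun i c =>
    if 0 < c (.inr i) then 0 else if c (.inr i) < 0 then 1 else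
      ε (fun p => if blk p = i then c p else 0)
  have hτ : ∀ i j, ∀ c ∈ blockCells blk R, τ i (negBlock blk j c) =
      τ i c + if i = j then 1 else 0 := by
    intro i j c hc
    by_cases hij : i = j
    · subst hij
      have e : negBlock blk i c (.inr i) = - c (.inr i) := by simp [negBlock, blk]
      have e' : (fun p => if blk p = i then negBlock blk i c p else 0) =
          -(fun p => if blk p = i then c p else 0) := by
        funext p
        by_cases hp : blk p = i <;> simp [negBlock, hp]
      simp only [τ, e, e']
      rcases lt_trichotomy (c (.inr i)) 0 with h | h | h
      · have h1 : ¬ 0 < c (.inr i) := by omega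
        have h2 : 0 < - c (.inr i) := by omega
        rw [if_pos h2, if_neg h1, if_pos h]; rfl
      · rw [h, hε]
        · simp
        · obtain ⟨p, hp, hpR⟩ := hc i
          intro h0
          have := congrFun h0 p
          simp only [hp, if_true, Pi.zero_apply] at this
          rw [this] at hpR
          simp at hpR
          omega
      · have h1 : ¬ 0 < - c (.inr i) := by omega
        have h2 : - c (.inr i) < 0 := by omega
        rw [if_neg h1, if_pos h, if_pos h2]; rfl
    · have e : negBlock blk j c (.inr i) = c (.inr i) := by simp [negBlock, blk, hij]
      have e' : (fun p => if blk p = i then negBlock blk j c p else 0) =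
          (fun p => if blk p = i then c p else 0) := by
        funext p
        by_cases hp : blk p = i <;> simp [negBlock, hp, hij]
      simp only [τ, e, e', hij, if_false, add_zero]
  refine ⟨fun k c => (if c (.inl k) = 0 then τ (b k) c else if c (.inl k) < 0 then 1 else 0) +
    ∑ i ∈ (χ k).erase (b k), τ i c, ?_, ?_⟩
  · intro k j c hc
    simp only
    rw [Finset.sum_congr rfl fun i _ => hτ i j c hc, Finset.sum_add_distrib, Finset.sum_ite_eq',
      hτ (b k) j c hc]
    by_cases hj : b k = j
    · have e : negBlock blk j c (.inl k) = - c (.inl k) := by simp [negBlock, blk, hj]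
      have hjk : j ∈ χ k := hj ▸ hb k
      have hmem : j ∉ (χ k).erase (b k) := by simp [hj]
      rw [e, if_neg hmem, if_pos hjk, if_pos hj, add_zero]
      rcases lt_trichotomy (c (.inl k)) 0 with h | h | h
      · have h1 : ¬ - c (.inl k) < 0 := by omega
        have h2 : - c (.inl k) ≠ 0 := by omega
        have h3 : (1 + 1 : ZMod 2) = 0 := rfl
        rw [if_neg h2, if_neg h1, if_neg h.ne, if_pos h]
        linear_combination -h3
      · rw [h]
        simp only [neg_zero, if_true]
        ring
      · have h1 : - c (.inl k) < 0 := by omega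
        have h2 : - c (.inl k) ≠ 0 := by omega
        have h3 : ¬ c (.inl k) < 0 := by omega
        rw [if_neg h2, if_pos h1, if_neg h.ne', if_neg h3]
        ring
    · have e : negBlock blk j c (.inl k) = c (.inl k) := by simp [negBlock, blk, hj]
      have hmem : j ∈ (χ k).erase (b k) ↔ j ∈ χ k := by simp [Ne.symm hj]
      rw [e]
      simp only [hmem, hj, if_false, add_zero]
      ring
  · intro k c h1 h2
    simp only
    rw [Finset.sum_eq_zero, add_zero]
    · by_cases h : c (.inl k) = 0
      · have h3 : 0 < c (.inr (b k)) := by omega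
        simp [h, τ, h3]
      · rw [if_neg h]
    · intro i hi
      rw [Finset.mem_erase] at hi
      simp [τ, h1 i hi.2 hi.1]

variable [Fintype κ] [DecidableEq κ] [Fintype β]

lemma iteratedCoboundary_model {R : ℤ} (hR : Even R) {s : κ → (κ ⊕ β → ℤ) → ZMod 2}
    (hs : ∀ k c, (∀ i, c (.inr i) = R) → s k c = if c (.inl k) < 0 then 1 else 0)
    {ks : List κ} (hks : ks.Nodup) :
    ∀ v : κ ⊕ β → ℤ, (∀ i, v (.inr i) = R) →
      iteratedCoboundary s ks v = if ∀ k ∈ ks, v (.inl k) = -1 then 1 else 0 := by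
  induction ks with
  | nil => intro v _; simp [iteratedCoboundary]
  | cons k ks ih =>
    intro v hv
    rw [List.nodup_cons] at hks
    have ih := ih hks.2
    have upd : ∀ j m i, Function.update v (Sum.inl j) m (.inr i) = R := by
      intro j m i; simp [hv]
    have e : s k * iteratedCoboundary s ks = (fun w => (s k w + s k v) * iteratedCoboundary s ks w)
        + fun w => s k v * iteratedCoboundary s ks w := by
      funext w
      have := CharTwo.add_self_eq_zero (s k v * iteratedCoboundary s ks w)
      simp only [Pi.mul_apply, Pi.add_apply]
      linear_combination -this
    rw [iteratedCoboundary, e, coboundary_add, Pi.add_apply, coboundary_const_mul,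
      coboundary_iteratedCoboundary, Pi.zero_apply, mul_zero, add_zero, coboundary,
      Finset.sum_eq_single (Sum.inl k)]
    · have hT : ∀ m, iteratedCoboundary s ks (Function.update v (Sum.inl k) m) =
          if ∀ k ∈ ks, v (.inl k) = -1 then 1 else 0 := by
        intro m
        rw [ih _ (upd k m)]
        refine if_congr (forall₂_congr fun j hj => ?_) rfl rfl
        rw [Function.update_of_ne]
        rintro h
        exact hks.1 (Sum.inl.inj h ▸ hj)
      rw [hT, hT, hs k _ (upd k _), hs k _ (upd k _), hs k v hv]
      simp only [Function.update_self, List.forall_mem_cons]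
      by_cases hP : ∀ k ∈ ks, v (.inl k) = -1
      · simp only [if_pos hP, mul_one]
        have hand : (v (.inl k) = -1 ∧ ∀ k ∈ ks, v (.inl k) = -1) ↔ v (.inl k) = -1 :=
          and_iff_left hP
        simp only [hand]
        by_cases h1 : v (.inl k) = -1
        · simp [h1]
          rfl
        · rw [if_neg h1]
          split_ifs <;> first | rfl | (exfalso; grind)
      · simp [hP]
    · rintro (j | i) - hj
      · have hjk : k ≠ j := fun h => hj (by rw [h])
        simp only [hs k _ (upd j _), hs k v hv, ne_eq, Sum.inl.injEq, hjk, not_false_eq_true,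
          Function.update_of_ne, CharTwo.add_self_eq_zero]
        simp
      · rw [if_neg]
        rw [hv]
        exact Int.not_odd_iff_even.2 hR
    · simp

theorem exists_topCell_sign_change {b : κ → β} {χ : κ → Finset β} (hb : ∀ k, b k ∈ χ k)
    (hχ : ∀ k, ∀ i ∈ χ k, i ≤ b k) {R : ℤ} (hR : Even R) (hR0 : 0 < R)
    {s : κ → (κ ⊕ β → ℤ) → ZMod 2} (hs : IsEquivariantSign (Sum.elim b id) R χ s) :
    ∃ x ∈ topCells (Sum.elim b id) R, ∀ k z, ∃ v, IsFace v x.2 ∧ s k v ≠ z := by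
  obtain ⟨s₀, hs₀, hmodel⟩ := exists_model_sign b χ hb hR0
  let ks : List κ := Finset.univ.toList
  have hks : ∀ k, k ∈ ks := fun k => by simp [ks]
  obtain ⟨η, hη, hsη⟩ := hs₀.exists_iteratedCoboundary_eq hR hs ks
  have hR2 : 1 < R := by grind
  let x₀ : (β → κ ⊕ β) × (κ ⊕ β → ℤ) := (Sum.inr, Sum.elim (fun _ => -1) fun _ => R)
  have hx₀ : x₀ ∈ topCells (Sum.elim b id) R := by
    rw [mem_topCells hR0]
    refine ⟨fun i => ⟨rfl, rfl⟩, ?_⟩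
    rintro (k | i) h
    · exact ⟨(by decide : Odd (-1 : ℤ)), by simpa [x₀] using hR2,
        by simp only [x₀, Sum.elim_inl]; omega⟩
    · exact absurd rfl h
  have hsum : ∑ x ∈ topCells (Sum.elim b id) R, iteratedCoboundary s₀ ks x.2 = 1 := by
    rw [Finset.sum_eq_single x₀]
    · rw [iteratedCoboundary_model hR (fun k c hc => hmodel k c ?_ ?_)
        (Finset.nodup_toList _) _ (fun i => rfl)]
      · simp [x₀]
      · intro i _ _; rw [hc]; exact hR0
      · right; rw [hc]; exact hR0
    · rintro ⟨l, u⟩ hx hne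
      have hx' := (mem_topCells hR0).1 hx
      simp only at hx'
      by_cases hl : ∀ i, l i = .inr i
      · have hu : ∀ i, u (.inr i) = R := fun i => by rw [← hl i]; exact (hx'.1 i).2
        rw [iteratedCoboundary_model hR (fun k c hc => hmodel k c ?_ ?_)
          (Finset.nodup_toList _) _ hu]
        · rw [if_neg]
          intro h
          apply hne
          refine Prod.ext (funext hl) (funext ?_)
          rintro (k | i)
          · exact h k (hks k)
          · exact hu i
        · intro i _ _; rw [hc]; exact hR0
        · right; rw [hc]; exact hR0
      · push Not at hl
        obtain ⟨i, hi, hmin⟩ := WellFounded.has_min (wellFounded_lt (α := β))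
          {i | l i ≠ .inr i} hl
        obtain ⟨k, hk⟩ : ∃ k, l i = .inl k := by
          rcases h : l i with k | j
          · exact ⟨k, rfl⟩
          · have := (hx'.1 i).1
            rw [h] at this
            simp only [Sum.elim_inr, id] at this
            exact absurd (by rw [h, this]) hi
        have hbk : b k = i := by
          have := (hx'.1 i).1
          rwa [hk] at this
        have huk : u (.inl k) = R := by rw [← hk]; exact (hx'.1 i).2
        have face_eq : ∀ v, IsFace v u → ∀ p, u p = R → v p = R := by
          intro v hv p hp
          rcases hv p with h | ⟨h, -⟩
          · rw [h, hp]
          · rw [hp] at h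
            exact absurd hR (Int.not_even_iff_odd.2 h)
        refine iteratedCoboundary_eq_zero_of_forall_face (k := k) (z := 0) (fun v hv => ?_) (hks k)
        have hvk := face_eq v hv _ huk
        rw [hmodel k v ?_ ?_, if_neg]
        · rw [hvk]; omega
        · intro j hj hjk
          have hji : j < i := lt_of_le_of_ne (hbk ▸ hχ k j hj) (hbk ▸ hjk)
          have hlj : l j = .inr j := by
            by_contra h
            exact hmin j h hji
          rw [face_eq v hv _ (by rw [← hlj]; exact (hx'.1 j).2)]
          exact hR0
        · left; rw [hvk]; exact hR0
    · exact fun h => absurd hx₀ h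
  have hsum' : ∑ x ∈ topCells (Sum.elim b id) R, iteratedCoboundary s ks x.2 = 1 := by
    rw [hsη]
    simp only [Pi.add_apply, Finset.sum_add_distrib, hsum, sum_topCells_coboundary hR hR0 hη,
      add_zero]
  obtain ⟨x, hx, hne⟩ := Finset.exists_ne_zero_of_sum_ne_zero (by rw [hsum']; exact one_ne_zero)
  refine ⟨x, hx, fun k z => ?_⟩
  by_contra! h
  exact hne (iteratedCoboundary_eq_zero_of_forall_face h (hks k))

end CommonZero

section Continuous

/-- The product over the blocks of the boundaries of the cubes `[-1, 1]`. -/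
def cubeBoundaries {ι β : Type*} (blk : ι → β) : Set (ι → ℝ) :=
  {x | (∀ p, |x p| ≤ 1) ∧ ∀ i, ∃ p, blk p = i ∧ |x p| = 1}

lemma isCompact_cubeBoundaries {ι β : Type*} [Finite ι] (blk : ι → β) :
    IsCompact (cubeBoundaries blk) := by
  have h1 : IsCompact (Set.univ.pi fun _ : ι => Set.Icc (-1 : ℝ) 1) :=
    isCompact_univ_pi fun _ => isCompact_Icc
  refine h1.of_isClosed_subset ?_ ?_
  · have e : cubeBoundaries blk = (⋂ p, {x : ι → ℝ | |x p| ≤ 1}) ∩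
        ⋂ i, ⋃ p : ι, {x | blk p = i ∧ |x p| = 1} := by
      ext x
      simp [cubeBoundaries]
    rw [e]
    refine (isClosed_iInter fun p => isClosed_le (by fun_prop) (by fun_prop)).inter
      (isClosed_iInter fun i => isClosed_iUnion_of_finite fun p => ?_)
    by_cases hp : blk p = i
    · simp only [hp, true_and]
      exact isClosed_eq (by fun_prop) (by fun_prop)
    · simp [hp]
  · intro x hx p _
    exact abs_le.1 (hx.1 p)

variable {κ β : Type*} [LinearOrder β] [Fintype κ] [DecidableEq κ] [Fintype β]

lemma exists_near_sign_change {b : κ → β} {χ : κ → Finset β} (hb : ∀ k, b k ∈ χ k)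
    (hχ : ∀ k, ∀ i ∈ χ k, i ≤ b k) {F : κ → (κ ⊕ β → ℝ) → ℝ}
    (hFe : ∀ k i x, F k (negBlock (Sum.elim b id) i x) = (if i ∈ χ k then -1 else 1) * F k x)
    {R : ℤ} (hR : Even R) (hR0 : 0 < R) :
    ∃ x ∈ cubeBoundaries (Sum.elim b id), ∀ k,
      (∃ y, (∀ p, |y p - x p| ≤ (R : ℝ)⁻¹) ∧ 0 ≤ F k y) ∧
      ∃ y, (∀ p, |y p - x p| ≤ (R : ℝ)⁻¹) ∧ F k y ≤ 0 := by
  obtain ⟨s₀, hs₀, -⟩ := exists_model_sign b χ hb hR0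
  let emb : (κ ⊕ β → ℤ) → κ ⊕ β → ℝ := fun c p => c p / R
  let s : κ → (κ ⊕ β → ℤ) → ZMod 2 := fun k c =>
    if F k (emb c) < 0 then 1 else if 0 < F k (emb c) then 0 else s₀ k c
  have hRR : (0 : ℝ) < R := by exact_mod_cast hR0
  have hemb : ∀ i c, emb (negBlock (Sum.elim b id) i c) = negBlock (Sum.elim b id) i (emb c) := by
    intro i c
    funext p
    simp only [emb, negBlock]
    split_ifs <;> simp [neg_div]
  have hs : IsEquivariantSign (Sum.elim b id) R χ s := by
    intro k i c hc
    simp only [s, hemb, hFe, hs₀ k i c hc]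
    have h3 : (1 + 1 : ZMod 2) = 0 := rfl
    by_cases hi : i ∈ χ k
    · simp only [hi, if_true, neg_one_mul, neg_neg_iff_pos, neg_pos]
      rcases lt_trichotomy (F k (emb c)) 0 with h | h | h
      · simp [h, h.not_gt, h3]
      · simp [h]
      · simp [h, h.not_gt]
    · simp [hi]
  obtain ⟨⟨l, u⟩, hx, hz⟩ := exists_topCell_sign_change hb hχ hR hR0 hs
  rw [mem_topCells hR0] at hx
  have hface : ∀ v, IsFace v u → ∀ p, |emb v p - emb u p| ≤ (R : ℝ)⁻¹ := by
    intro v hv p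
    have : |v p - u p| ≤ 1 := by
      rcases hv p with h | h
      · simp [h]
      · exact h.2.2
    have h' : |(v p : ℝ) - u p| ≤ 1 := by exact_mod_cast this
    simp only [emb]
    rw [← sub_div, abs_div, abs_of_pos hRR, ← one_div]
    gcongr
  refine ⟨emb u, ⟨fun p => ?_, fun i => ⟨l i, (hx.1 i).1, ?_⟩⟩, fun k => ⟨?_, ?_⟩⟩
  · have : |u p| ≤ R := by
      by_cases hp : p = l (Sum.elim b id p)
      · have := (hx.1 (Sum.elim b id p)).2
        simp only at this
        rw [← hp] at this
        rw [this, abs_of_pos hR0]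
      · have := hx.2 p hp
        exact abs_le.2 ⟨this.2.1.le, this.2.2.le⟩
    simp only [emb]
    rw [abs_div, abs_of_pos hRR, div_le_one hRR]
    exact_mod_cast this
  · have := (hx.1 i).2
    simp only at this
    simp only [emb, this, div_self hRR.ne', abs_one]
  · obtain ⟨v, hv, h⟩ := hz k 1
    refine ⟨emb v, hface v hv, ?_⟩
    by_contra! hneg
    exact h (by simp [s, hneg])
  · obtain ⟨v, hv, h⟩ := hz k 0
    refine ⟨emb v, hface v hv, ?_⟩
    by_contra! hpos
    exact h (by simp [s, hpos, hpos.not_gt])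

/-- A Borsuk-Ulam theorem for products: continuous functions that are odd or even under the
negation of each block, the number of functions ending in the block `i` being one less than its
dimension, have a common zero. -/
theorem exists_common_zero {b : κ → β} {χ : κ → Finset β} (hb : ∀ k, b k ∈ χ k)
    (hχ : ∀ k, ∀ i ∈ χ k, i ≤ b k) {F : κ → (κ ⊕ β → ℝ) → ℝ} (hF : ∀ k, Continuous (F k))
    (hFe : ∀ k i x, F k (negBlock (Sum.elim b id) i x) = (if i ∈ χ k then -1 else 1) * F k x) :
    ∃ x ∈ cubeBoundaries (Sum.elim b id), ∀ k, F k x = 0 := by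
  have hR : ∀ n : ℕ, ∃ x ∈ cubeBoundaries (Sum.elim b id), ∀ k,
      (∃ y, (∀ p, |y p - x p| ≤ ((2 * (n + 1) : ℤ) : ℝ)⁻¹) ∧ 0 ≤ F k y) ∧
      ∃ y, (∀ p, |y p - x p| ≤ ((2 * (n + 1) : ℤ) : ℝ)⁻¹) ∧ F k y ≤ 0 := fun n =>
    exists_near_sign_change hb hχ hFe (even_two_mul _) (by positivity)
  choose x hx hy hz using hR
  choose y hy hy0 using hy
  choose z hz hz0 using hz
  obtain ⟨a, ha, φ, hφ, hlim⟩ := (isCompact_cubeBoundaries (Sum.elim b id)).tendsto_subseq hx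
  have h0 : Filter.Tendsto (fun n : ℕ => ((2 * ((φ n : ℕ) + 1) : ℤ) : ℝ)⁻¹) Filter.atTop
      (nhds 0) := by
    refine Filter.Tendsto.comp (g := fun n : ℕ => ((2 * ((n : ℕ) + 1) : ℤ) : ℝ)⁻¹) ?_
      hφ.tendsto_atTop
    refine tendsto_inv_atTop_zero.comp ?_
    push_cast
    exact (Filter.tendsto_atTop_add_const_right _ _ tendsto_natCast_atTop_atTop).const_mul_atTop
      two_pos
  have hlim' : ∀ w : ℕ → κ ⊕ β → ℝ,
      (∀ n p, |w n p - x n p| ≤ ((2 * ((n : ℕ) + 1) : ℤ) : ℝ)⁻¹) →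
      Filter.Tendsto (fun n => w (φ n)) Filter.atTop (nhds a) := by
    intro w hw
    rw [tendsto_pi_nhds] at hlim ⊢
    intro p
    have h1 : Filter.Tendsto (fun n => w (φ n) p - x (φ n) p) Filter.atTop (nhds 0) :=
      squeeze_zero_norm (fun n => hw (φ n) p) h0
    simpa using h1.add (hlim p)
  refine ⟨a, ha, fun k => le_antisymm ?_ ?_⟩
  · exact le_of_tendsto' (((hF k).tendsto a).comp (hlim' (fun n => z n k) fun n => hz n k))
      fun n => hz0 (φ n) k
  · exact ge_of_tendsto' (((hF k).tendsto a).comp (hlim' (fun n => y n k) fun n => hy n k))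
      fun n => hy0 (φ n) k

end Continuous

section Equipartition

variable {β : Type*} [Fintype β]

lemma sum_prod_signs_mul (w w' : β → ℤˣ) :
    ∑ S : Finset β, (((∏ i ∈ S, w i : ℤˣ) : ℤ) : ℝ) * (((∏ i ∈ S, w' i : ℤˣ) : ℤ) : ℝ) =
      if w = w' then 2 ^ Fintype.card β else 0 := by
  have h : ∑ S : Finset β, (((∏ i ∈ S, w i : ℤˣ) : ℤ) : ℝ) * (((∏ i ∈ S, w' i : ℤˣ) : ℤ) : ℝ) =
      ∏ i, (1 + ((w i : ℤ) : ℝ) * ((w' i : ℤ) : ℝ)) := by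
    rw [Finset.prod_one_add, Finset.powerset_univ]
    refine Finset.sum_congr rfl fun S _ => ?_
    push_cast
    rw [Finset.prod_mul_distrib]
  rw [h]
  split_ifs with hw
  · subst hw
    rw [Finset.prod_congr rfl fun i _ => (?_ : _ = (2 : ℝ))]
    · simp
    · rcases Int.units_eq_one_or (w i) with h | h <;> rw [h] <;> norm_num
  · obtain ⟨i, hi⟩ := Function.ne_iff.1 hw
    refine Finset.prod_eq_zero (Finset.mem_univ i) ?_
    rcases Int.units_eq_one_or (w i) with h1 | h1 <;>
      rcases Int.units_eq_one_or (w' i) with h2 | h2 <;> rw [h1, h2] at hi ⊢ <;> simp at hi ⊢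

variable [LinearOrder β]

/-- The block in which a nonempty set of indices ends. -/
def lastBlock (S : {S : Finset β // S.Nonempty}) : β := S.1.max' S.2

/-- Functions indexed by sign vectors and permuted by the negations of blocks
take all the same value somewhere on a product of boundaries of cubes. -/
theorem exists_equal_values
    {H : (β → ℤˣ) → ({S : Finset β // S.Nonempty} ⊕ β → ℝ) → ℝ} (hH : ∀ w, Continuous (H w))
    (hneg : ∀ w i x, H w (negBlock (Sum.elim lastBlock id) i x) = H (w * Pi.mulSingle i (-1)) x) :
    ∃ x ∈ cubeBoundaries (Sum.elim (lastBlock (β := β)) id), ∀ w,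
      2 ^ Fintype.card β * H w x = ∑ w', H w' x := by
  let G : Finset β → ({S : Finset β // S.Nonempty} ⊕ β → ℝ) → ℝ := fun S x =>
    ∑ w, (((∏ i ∈ S, w i : ℤˣ) : ℤ) : ℝ) * H w x
  obtain ⟨x, hx, h0⟩ := exists_common_zero (b := lastBlock (β := β)) (χ := fun S => S.1)
    (F := fun S => G S.1) (fun S => S.1.max'_mem S.2) (fun S i hi => S.1.le_max' i hi)
    (fun S => by dsimp only [G]; fun_prop) (fun S i x => by
      simp only [G]
      rw [Finset.mul_sum, ← Equiv.sum_comp (Equiv.mulRight (Pi.mulSingle i (-1) : β → ℤˣ))]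
      refine Finset.sum_congr rfl fun w _ => ?_
      have hinv : w * Pi.mulSingle i (-1) * Pi.mulSingle i (-1) = w := by
        rw [mul_assoc, ← Pi.mulSingle_mul]
        simp
      simp only [Equiv.coe_mulRight, hneg, hinv]
      have : ∏ j ∈ S.1, (w * Pi.mulSingle i (-1) : β → ℤˣ) j =
          (∏ j ∈ S.1, w j) * if i ∈ S.1 then -1 else 1 := by
        simp only [Pi.mul_apply]
        simp only [Finset.prod_mul_distrib, Pi.mulSingle_apply, Finset.prod_ite_eq']
      rw [this]
      split_ifs <;> simp)
  refine ⟨x, hx, fun w => ?_⟩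
  have hG : ∑ S : Finset β, (((∏ i ∈ S, w i : ℤˣ) : ℤ) : ℝ) * G S x = G ∅ x := by
    rw [Finset.sum_eq_single ∅]
    · simp
    · intro S _ hS
      rw [h0 ⟨S, Finset.nonempty_iff_ne_empty.2 hS⟩, mul_zero]
    · simp
  have hG' : ∑ S : Finset β, (((∏ i ∈ S, w i : ℤˣ) : ℤ) : ℝ) * G S x =
      2 ^ Fintype.card β * H w x := by
    simp only [G, Finset.mul_sum]
    rw [Finset.sum_comm]
    simp only [← mul_assoc, ← Finset.sum_mul, sum_prod_signs_mul]
    rw [Finset.sum_eq_single w] <;> simp +contextual [eq_comm]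
  rw [← hG', hG]
  simp [G]

/-- If on each of finitely many curves, given by sequences of points, at most `K` sign vectors are
realised, then for some parameter each sign vector is realised on few curves. -/
theorem exists_few_meeting_sign_cells {P α : Type*} [Fintype α] {K : ℕ} (pts : α → ℕ → P)
    {g : β → ({S : Finset β // S.Nonempty} ⊕ β → ℝ) → P → ℝ}
    (hg : ∀ i p, Continuous fun x => g i x p)
    (hneg : ∀ i j x p, g i (negBlock (Sum.elim lastBlock id) j x) p =
      if i = j then -g i x p else g i x p)
    (hK : ∀ x ∈ cubeBoundaries (Sum.elim (lastBlock (β := β)) id), ∀ l,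
      (Finset.univ.filter fun w : β → ℤˣ =>
        ∃ q, ∀ i, 0 < ((w i : ℤ) : ℝ) * g i x (pts l q)).card ≤ K) :
    ∃ x ∈ cubeBoundaries (Sum.elim (lastBlock (β := β)) id), ∀ w : β → ℤˣ,
      2 ^ Fintype.card β * ((Finset.univ.filter fun l : α =>
        ∃ q, ∀ i, 0 < ((w i : ℤ) : ℝ) * g i x (pts l q)).card : ℝ) ≤ Fintype.card α * K := by
  let T : (β → ℤˣ) → ({S : Finset β // S.Nonempty} ⊕ β → ℝ) → α → ℕ → ℝ := fun w x l q =>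
    ∏ i, max (((w i : ℤ) : ℝ) * g i x (pts l q)) 0
  have hT : ∀ w l q, Continuous fun x => T w x l q := fun w l q => by
    have := fun i => hg i (pts l q)
    dsimp only [T]
    fun_prop
  have hT0 : ∀ w x l q, 0 ≤ T w x l q := fun w x l q =>
    Finset.prod_nonneg fun i _ => le_max_right _ _
  have hTpos : ∀ w x l q, 0 < T w x l q ↔ ∀ i, 0 < ((w i : ℤ) : ℝ) * g i x (pts l q) := by
    intro w x l q
    constructor
    · intro h i
      by_contra! hi
      exact h.ne' (Finset.prod_eq_zero (Finset.mem_univ i) (max_eq_right hi))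
    · intro h
      exact Finset.prod_pos fun i _ => lt_max_of_lt_left (h i)
  let U : ℕ → (β → ℤˣ) → ({S : Finset β // S.Nonempty} ⊕ β → ℝ) → α → ℝ := fun M w x l =>
    min 1 (M * ∑ q ∈ Finset.range M, T w x l q)
  have hU0 : ∀ M w x l, 0 ≤ U M w x l := fun M w x l =>
    le_min zero_le_one (mul_nonneg M.cast_nonneg (Finset.sum_nonneg fun q _ => hT0 w x l q))
  have hM : ∀ M : ℕ, ∃ x ∈ cubeBoundaries (Sum.elim (lastBlock (β := β)) id), ∀ w,
      2 ^ Fintype.card β * ∑ l, U M w x l ≤ Fintype.card α * K := by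
    intro M
    obtain ⟨x, hx, h⟩ := exists_equal_values (β := β) (H := fun w x => ∑ l, U M w x l)
      (fun w => by dsimp only [U]; fun_prop) (fun w j x => by
        have : ∀ l q, T w (negBlock (Sum.elim lastBlock id) j x) l q =
            T (w * Pi.mulSingle j (-1)) x l q := by
          intro l q
          refine Finset.prod_congr rfl fun i _ => ?_
          rw [hneg]
          by_cases hij : i = j
          · subst hij
            simp
          · simp [hij]
        simp only [U, this])
    refine ⟨x, hx, fun w => ?_⟩
    rw [h w, Finset.sum_comm]
    refine (Finset.sum_le_card_nsmul _ _ (K : ℝ) fun l _ => ?_).trans (by simp)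
    refine le_trans ?_ (Nat.cast_le.2 (hK x hx l))
    rw [Finset.card_filter, Nat.cast_sum]
    refine Finset.sum_le_sum fun w _ => ?_
    split_ifs with hw
    · simp [U]
    · have : ∀ q, T w x l q = 0 := fun q => by
        refine le_antisymm ?_ (hT0 w x l q)
        by_contra! hq
        exact hw ⟨q, (hTpos w x l q).1 hq⟩
      simp [U, this]
  choose x hx hxM using hM
  obtain ⟨a, ha, φ, hφ, hlim⟩ := (isCompact_cubeBoundaries _).tendsto_subseq hx
  refine ⟨a, ha, fun w => ?_⟩
  have hev : ∀ l ∈ Finset.univ.filter fun l : α => ∃ q, ∀ i, 0 < ((w i : ℤ) : ℝ) * g i a (pts l q),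
      ∀ᶠ n in Filter.atTop, 1 ≤ U (φ n) w (x (φ n)) l := by
    intro l hl
    obtain ⟨q, hq⟩ := (Finset.mem_filter.1 hl).2
    rw [← hTpos] at hq
    have h1 := ((hT w l q).tendsto a).comp hlim
    have h2 := h1.eventually_const_lt (half_lt_self hq)
    have h3 := (tendsto_natCast_atTop_atTop (R := ℝ)).comp hφ.tendsto_atTop
    filter_upwards [h2, h3.eventually_ge_atTop (2 / T w a l q),
      hφ.tendsto_atTop.eventually_gt_atTop q] with n h4 h5 h6
    refine le_min le_rfl ?_
    have h7 : T w (x (φ n)) l q ≤ ∑ q ∈ Finset.range (φ n), T w (x (φ n)) l q :=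
      Finset.single_le_sum (f := fun q => T w (x (φ n)) l q) (fun q _ => hT0 _ _ _ q)
        (Finset.mem_range.2 h6)
    calc (1 : ℝ) = 2 / T w a l q * (T w a l q / 2) := by field_simp
      _ ≤ _ := mul_le_mul h5 (h4.le.trans h7) (by positivity) (Nat.cast_nonneg _)
  obtain ⟨n, hn⟩ := ((Filter.eventually_all_finset _).2 hev).exists
  refine le_trans ?_ (hxM (φ n) w)
  gcongr
  rw [← nsmul_one, ← Finset.sum_const]
  exact (Finset.sum_le_sum hn).trans (Finset.sum_le_univ_sum_of_nonneg fun l => hU0 _ _ _ l)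

end Equipartition

section Lines

open Polynomial in
lemma card_signs_le {β : Type*} [Fintype β] [DecidableEq β] (r : β → ℝ[X]) :
    (Finset.univ.filter fun w : β → ℤˣ => ∃ t, ∀ i, 0 < ((w i : ℤ) : ℝ) * (r i).eval t).card ≤
      ∑ i, (r i).natDegree + 1 := by
  set A := Finset.univ.filter fun w : β → ℤˣ => ∃ t, ∀ i, 0 < ((w i : ℤ) : ℝ) * (r i).eval t
  have hA : ∀ w : A, ∃ t, ∀ i, 0 < ((w.1 i : ℤ) : ℝ) * (r i).eval t :=
    fun w => (Finset.mem_filter.1 w.2).2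
  choose τ hτ using hA
  by_cases h0 : ∏ i, r i = 0
  · obtain ⟨i, -, hi⟩ := Finset.prod_eq_zero_iff.1 h0
    have : A = ∅ := Finset.eq_empty_of_forall_notMem fun w hw => by simpa [hi] using hτ ⟨w, hw⟩ i
    simp [this]
  have hroot : ∀ w w', τ w < τ w' → w ≠ w' →
      ∃ z ∈ (∏ i, r i).roots.toFinset, τ w < z ∧ z < τ w' := by
    intro w w' hlt hne
    obtain ⟨i, hi⟩ := Function.ne_iff.1 (Subtype.coe_injective.ne hne)
    have h1 := hτ w i
    have h2 := hτ w' i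
    have hneg : ((w'.1 i : ℤ) : ℝ) = -((w.1 i : ℤ) : ℝ) := by
      rcases Int.units_eq_one_or (w.1 i) with h | h <;>
        rcases Int.units_eq_one_or (w'.1 i) with h' | h' <;> rw [h, h'] at hi ⊢ <;> simp at hi ⊢
    rw [hneg] at h2
    have hc : ContinuousOn (fun t => ((w.1 i : ℤ) : ℝ) * (r i).eval t) (Set.Icc (τ w) (τ w')) := by
      fun_prop
    obtain ⟨z, hz, hz0⟩ := intermediate_value_Ioo' hlt.le hc ⟨by linarith, h1⟩
    refine ⟨z, ?_, hz.1, hz.2⟩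
    rw [Multiset.mem_toFinset, mem_roots h0, IsRoot, eval_prod]
    refine Finset.prod_eq_zero (Finset.mem_univ i) ((mul_eq_zero.1 hz0).resolve_left ?_)
    exact_mod_cast (w.1 i).ne_zero
  have hinj : Function.Injective τ := by
    intro w w' h
    refine Subtype.ext (funext fun i => ?_)
    have h1 := hτ w i
    have h2 := hτ w' i
    rw [h] at h1
    rcases Int.units_eq_one_or (w.1 i) with h | h <;>
      rcases Int.units_eq_one_or (w'.1 i) with h' | h' <;> rw [h, h'] <;>
      rw [h] at h1 <;> rw [h'] at h2 <;> push_cast at h1 h2 <;> linarith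
  have hcard := Finset.card_le_of_interleaved (s := Finset.univ.image τ)
    (t := (∏ i, r i).roots.toFinset) (by
      intro a ha b hb hab _
      obtain ⟨w, -, rfl⟩ := Finset.mem_image.1 ha
      obtain ⟨w', -, rfl⟩ := Finset.mem_image.1 hb
      exact hroot w w' hab fun h => hab.ne (by rw [h]))
  rw [Finset.card_image_of_injective _ hinj, Finset.card_univ, Fintype.card_coe] at hcard
  calc A.card ≤ (∏ i, r i).roots.toFinset.card + 1 := hcard
    _ ≤ _ := by
      gcongr
      exact (Multiset.toFinset_card_le _).trans ((card_roots' _).trans (natDegree_prod_le _ _))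

lemma exists_polynomial_eval_line (f : MvPolynomial (Fin 3) ℝ) (p v : Fin 3 → ℝ) :
    ∃ r : Polynomial ℝ, r.natDegree ≤ f.totalDegree ∧
      ∀ t : ℝ, r.eval t = MvPolynomial.eval (p + t • v) f := by
  refine ⟨MvPolynomial.aeval (fun j => Polynomial.C (p j) + Polynomial.X * Polynomial.C (v j)) f,
    ?_, fun t => ?_⟩
  · refine (MvPolynomial.aeval_natDegree_le f le_rfl _ (n := 1) fun j => ?_).trans (by simp)
    compute_degree
  · rw [← Polynomial.coe_evalRingHom, MvPolynomial.aeval_def, MvPolynomial.hom_eval₂,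
      MvPolynomial.eval, MvPolynomial.coe_eval₂Hom]
    congr 1
    · ext; simp
    · funext j; simp; ring

lemma mul_pos_of_isPreconnected {X : Type*} [TopologicalSpace X] {C : Set X}
    (hC : IsPreconnected C) {f : X → ℝ} (hf : ContinuousOn f C) (h0 : ∀ x ∈ C, f x ≠ 0) {x y : X}
    (hx : x ∈ C) (hy : y ∈ C) : 0 < f x * f y := by
  by_contra! h
  have hxy := mul_ne_zero (h0 x hx) (h0 y hy)
  rcases (h0 x hx).lt_or_gt with h1 | h1
  · have h2 : 0 ≤ f y := by
      by_contra! h2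
      exact absurd (mul_pos_of_neg_of_neg h1 h2) h.not_gt
    obtain ⟨z, hz, hz0⟩ := hC.intermediate_value hx hy hf ⟨h1.le, h2⟩
    exact h0 z hz hz0
  · have h2 : f y ≤ 0 := by
      by_contra! h2
      exact absurd (mul_pos h1 h2) h.not_gt
    obtain ⟨z, hz, hz0⟩ := hC.intermediate_value hy hx hf ⟨h2, h1.le⟩
    exact h0 z hz hz0

/-- Partitioning by the product of one member of each of several linear systems of polynomials,
the `i`-th of them being spanned by the monomials with exponents `m q`, `q` in the block `i`. -/
theorem exists_partitioning_of_monomials {β : Type*} [Fintype β] [LinearOrder β]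
    (m : {S : Finset β // S.Nonempty} ⊕ β → Fin 3 →₀ ℕ)
    (hm : ∀ q q', Sum.elim lastBlock id q = Sum.elim lastBlock id q' → m q = m q' → q = q')
    {d : β → ℕ} (hd : ∀ q, (m q).degree ≤ d (Sum.elim lastBlock id q))
    {N : ℕ} {L : Fin N → Set (Fin 3 → ℝ)} (hL : ∀ i, IsLine (L i)) :
    ∃ f : MvPolynomial (Fin 3) ℝ, f ≠ 0 ∧ f.totalDegree ≤ ∑ i, d i ∧
      ∀ x, MvPolynomial.eval x f ≠ 0 →
        2 ^ Fintype.card β * ((Finset.univ.filter fun i =>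
          (L i ∩ connectedComponentIn {p | MvPolynomial.eval p f ≠ 0} x).Nonempty).card : ℝ) ≤
        N * (∑ i, d i + 1 : ℕ) := by
  choose p v hv hpv using hL
  let F : β → ({S : Finset β // S.Nonempty} ⊕ β → ℝ) → MvPolynomial (Fin 3) ℝ := fun i x =>
    ∑ q with Sum.elim lastBlock id q = i, MvPolynomial.monomial (m q) (x q)
  have hFd : ∀ i x, (F i x).totalDegree ≤ d i := by
    intro i x
    refine MvPolynomial.totalDegree_finsetSum_le fun q hq => ?_
    refine (MvPolynomial.totalDegree_monomial_le _ _).trans ?_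
    rw [← (Finset.mem_filter.1 hq).2]
    exact hd q
  have hF0 : ∀ i, ∀ x ∈ cubeBoundaries (Sum.elim lastBlock id), F i x ≠ 0 := by
    intro i x hx h
    obtain ⟨q, hq, hq1⟩ := hx.2 i
    have := congrArg (MvPolynomial.coeff (m q)) h
    simp only [F, MvPolynomial.coeff_sum, MvPolynomial.coeff_monomial,
      MvPolynomial.coeff_zero] at this
    rw [Finset.sum_eq_single q, if_pos rfl] at this
    · rw [this] at hq1
      simp at hq1
    · intro q' hq' hne
      rw [if_neg]
      exact fun h' => hne (hm _ _ ((Finset.mem_filter.1 hq').2.trans hq.symm) h')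
    · intro h'
      exact absurd (Finset.mem_filter.2 ⟨Finset.mem_univ q, hq⟩) h'
  obtain ⟨a, ha, hcard⟩ := exists_few_meeting_sign_cells (K := ∑ i, d i + 1)
    (fun (l : Fin N) q => p l + TopologicalSpace.denseSeq ℝ q • v l)
    (g := fun i x y => MvPolynomial.eval y (F i x))
    (fun i y => by
      simp only [F, map_sum, MvPolynomial.eval_monomial]
      fun_prop)
    (fun i j x y => by
      simp only [F, map_sum, MvPolynomial.eval_monomial, negBlock]
      by_cases hij : i = j
      · subst hij
        rw [if_pos rfl, ← Finset.sum_neg_distrib]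
        refine Finset.sum_congr rfl fun q hq => ?_
        rw [if_pos (Finset.mem_filter.1 hq).2, neg_mul]
      · rw [if_neg hij]
        refine Finset.sum_congr rfl fun q hq => ?_
        rw [if_neg]
        rwa [(Finset.mem_filter.1 hq).2])
    (fun x hx l => by
      choose r hrd hr using fun i => exists_polynomial_eval_line (F i x) (p l) (v l)
      refine le_trans (Finset.card_le_card ?_) ((card_signs_le r).trans ?_)
      · intro w hw
        obtain ⟨q, hq⟩ := (Finset.mem_filter.1 hw).2
        exact Finset.mem_filter.2 ⟨Finset.mem_univ w, _, fun i => by rw [hr]; exact hq i⟩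
      · gcongr with i
        exact (hrd i).trans (hFd i x))
  refine ⟨∏ i, F i a, Finset.prod_ne_zero_iff.2 fun i _ => hF0 i a ha,
    (MvPolynomial.totalDegree_finsetProd _ _).trans (Finset.sum_le_sum fun i _ => hFd i a),
    fun x hx => ?_⟩
  have hw : ∀ i, ∃ w : ℤˣ, ∀ z, 0 < MvPolynomial.eval x (F i a) * z → 0 < ((w : ℤ) : ℝ) * z := by
    intro i
    rcases lt_or_ge (MvPolynomial.eval x (F i a)) 0 with h | h
    · refine ⟨-1, fun z hz => ?_⟩
      have := neg_of_mul_pos_right hz h.le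
      push_cast
      linarith
    · refine ⟨1, fun z hz => ?_⟩
      have := pos_of_mul_pos_right hz h
      push_cast
      linarith
  choose w hw using hw
  have hle := hcard w
  rw [Fintype.card_fin] at hle
  refine le_trans ?_ hle
  gcongr with l _
  rintro ⟨y, hyL, hyC⟩
  rw [hpv] at hyL
  obtain ⟨t, rfl⟩ := hyL
  set C := connectedComponentIn {p | MvPolynomial.eval p (∏ i, F i a) ≠ 0} x
  have hC0 : ∀ z ∈ C, ∀ i, MvPolynomial.eval z (F i a) ≠ 0 := by
    intro z hz i
    have := connectedComponentIn_subset _ _ hz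
    rw [Set.mem_ofPred_eq, map_prod, Finset.prod_ne_zero_iff] at this
    exact this i (Finset.mem_univ i)
  have hpos : ∀ i, 0 < ((w i : ℤ) : ℝ) * MvPolynomial.eval (p l + t • v l) (F i a) := fun i =>
    hw i _ (mul_pos_of_isPreconnected isPreconnected_connectedComponentIn
      (MvPolynomial.continuous_eval (F i a)).continuousOn (fun z hz => hC0 z hz i)
      (mem_connectedComponentIn hx) hyC)
  have hopen : IsOpen {t : ℝ | ∀ i,
      0 < ((w i : ℤ) : ℝ) * MvPolynomial.eval (p l + t • v l) (F i a)} := by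
    simp only [Set.ofPred_forall]
    refine isOpen_iInter_of_finite fun i => isOpen_lt continuous_const
      (continuous_const.mul ((MvPolynomial.continuous_eval (F i a)).comp ?_))
    fun_prop
  exact (TopologicalSpace.denseRange_denseSeq ℝ).exists_mem_open hopen ⟨t, hpos⟩

end Lines

section Monomials

lemma card_block_le {s : ℕ} (i : Fin s) :
    Fintype.card {q : {S : Finset (Fin s) // S.Nonempty} ⊕ Fin s //
      Sum.elim lastBlock id q = i} ≤ 2 ^ (i : ℕ) + 1 := by
  let e : {q : {S : Finset (Fin s) // S.Nonempty} ⊕ Fin s // Sum.elim lastBlock id q = i} →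
      Option (Finset.Iio i).powerset := fun q => match q with
    | ⟨.inl S, h⟩ => some ⟨S.1.erase i, Finset.mem_powerset.2 fun j hj => by
        rw [Finset.mem_erase] at hj
        exact Finset.mem_Iio.2 (lt_of_le_of_ne (h ▸ S.1.le_max' j hj.2) hj.1)⟩
    | ⟨.inr _, _⟩ => none
  have he : Function.Injective e := by
    rintro ⟨S | j, h⟩ ⟨S' | j', h'⟩ heq
    · simp only [e, Option.some.injEq, Subtype.mk.injEq] at heq
      have hi : i ∈ S.1 := h ▸ S.1.max'_mem S.2
      have hi' : i ∈ S'.1 := h' ▸ S'.1.max'_mem S'.2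
      have : S = S' := Subtype.ext (by
        rw [← Finset.insert_erase hi, ← Finset.insert_erase hi', heq])
      subst this
      rfl
    · simp [e] at heq
    · simp [e] at heq
    · have : j = j' := h.trans h'.symm
      subst this
      rfl
  refine (Fintype.card_le_of_injective e he).trans ?_
  rw [Fintype.card_option, Fintype.card_coe, Finset.card_powerset, Fin.card_Iio]

lemma exists_monomials (s : ℕ) :
    ∃ m : {S : Finset (Fin s) // S.Nonempty} ⊕ Fin s → Fin 3 →₀ ℕ,
      (∀ q q', Sum.elim lastBlock id q = Sum.elim lastBlock id q' → m q = m q' → q = q') ∧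
      ∀ q, (m q).degree ≤ 3 * 2 ^ (((Sum.elim lastBlock id q : Fin s) + 2 : ℕ) / 3) := by
  have h : ∀ i : Fin s, Nonempty ({q : {S : Finset (Fin s) // S.Nonempty} ⊕ Fin s //
      Sum.elim lastBlock id q = i} ↪ (Fin 3 → Fin (2 ^ (((i : ℕ) + 2) / 3) + 1))) := by
    intro i
    refine Function.Embedding.nonempty_of_card_le ((card_block_le i).trans ?_)
    rw [Fintype.card_fun, Fintype.card_fin, Fintype.card_fin]
    have h1 : 2 ^ (i : ℕ) ≤ (2 ^ (((i : ℕ) + 2) / 3)) ^ 3 := by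
      rw [← pow_mul]
      exact Nat.pow_le_pow_right two_pos (by omega)
    nlinarith [Nat.zero_le (2 ^ (((i : ℕ) + 2) / 3))]
  let e := fun i => (h i).some
  refine ⟨fun q => Finsupp.equivFunOnFinite.symm fun j => e _ ⟨q, rfl⟩ j, ?_, ?_⟩
  · intro q q' hq heq
    have key : ∀ i i' (hi : Sum.elim lastBlock id q = i) (hi' : Sum.elim lastBlock id q' = i'),
        i = i' → (∀ j, (e i ⟨q, hi⟩ j : ℕ) = e i' ⟨q', hi'⟩ j) → q = q' := by
      rintro i _ hi hi' rfl hj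
      exact congrArg Subtype.val ((e i).injective (funext fun j => Fin.ext (hj j)))
    exact key _ _ rfl rfl hq fun j => by simpa using DFunLike.congr_fun heq j
  · intro q
    rw [Finsupp.degree_eq_sum]
    refine (Finset.sum_le_card_nsmul _ _ (2 ^ (((Sum.elim lastBlock id q : Fin s) + 2 : ℕ) / 3))
      fun j _ => ?_).trans (by simp)
    simp only [Finsupp.equivFunOnFinite_symm_apply_apply]
    exact Nat.lt_succ_iff.1 (Fin.is_lt _)

lemma sum_degree_le (t : ℕ) :
    ∑ i : Fin (3 * t), 3 * 2 ^ (((i : ℕ) + 2) / 3) + 15 = 15 * 2 ^ t := by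
  rw [Fin.sum_univ_eq_sum_range fun i => 3 * 2 ^ ((i + 2) / 3)]
  induction t with
  | zero => simp
  | succ t ih =>
    rw [show 3 * (t + 1) = 3 * t + 1 + 1 + 1 by ring, Finset.sum_range_succ, Finset.sum_range_succ,
      Finset.sum_range_succ, show (3 * t + 2) / 3 = t by omega,
      show (3 * t + 1 + 2) / 3 = t + 1 by omega, show (3 * t + 1 + 1 + 2) / 3 = t + 1 by omega]
    rw [pow_succ]
    omega

end Monomials

/-- **Guth's polynomial partitioning for lines.** There is an absolute
constant `c > 0` such that for every finite set of `N` lines in `ℝ³` and every integer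
`1 ≤ D ≤ √(cN)` there is a nonzero polynomial `f ∈ ℝ[x,y,z]` of degree at most `D` such
that every connected component of `ℝ³ \ Z(f)` meets at most `cN/D²` of the lines. -/
theorem polynomial_partitioning_for_lines :
    ∃ c : ℝ, 0 < c ∧
      ∀ (N : ℕ) (L : Fin N → Set (Fin 3 → ℝ)), (∀ i, IsLine (L i)) →
        Function.Injective L →
        ∀ D : ℕ, 1 ≤ D → (D : ℝ) ≤ Real.sqrt (c * N) →
          ∃ f : MvPolynomial (Fin 3) ℝ, f ≠ 0 ∧ f.totalDegree ≤ D ∧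
            ∀ x : Fin 3 → ℝ, MvPolynomial.eval x f ≠ 0 →
              ((Finset.univ.filter fun i =>
                  (L i ∩ connectedComponentIn {p | MvPolynomial.eval p f ≠ 0} x).Nonempty).card : ℝ)
                ≤ c * N / (D : ℝ) ^ 2 := by
  refine ⟨54000, by norm_num, fun N L hL _ D hD1 _ => ?_⟩
  have hD0 : (0 : ℝ) < D := by exact_mod_cast hD1
  by_cases hD : D < 15
  · refine ⟨1, one_ne_zero, by simp, fun x _ => ?_⟩
    have h1 : ((Finset.univ.filter fun i => (L i ∩ connectedComponentIn
        {p | MvPolynomial.eval p (1 : MvPolynomial (Fin 3) ℝ) ≠ 0} x).Nonempty).card : ℝ) ≤ N := by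
      exact_mod_cast (Finset.card_filter_le _ _).trans (by simp)
    refine h1.trans ?_
    rw [le_div_iff₀ (by positivity)]
    have h2 : (D : ℝ) ≤ 15 := by exact_mod_cast hD.le
    have h3 : (D : ℝ) ^ 2 ≤ 54000 := by nlinarith
    nlinarith [(Nat.cast_nonneg N : (0 : ℝ) ≤ N)]
  · push Not at hD
    set t := Nat.log 2 (D / 15)
    have ht1 : 2 ^ t ≤ D / 15 := Nat.pow_log_le_self 2 (by omega)
    have ht2 : D / 15 < 2 ^ (t + 1) := Nat.lt_pow_succ_log_self one_lt_two _
    have hdeg := sum_degree_le t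
    obtain ⟨m, hm, hmd⟩ := exists_monomials (3 * t)
    obtain ⟨f, hf0, hfd, hf⟩ := exists_partitioning_of_monomials m hm
      (d := fun i => 3 * 2 ^ (((i : ℕ) + 2) / 3)) hmd hL
    refine ⟨f, hf0, hfd.trans (by omega), fun x hx => ?_⟩
    have hle := hf x hx
    rw [Fintype.card_fin, pow_mul'] at hle
    set A : ℝ := (2 : ℝ) ^ t
    have hA : (D : ℝ) ≤ 30 * A := by
      have : D ≤ 30 * 2 ^ t := by rw [pow_succ] at ht2; omega
      simp only [A]
      exact_mod_cast this
    have hA0 : 0 < A := by positivity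
    have hS : ((∑ i : Fin (3 * t), 3 * 2 ^ (((i : ℕ) + 2) / 3) + 1 : ℕ) : ℝ) ≤ 15 * A := by
      have : ∑ i : Fin (3 * t), 3 * 2 ^ (((i : ℕ) + 2) / 3) + 1 ≤ 15 * 2 ^ t := by omega
      simp only [A]
      exact_mod_cast this
    set k : ℝ := ((Finset.univ.filter fun i => (L i ∩ connectedComponentIn
        {p | MvPolynomial.eval p f ≠ 0} x).Nonempty).card : ℝ)
    have hk0 : 0 ≤ k := Nat.cast_nonneg _
    have hN0 : (0 : ℝ) ≤ N := Nat.cast_nonneg _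
    have h1 : A * (A ^ 2 * k) ≤ A * (15 * N) := by
      have := hle.trans (mul_le_mul_of_nonneg_left hS hN0)
      linarith
    have h2 := le_of_mul_le_mul_left h1 hA0
    rw [le_div_iff₀ (by positivity)]
    have h3 : (D : ℝ) ^ 2 ≤ (30 * A) ^ 2 := by gcongr
    nlinarith [mul_le_mul_of_nonneg_left h3 hk0]
end

section
/- Let T be a finite collection of pairwise disjoint non-vertical triangles in ℝ³. For each Δ ∈ T let Γ_Δ be a finite collection of closed subsets ('curves') of Δ, let O_Δ be the set of connected components of (relative interior of Δ) \ ⋃Γ_Δ, and put O = ⋃_{Δ∈T} O_Δ. Given a cycle Δ₁ ≺ Δ₂ ≺ ⋯ ≺ Δ_k ≺ Δ₁ in (T, ≺), a witness path for it consists of points v_i⁻, v_i⁺ ∈ Δ_i and continuous paths π_i inside Δ_i from v_i⁻ to v_i⁺, for i = 1,…,k, such that for each i (indices mod k) the segment from v_i⁺ to v_{i+1}⁻ is vertical and v_i⁺ has strictly smaller z-coordinate than v_{i+1}⁻. If for every cycle in (T, ≺) and every witness path π for it, at least one of the on-triangle subpaths π_i of π intersects ⋃Γ_{Δ_i}, then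 the depth relation ≺ on O is acyclic. -/
/-- A set in `ℝ³` is a non-vertical triangle if it is the convex hull of three affinely
independent points whose spanning plane is not parallel to the `z`-axis. -/
def IsNonVerticalTriangle (s : Set (Fin 3 → ℝ)) : Prop :=
  ∃ a b c : Fin 3 → ℝ, AffineIndependent ℝ ![a, b, c] ∧
    s = convexHull ℝ {a, b, c} ∧
    (![0, 0, 1] : Fin 3 → ℝ) ∉ (affineSpan ℝ ({a, b, c} : Set (Fin 3 → ℝ))).direction

/-- The depth relation: `o₁ ≺ o₂` if some vertical line meets both sets, with the
intersection with `o₁` lower (in `z`-coordinate) than the intersection with `o₂`. -/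
def Below (o₁ o₂ : Set (Fin 3 → ℝ)) : Prop :=
  ∃ p ∈ o₁, ∃ q ∈ o₂, p 0 = q 0 ∧ p 1 = q 1 ∧ p 2 < q 2

/-- The depth relation on a collection `O` of pieces is acyclic: there is no cyclic
sequence `o₀ ≺ o₁ ≺ ⋯ ≺ o_k ≺ o₀` of members of `O`. -/
def DepthAcyclic (O : Set (Set (Fin 3 → ℝ))) : Prop :=
  ¬ ∃ (k : ℕ) (o : Fin (k + 1) → Set (Fin 3 → ℝ)),
      (∀ i, o i ∈ O) ∧ ∀ i, Below (o i) (o (i + 1))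

/-- A preconnected subset of a relatively open subset `V ∩ A` of a convex set `A` has any two of
its points joined by a path in `V ∩ A`. -/
theorem IsPreconnected.joinedIn_isOpen_inter_convex {E : Type*} [NormedAddCommGroup E]
    [NormedSpace ℝ E] {V A s : Set E} (hs : IsPreconnected s) (hV : IsOpen V)
    (hA : Convex ℝ A) (hsub : s ⊆ V ∩ A) {x y : E} (hx : x ∈ s) (hy : y ∈ s) :
    JoinedIn (V ∩ A) x y := by
  refine hs.induction₂ (JoinedIn (V ∩ A)) (fun z hz => ?_)
    (fun _ _ _ _ _ _ h₁ h₂ => h₁.trans h₂) (fun _ _ _ _ h => h.symm) hx hy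
  obtain ⟨ε, hε, hball⟩ := Metric.isOpen_iff.1 hV z (hsub hz).1
  filter_upwards [self_mem_nhdsWithin,
    mem_nhdsWithin_of_mem_nhds (Metric.ball_mem_nhds z hε)] with w hw hwε
  refine JoinedIn.of_segment_subset fun u hu => ⟨hball ?_, ?_⟩
  · exact (convex_ball z ε).segment_subset (Metric.mem_ball_self hε) hwε hu
  · exact hA.segment_subset (hsub hz).2 (hsub hw).2 hu

/-- The intrinsic interior is relatively open in the affine span. -/
theorem exists_isOpen_intrinsicInterior_eq_inter {E : Type*} [NormedAddCommGroup E]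
    [NormedSpace ℝ E] (s : Set E) :
    ∃ V : Set E, IsOpen V ∧ intrinsicInterior ℝ s = V ∩ (affineSpan ℝ s : Set E) := by
  obtain ⟨V, hV, h⟩ := isOpen_induced_iff.1
    (isOpen_interior (s := ((↑) : affineSpan ℝ s → E) ⁻¹' s))
  refine ⟨V, hV, ?_⟩
  rw [intrinsicInterior, ← h]
  ext z
  simp [and_comm]

/-- Points of a common component of the intrinsic interior minus a closed set are joined by a path
avoiding that closed set. -/
theorem joinedIn_intrinsicInterior_diff {E : Type*} [NormedAddCommGroup E]
    [NormedSpace ℝ E] {s F : Set E} (hF : IsClosed F) {c x y : E}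
    (hx : x ∈ connectedComponentIn (intrinsicInterior ℝ s \ F) c)
    (hy : y ∈ connectedComponentIn (intrinsicInterior ℝ s \ F) c) :
    JoinedIn (intrinsicInterior ℝ s \ F) x y := by
  obtain ⟨V, hV, h⟩ := exists_isOpen_intrinsicInterior_eq_inter s
  have heq : intrinsicInterior ℝ s \ F = (V \ F) ∩ (affineSpan ℝ s : Set E) := by
    rw [h]
    ext z
    simp only [Set.mem_sdiff, Set.mem_inter_iff]
    tauto
  have hsub := connectedComponentIn_subset (intrinsicInterior ℝ s \ F) c
  rw [heq] at hsub hx hy ⊢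
  exact isPreconnected_connectedComponentIn.joinedIn_isOpen_inter_convex (hV.sdiff hF)
    (affineSpan ℝ s).convex hsub hx hy

/-- **cutting all witness paths eliminates all cycles.**
Let `T 0, …, T (n-1)` be pairwise disjoint non-vertical triangles, let `Γ i` be a finite
collection of closed subsets ("curves") of the triangle `T i`, and let `O` consist of the
connected components of `(relative interior of T i) \ ⋃ Γ i`, over all `i`. Suppose that
for every cycle `T (ind 0) ≺ T (ind 1) ≺ ⋯ ≺ T (ind k) ≺ T (ind 0)` and every witness
path for it — points `vm i, vp i ∈ T (ind i)`, continuous paths `π i` from `vm i` to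
`vp i` inside `T (ind i)`, and vertical upward jumps from `vp i` to `vm (i+1)` — some
on-triangle subpath `π i` meets `⋃ Γ (ind i)`. Then the depth relation on `O` is
acyclic. -/
theorem cutting_witness_paths_eliminates_cycles
    (n : ℕ) (T : Fin n → Set (Fin 3 → ℝ))
    (hT : ∀ i, IsNonVerticalTriangle (T i))
    (hdisj : ∀ i j, i ≠ j → Disjoint (T i) (T j))
    (Γ : Fin n → Finset (Set (Fin 3 → ℝ)))
    (hΓ : ∀ i, ∀ γ ∈ Γ i, IsClosed γ ∧ γ ⊆ T i)
    (O : Set (Set (Fin 3 → ℝ)))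
    (hO : O = {s | ∃ (i : Fin n) (x : Fin 3 → ℝ),
        x ∈ intrinsicInterior ℝ (T i) \ ⋃₀ (↑(Γ i) : Set (Set (Fin 3 → ℝ))) ∧
        s = connectedComponentIn
              (intrinsicInterior ℝ (T i) \ ⋃₀ (↑(Γ i) : Set (Set (Fin 3 → ℝ)))) x})
    (hcut : ∀ (k : ℕ) (ind : Fin (k + 1) → Fin n)
        (vm vp : Fin (k + 1) → (Fin 3 → ℝ)) (π : ∀ i, Path (vm i) (vp i)),
        -- the triangles form a cycle in the depth relation:
        (∀ i, Below (T (ind i)) (T (ind (i + 1)))) →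
        -- each subpath `π i` runs inside the triangle `T (ind i)`:
        (∀ i t, (π i) t ∈ T (ind i)) →
        -- the jump from `vp i` to `vm (i+1)` is vertical and goes upward:
        (∀ i, vp i 0 = vm (i + 1) 0 ∧ vp i 1 = vm (i + 1) 1 ∧ vp i 2 < vm (i + 1) 2) →
        -- conclusion: some on-triangle subpath is cut by a curve of `Γ`:
        ∃ (i : Fin (k + 1)) (t : unitInterval),
          (π i) t ∈ ⋃₀ (↑(Γ (ind i)) : Set (Set (Fin 3 → ℝ)))) :
    DepthAcyclic O := by
  rintro ⟨k, o, ho, hbelow⟩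
  simp only [hO, Set.mem_ofPred_eq] at ho
  choose ind x hx hox using ho
  choose p hp q hq hpq using hbelow
  have hsub : ∀ i, o i ⊆ T (ind i) := fun i y hy => by
    rw [hox i] at hy
    exact intrinsicInterior_subset (connectedComponentIn_subset _ _ hy).1
  have hq' : ∀ i, q (i - 1) ∈ o i := fun i => by
    simpa only [sub_add_cancel] using hq (i - 1)
  have hjoin : ∀ i, JoinedIn
      (intrinsicInterior ℝ (T (ind i)) \ ⋃₀ (↑(Γ (ind i)) : Set (Set (Fin 3 → ℝ))))
      (q (i - 1)) (p i) := fun i => by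
    have hclosed : IsClosed (⋃₀ (↑(Γ (ind i)) : Set (Set (Fin 3 → ℝ)))) :=
      by
      rw [Set.sUnion_eq_biUnion]
      exact (Γ (ind i)).finite_toSet.isClosed_biUnion fun γ hγ => (hΓ (ind i) γ hγ).1
    exact joinedIn_intrinsicInterior_diff hclosed (hox i ▸ hq' i) (hox i ▸ hp i)
  obtain ⟨i, t, hit⟩ := hcut k ind (fun i => q (i - 1)) p (fun i => (hjoin i).somePath)
    (fun i => ⟨p i, hsub i (hp i), q i, hsub (i + 1) (hq i), hpq i⟩)
    (fun i t => intrinsicInterior_subset ((hjoin i).somePath_mem t).1)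
    (fun i => by simpa only [add_sub_cancel_right] using hpq i)
  exact ((hjoin i).somePath_mem t).2 hit
end

section
/- There exists an absolute constant C with the following property. Let T be a finite collection of pairwise disjoint non-vertical triangles in ℝ³ and let f ∈ ℝ[x,y,z] be a nonzero squarefree polynomial of degree at most D. Call a connected component of Δ \ Z(f), for Δ ∈ T, a slice if its closure is contained in the relative interior of Δ (i.e., it is disjoint from the edges of Δ). Then there is an ordering s₁, …, s_t of all the slices such that the number of indices i for which s_i is non-disconnecting is at most C·D³, where s_i is called non-disconnecting if U_i \ s_i is connected, U_i being the connected component of (ℝ³ \ Z(f)) \ (s₁ ∪ ⋯ ∪ s_{i−1}) that contains s_i. -/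
/-- The real zero set of a polynomial `f ∈ ℝ[x,y,z]`. -/
def ZeroSet (f : MvPolynomial (Fin 3) ℝ) : Set (Fin 3 → ℝ) :=
  {p | MvPolynomial.eval p f = 0}

section CriticalPoints

open MvPolynomial

/-- Evaluation of polynomials at the points of a finite set, as a linear map. -/
noncomputable def evalOn {σ : Type*} (P : Finset (σ → ℝ)) : MvPolynomial σ ℝ →ₗ[ℝ] (P → ℝ) :=
  LinearMap.pi fun x => (aeval (x : σ → ℝ)).toLinearMap

lemma evalOn_apply {σ : Type*} (P : Finset (σ → ℝ)) (p : MvPolynomial σ ℝ) (x : P) :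
    evalOn P p x = eval (x : σ → ℝ) p := by
  simp [evalOn, aeval_eq_eval]

lemma evalOn_surjective {σ : Type*} (P : Finset (σ → ℝ)) :
    Function.Surjective (evalOn P) := by
  classical
  have key : ∀ x : P, ∃ p, evalOn P p = Pi.single x 1 := by
    intro x
    have h : ∀ y : P, y ≠ x → ∃ p : MvPolynomial σ ℝ,
        eval (x : σ → ℝ) p = 1 ∧ eval (y : σ → ℝ) p = 0 := by
      intro y hy
      have : (y : σ → ℝ) ≠ x := fun h => hy (Subtype.ext h)
      obtain ⟨i, hi⟩ := Function.ne_iff.1 this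
      refine ⟨C ((x : σ → ℝ) i - (y : σ → ℝ) i)⁻¹ * (X i - C ((y : σ → ℝ) i)), ?_, ?_⟩
      · have : (x : σ → ℝ) i - (y : σ → ℝ) i ≠ 0 := sub_ne_zero.2 (Ne.symm hi)
        simp [this]
      · simp
    choose! p hp1 hp0 using h
    refine ⟨∏ y ∈ Finset.univ.erase x, p y, ?_⟩
    ext z
    rw [evalOn_apply, map_prod]
    by_cases hz : z = x
    · subst hz
      rw [Pi.single_eq_same]
      exact Finset.prod_eq_one fun y hy => hp1 y (Finset.ne_of_mem_erase hy)
    · rw [Pi.single_eq_of_ne hz]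
      exact Finset.prod_eq_zero (Finset.mem_erase.2 ⟨hz, Finset.mem_univ _⟩) (hp0 z hz)
  rw [← LinearMap.range_eq_top, eq_top_iff]
  intro v _
  rw [pi_eq_sum_univ' v]
  refine Submodule.sum_mem _ fun x _ => Submodule.smul_mem _ _ ?_
  obtain ⟨p, hp⟩ := key x
  refine ⟨p, hp.trans ?_⟩
  ext y
  simp [Pi.single_apply, eq_comm]

/-- A system of the form `xᵢ ^ N = qᵢ(x)` with `deg qᵢ < N` has at most `N ^ n` solutions. -/
lemma card_le_of_pow_eq {σ : Type*} [Fintype σ] (N : ℕ) (q : σ → MvPolynomial σ ℝ)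
    (hq : ∀ i, (q i).totalDegree < N) (P : Finset (σ → ℝ))
    (hP : ∀ x ∈ P, ∀ i, x i ^ N = eval x (q i)) : P.card ≤ N ^ Fintype.card σ := by
  classical
  let b : (σ → Fin N) → (P → ℝ) := fun e =>
    evalOn P (monomial (Finsupp.equivFunOnFinite.symm fun i => (e i : ℕ)) 1)
  have key : ∀ d : ℕ, ∀ p : MvPolynomial σ ℝ, p.totalDegree ≤ d →
      evalOn P p ∈ Submodule.span ℝ (Set.range b) := by
    intro d
    induction d using Nat.strong_induction_on with
    | _ d ih =>
    intro p hp
    have mono : ∀ m : σ →₀ ℕ, m.degree ≤ d →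
        evalOn P (monomial m 1) ∈ Submodule.span ℝ (Set.range b) := by
      intro m hm
      by_cases h : ∀ i, m i < N
      · refine Submodule.subset_span ⟨fun i => ⟨m i, h i⟩, ?_⟩
        simp only [b]
        congr 2
        ext i
        simp
      · push Not at h
        obtain ⟨i, hi⟩ := h
        have hms : m = Finsupp.single i N + (m - Finsupp.single i N) := by
          rw [add_tsub_cancel_of_le]
          simpa using hi
        set m' := m - Finsupp.single i N with hm'
        have hdeg : m.degree = N + m'.degree := by
          rw [hms]; simp
        have : evalOn P (monomial m 1) = evalOn P (q i * monomial m' 1) := by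
          ext x
          rw [evalOn_apply, evalOn_apply, hms, monomial_single_add, map_mul, map_mul, map_pow,
            eval_X, hP x x.2 i]
        rw [this]
        have hlt : (q i * monomial m' (1 : ℝ)).totalDegree < d := by
          refine (totalDegree_mul _ _).trans_lt ?_
          have h1 : (monomial m' (1 : ℝ)).totalDegree ≤ m'.degree := by
            rw [totalDegree_monomial _ one_ne_zero]; exact le_of_eq rfl
          have := hq i
          omega
        exact ih _ hlt _ le_rfl
    rw [p.as_sum, map_sum]
    refine Submodule.sum_mem _ fun m hm => ?_
    have : monomial m (coeff m p) = coeff m p • monomial m (1 : ℝ) := by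
      rw [smul_monomial]; simp
    rw [this, map_smul]
    exact Submodule.smul_mem _ _ (mono m ((le_totalDegree hm).trans hp))
  have htop : Submodule.span ℝ (Set.range b) = ⊤ := by
    rw [eq_top_iff]
    intro v _
    obtain ⟨p, rfl⟩ := evalOn_surjective P v
    exact key _ p le_rfl
  have := finrank_range_le_card (R := ℝ) b
  rw [Set.finrank, htop, finrank_top] at this
  simpa using this

lemma hasFDerivAt_eval {σ : Type*} [Fintype σ] (p : MvPolynomial σ ℝ) (x : σ → ℝ) :
    HasFDerivAt (fun y => eval y p)
      (∑ i, eval x (pderiv i p) • ContinuousLinearMap.proj (R := ℝ) (φ := fun _ : σ => ℝ) i) x := by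
  classical
  induction p using MvPolynomial.induction_on with
  | C a => simpa using hasFDerivAt_const a x
  | add p q hp hq =>
    refine ((hp.fun_add hq).congr_fderiv ?_).congr_of_eventuallyEq (.of_forall fun y => ?_)
    · simp [add_smul, Finset.sum_add_distrib]
    · simp
  | mul_X p i hp =>
    refine ((hp.fun_mul (hasFDerivAt_apply (𝕜 := ℝ) i x)).congr_fderiv ?_).congr_of_eventuallyEq
      (.of_forall fun y => ?_)
    · ext v
      simp [Derivation.leibniz, pderiv_X, Pi.single_apply, add_mul, Finset.sum_add_distrib,
        Finset.mul_sum, apply_ite, mul_assoc]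
    · simp

lemma totalDegree_pderiv_le {σ : Type*} (i : σ) (p : MvPolynomial σ ℝ) :
    (pderiv i p).totalDegree ≤ p.totalDegree := by
  classical
  conv_lhs => rw [p.as_sum, map_sum]
  refine totalDegree_finsetSum_le fun m hm => ?_
  rw [pderiv_monomial]
  refine (totalDegree_monomial_le _ _).trans ?_
  refine le_trans ?_ (le_totalDegree hm)
  change (m - Finsupp.single i 1).degree ≤ m.degree
  exact Finsupp.degree_mono tsub_le_self

/-- The perturbation `f² - ε (1 + ∑ xᵢ ^ (2 * D + 2)) - ∑ ℓᵢ xᵢ` of `f²`. -/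
noncomputable def pert {σ : Type*} [Fintype σ] (f : MvPolynomial σ ℝ) (D : ℕ) (ε : ℝ)
    (ℓ : σ → ℝ) : MvPolynomial σ ℝ :=
  f ^ 2 - C ε * (1 + ∑ i, X i ^ (2 * D + 2)) - ∑ i, C (ℓ i) * X i

/-- The critical points of a polynomial. -/
def critSet {σ : Type*} (h : MvPolynomial σ ℝ) : Set (σ → ℝ) :=
  {x | ∀ i, eval x (pderiv i h) = 0}

lemma eval_pert {σ : Type*} [Fintype σ] (f : MvPolynomial σ ℝ) (D : ℕ) (ε : ℝ) (ℓ x : σ → ℝ) :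
    eval x (pert f D ε ℓ) =
      eval x f ^ 2 - ε * (1 + ∑ i, x i ^ (2 * D + 2)) - ∑ i, ℓ i * x i := by
  simp [pert]

lemma eval_pderiv_pert {σ : Type*} [Fintype σ] (f : MvPolynomial σ ℝ) (D : ℕ) (ε : ℝ)
    (ℓ x : σ → ℝ) (i : σ) :
    eval x (pderiv i (pert f D ε ℓ)) =
      eval x (pderiv i (f ^ 2)) - ε * ((2 * D + 2) * x i ^ (2 * D + 1)) - ℓ i := by
  classical
  have h1 : ∀ j, pderiv i (X j ^ (2 * D + 2) : MvPolynomial σ ℝ) =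
      if j = i then (2 * (D : MvPolynomial σ ℝ) + 2) * X i ^ (2 * D + 1) else 0 := by
    intro j
    rw [pderiv_pow, pderiv_X]
    split_ifs with h
    · subst h; simp
    · simp [h]
  have h2 : ∀ j, pderiv i (C (ℓ j) * X j : MvPolynomial σ ℝ) =
      if j = i then C (ℓ i) else 0 := by
    intro j
    rw [pderiv_C_mul, pderiv_X]
    split_ifs with h
    · subst h; simp
    · simp [h]
  simp only [pert, map_sub, pderiv_C_mul, map_add, map_sum, h1, h2, pderiv_one, zero_add]
  simp [apply_ite]

lemma critSet_pert_finite {σ : Type*} [Fintype σ] {f : MvPolynomial σ ℝ} {D : ℕ}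
    (hf : f.totalDegree ≤ D) {ε : ℝ} (hε : ε ≠ 0) (ℓ : σ → ℝ) :
    (critSet (pert f D ε ℓ)).Finite ∧
      (critSet (pert f D ε ℓ)).ncard ≤ (2 * D + 1) ^ Fintype.card σ := by
  classical
  have key : ∀ P : Finset (σ → ℝ), (P : Set (σ → ℝ)) ⊆ critSet (pert f D ε ℓ) →
      P.card ≤ (2 * D + 1) ^ Fintype.card σ := by
    intro P hP
    refine card_le_of_pow_eq (2 * D + 1)
      (fun i => C (ε * (2 * D + 2))⁻¹ * (pderiv i (f ^ 2) - C (ℓ i))) (fun i => ?_) P ?_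
    · refine Nat.lt_succ_of_le ((totalDegree_mul _ _).trans ?_)
      rw [totalDegree_C, zero_add]
      refine (totalDegree_sub _ _).trans (max_le ?_ (by simp))
      refine (totalDegree_pderiv_le _ _).trans ((totalDegree_pow _ _).trans ?_)
      omega
    · intro x hx i
      have h := hP hx i
      rw [eval_pderiv_pert] at h
      have h2 : ε * (2 * D + 2) ≠ 0 := mul_ne_zero hε (by positivity)
      rw [map_mul, eval_C, map_sub, eval_C, eq_inv_mul_iff_mul_eq₀ h2]
      linarith
  have hfin : (critSet (pert f D ε ℓ)).Finite := by
    by_contra h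
    obtain ⟨P, hP, hc⟩ := Set.Infinite.exists_subset_card_eq h ((2 * D + 1) ^ Fintype.card σ + 1)
    have := key P hP
    omega
  refine ⟨hfin, ?_⟩
  rw [Set.ncard_eq_toFinset_card _ hfin]
  exact key _ (by simp)

end CriticalPoints

section Superlevel

open MvPolynomial Topology

lemma mem_critSet_iff_fderiv {σ : Type*} [Fintype σ] (h : MvPolynomial σ ℝ) (x : σ → ℝ) :
    x ∈ critSet h ↔ fderiv ℝ (fun y => eval y h) x = 0 := by
  classical
  rw [(hasFDerivAt_eval h x).fderiv]
  constructor
  · intro hx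
    refine Finset.sum_eq_zero fun i _ => ?_
    rw [hx i, zero_smul]
  · intro hx i
    have := DFunLike.congr_fun hx (Pi.single i 1)
    simpa [Pi.single_apply] using this

lemma exists_abs_eval_le {σ : Type*} [Fintype σ] {f : MvPolynomial σ ℝ} {D : ℕ}
    (hf : f.totalDegree ≤ D) : ∃ A : ℝ, 0 ≤ A ∧ ∀ x, |eval x f| ≤ A * max 1 ‖x‖ ^ D := by
  refine ⟨∑ m ∈ f.support, |coeff m f|, Finset.sum_nonneg fun _ _ => abs_nonneg _, fun x => ?_⟩
  rw [eval_eq', Finset.sum_mul]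
  refine (Finset.abs_sum_le_sum_abs _ _).trans (Finset.sum_le_sum fun m hm => ?_)
  rw [abs_mul, Finset.abs_prod]
  refine mul_le_mul_of_nonneg_left ?_ (abs_nonneg _)
  have h1 : ∏ i, |x i ^ m i| ≤ ∏ i, max 1 ‖x‖ ^ m i := by
    refine Finset.prod_le_prod (fun _ _ => abs_nonneg _) fun i _ => ?_
    rw [abs_pow]
    refine pow_le_pow_left₀ (abs_nonneg _) ?_ _
    exact (norm_le_pi_norm x i).trans (le_max_right _ _)
  refine h1.trans ?_
  rw [Finset.prod_pow_eq_pow_sum]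
  refine pow_le_pow_right₀ (le_max_left _ _) ?_
  refine le_trans (le_of_eq ?_) ((le_totalDegree hm).trans hf)
  rw [Finsupp.sum_fintype _ _ (fun _ => rfl)]

lemma isBounded_superlevel_pert {σ : Type*} [Fintype σ] [Nonempty σ] {f : MvPolynomial σ ℝ}
    {D : ℕ} (hf : f.totalDegree ≤ D) {ε : ℝ} (hε : 0 < ε) (ℓ : σ → ℝ) (c : ℝ) :
    Bornology.IsBounded {x | c ≤ eval x (pert f D ε ℓ)} := by
  obtain ⟨A, hA, hfA⟩ := exists_abs_eval_le hf
  set B : ℝ := ∑ i, |ℓ i| with hB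
  have hB0 : 0 ≤ B := Finset.sum_nonneg fun _ _ => abs_nonneg _
  set R : ℝ := (A ^ 2 + B + |c| + 1) / ε + 1 with hR
  have hR1 : 1 ≤ R := by
    have : 0 ≤ (A ^ 2 + B + |c| + 1) / ε := by positivity
    linarith
  rw [isBounded_iff_forall_norm_le]
  refine ⟨R, fun x hx => ?_⟩
  by_contra hlt
  push Not at hlt
  set M := ‖x‖ with hM
  have hM1 : 1 ≤ M := hR1.trans hlt.le
  have hf2 : eval x f ^ 2 ≤ A ^ 2 * M ^ (2 * D) := by
    have := hfA x
    rw [max_eq_right hM1] at this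
    calc eval x f ^ 2 = |eval x f| ^ 2 := (sq_abs _).symm
      _ ≤ (A * M ^ D) ^ 2 := pow_le_pow_left₀ (abs_nonneg _) this 2
      _ = _ := by ring
  have hsum : M ^ (2 * D + 2) ≤ ∑ i, x i ^ (2 * D + 2) := by
    obtain ⟨i, hi⟩ : ∃ i, ‖x‖ = ‖x i‖ := by
      obtain ⟨i, -, hi⟩ := Finset.exists_max_image Finset.univ (fun i => ‖x i‖)
        Finset.univ_nonempty
      refine ⟨i, le_antisymm ?_ (norm_le_pi_norm x i)⟩
      exact (pi_norm_le_iff_of_nonneg (norm_nonneg _)).2 fun j => hi j (Finset.mem_univ _)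
    have he : Even (2 * D + 2) := ⟨D + 1, by ring⟩
    rw [hM, hi, Real.norm_eq_abs, he.pow_abs]
    exact Finset.single_le_sum (f := fun i => x i ^ (2 * D + 2)) (fun j _ => he.pow_nonneg _)
      (Finset.mem_univ i)
  have hl : -∑ i, ℓ i * x i ≤ B * M := by
    rw [hB, Finset.sum_mul, ← Finset.sum_neg_distrib]
    refine Finset.sum_le_sum fun i _ => ?_
    calc -(ℓ i * x i) ≤ |ℓ i * x i| := neg_le_abs _
      _ = |ℓ i| * |x i| := abs_mul _ _
      _ ≤ _ := mul_le_mul_of_nonneg_left (norm_le_pi_norm x i) (abs_nonneg _)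
  have hx' : c ≤ eval x (pert f D ε ℓ) := hx
  rw [eval_pert] at hx'
  have h1 : A ^ 2 + B + |c| + 1 < ε * M := by
    have : (A ^ 2 + B + |c| + 1) / ε < M := by linarith
    rwa [div_lt_iff₀' hε] at this
  have hpow : 1 ≤ M ^ (2 * D) := one_le_pow₀ hM1
  have h2 : A ^ 2 + B * M + |c| + 1 ≤ ε * M ^ 2 := by
    nlinarith [abs_nonneg c, sq_nonneg A]
  have h3 : ε * M ^ (2 * D + 2) = M ^ (2 * D) * (ε * M ^ 2) := by ring
  have h4 : M ^ (2 * D) * (A ^ 2 + B * M + |c| + 1) ≤ M ^ (2 * D) * (ε * M ^ 2) :=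
    mul_le_mul_of_nonneg_left h2 (by positivity)
  have h5 : B * M + |c| + 1 ≤ M ^ (2 * D) * (B * M + |c| + 1) :=
    le_mul_of_one_le_left (by positivity) hpow
  have h6 : ε * M ^ (2 * D + 2) ≤ ε * ∑ i, x i ^ (2 * D + 2) :=
    mul_le_mul_of_nonneg_left hsum hε.le
  have := neg_abs_le c
  nlinarith

lemma isCompact_superlevel_pert {σ : Type*} [Fintype σ] [Nonempty σ] {f : MvPolynomial σ ℝ}
    {D : ℕ} (hf : f.totalDegree ≤ D) {ε : ℝ} (hε : 0 < ε) (ℓ : σ → ℝ) (c : ℝ) :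
    IsCompact {x | c ≤ eval x (pert f D ε ℓ)} :=
  Metric.isCompact_of_isClosed_isBounded
    (isClosed_le continuous_const (MvPolynomial.continuous_eval _))
    (isBounded_superlevel_pert hf hε ℓ c)

lemma sum_even_pow_nonneg {σ : Type*} [Fintype σ] (D : ℕ) (x : σ → ℝ) :
    0 ≤ ∑ i, x i ^ (2 * D + 2) :=
  Finset.sum_nonneg fun _ _ => Even.pow_nonneg ⟨D + 1, by ring⟩ _

/-- A family of pairwise disjoint bounded open sets whose frontiers lie in the zero set of a
polynomial, and on which the polynomial is not identically zero, is finite. -/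
lemma finite_of_frontier_subset_zeros {σ : Type*} [Fintype σ] (f : MvPolynomial σ ℝ)
    (𝒪 : Set (Set (σ → ℝ))) (hdisj : 𝒪.PairwiseDisjoint id)
    (hO : ∀ O ∈ 𝒪, IsOpen O ∧ Bornology.IsBounded O ∧ (∃ q ∈ O, eval q f ≠ 0) ∧
      ∀ x ∈ frontier O, eval x f = 0) : 𝒪.Finite := by
  classical
  set D := f.totalDegree
  by_contra hinf
  obtain ⟨P, hP, hcard⟩ := Set.Infinite.exists_subset_card_eq hinf
    ((2 * D + 1) ^ Fintype.card σ + 1)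
  choose! hopen hbdd hq hfr using hO
  choose! q hqO hqf using hq
  obtain ⟨ε, hε, hεP⟩ : ∃ ε : ℝ, 0 < ε ∧
      ∀ O ∈ P, ε * (1 + ∑ i, q O i ^ (2 * D + 2)) < eval (q O) f ^ 2 := by
    have : ∀ᶠ ε in 𝓝[>] (0 : ℝ),
        ∀ O ∈ P, ε * (1 + ∑ i, q O i ^ (2 * D + 2)) < eval (q O) f ^ 2 := by
      rw [Filter.eventually_all_finset]
      intro O hO
      have hc : Continuous fun ε : ℝ => ε * (1 + ∑ i, q O i ^ (2 * D + 2)) := by fun_prop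
      have h0 : (0 : ℝ) * (1 + ∑ i, q O i ^ (2 * D + 2)) < eval (q O) f ^ 2 := by
        rw [zero_mul]
        exact sq_pos_of_ne_zero (hqf O (hP hO))
      exact ((hc.tendsto 0).eventually_lt_const h0).filter_mono nhdsWithin_le_nhds
    obtain ⟨ε, h1, h2⟩ := (this.and self_mem_nhdsWithin).exists
    exact ⟨ε, h2, h1⟩
  have hcrit : ∀ O ∈ P, ∃ x ∈ O, x ∈ critSet (pert f D ε 0) := by
    intro O hO
    have hO' := hP hO
    have hcpt : IsCompact (closure O) := (hbdd O hO').isCompact_closure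
    obtain ⟨x, hx, hmax⟩ := hcpt.exists_isMaxOn ⟨q O, subset_closure (hqO O hO')⟩
      (MvPolynomial.continuous_eval (pert f D ε 0)).continuousOn
    have hpos : 0 < eval x (pert f D ε 0) := by
      refine lt_of_lt_of_le ?_ (hmax (subset_closure (hqO O hO')))
      have := hεP O hO
      simp only [eval_pert, Pi.zero_apply, zero_mul, Finset.sum_const_zero]
      linarith
    have hxO : x ∈ O := by
      by_contra hxO
      have hxf := hfr O hO' x ⟨hx, by rwa [(hopen O hO').interior_eq]⟩
      rw [eval_pert, hxf] at hpos
      have := sum_even_pow_nonneg D x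
      simp only [Pi.zero_apply, zero_mul, Finset.sum_const_zero] at hpos
      nlinarith
    refine ⟨x, hxO, (mem_critSet_iff_fderiv _ _).2 ?_⟩
    exact ((hmax.on_subset subset_closure).isLocalMax
      ((hopen O hO').mem_nhds hxO)).fderiv_eq_zero
  choose! x hxO hxc using hcrit
  obtain ⟨hfin, hle⟩ := critSet_pert_finite (f := f) (D := D) le_rfl hε.ne' 0
  have hinj : Set.InjOn x P := by
    intro O hO O' hO' h
    by_contra hne
    exact Set.disjoint_left.1 (hdisj (hP hO) (hP hO') hne) (hxO O hO) (h ▸ hxO O' hO')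
  have h1 : (P.image x).card = P.card := Finset.card_image_of_injOn hinj
  have h2 : ((P.image x : Finset (σ → ℝ)) : Set (σ → ℝ)).ncard ≤ _ :=
    Set.ncard_le_ncard (t := critSet (pert f D ε 0)) (by
      intro y hy
      obtain ⟨O, hO, rfl⟩ := Finset.mem_image.1 (Finset.mem_coe.1 hy)
      exact hxc O hO) hfin
  rw [Set.ncard_coe_finset] at h2
  omega

end Superlevel

section Colorings

open Topology Metric

variable {V ι : Type*} [Fintype ι]

/-- The combination `∑ aⱼ ωⱼ` of a family of local primitives. -/
def combo (ω : ι → V → V → ZMod 2) (a : ι → ZMod 2) (p x : V) : ZMod 2 :=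
  ∑ j, a j * ω j p x

lemma combo_sub (ω : ι → V → V → ZMod 2) (a : ι → ZMod 2) (p x q y : V) :
    combo ω a p x - combo ω a q y = ∑ j, a j * (ω j p x - ω j q y) := by
  simp [combo, mul_sub, Finset.sum_sub_distrib]

lemma combo_add (ω : ι → V → V → ZMod 2) (a b : ι → ZMod 2) (p x : V) :
    combo ω (a + b) p x = combo ω a p x + combo ω b p x := by
  simp [combo, add_mul, Finset.sum_add_distrib]

lemma combo_smul (ω : ι → V → V → ZMod 2) (c : ZMod 2) (a : ι → ZMod 2) (p x : V) :
    combo ω (c • a) p x = c * combo ω a p x := by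
  simp [combo, Finset.mul_sum, mul_assoc]

variable [NormedAddCommGroup V]

/-- `ω j p`, for `p ∈ U`, is a local primitive near `p` of a cocycle on `U`. -/
def IsCocycle (ω : ι → V → V → ZMod 2) (U : Set V) : Prop :=
  ∀ p ∈ U, ∃ ρ > 0, ball p ρ ⊆ U ∧ ∀ q ∈ ball p ρ, ∀ᶠ x in 𝓝 q, ∀ j,
    ω j q x - ω j q q = ω j p x - ω j p q

/-- `u` is a primitive on `Y` of the cocycle with coefficients `a`. -/
def IsColoring (ω : ι → V → V → ZMod 2) (Y : Set V) (a : ι → ZMod 2) (u : V → ZMod 2) : Prop :=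
  ∀ p ∈ Y, ∀ᶠ x in 𝓝[Y] p, u x - u p = combo ω a p x - combo ω a p p

/-- The space of pairs `(a, u)` such that `u` is a coloring with coefficients `a`. -/
def coloringSpace (ω : ι → V → V → ZMod 2) (Y : Set V) :
    Submodule (ZMod 2) ((ι → ZMod 2) × (V → ZMod 2)) where
  carrier := {au | IsColoring ω Y au.1 au.2}
  zero_mem' := fun p _ => .of_forall fun x => by simp [combo]
  add_mem' := fun {s t} hs ht p hp => by
    filter_upwards [hs p hp, ht p hp] with x h1 h2
    simp only [Prod.fst_add, Prod.snd_add, Pi.add_apply, combo_add]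
    linear_combination h1 + h2
  smul_mem' := fun c s hs p hp => by
    filter_upwards [hs p hp] with x h1
    simp only [Prod.smul_fst, Prod.smul_snd, Pi.smul_apply, combo_smul, smul_eq_mul]
    linear_combination c * h1

/-- The coefficient vectors of cocycles which are trivial on `Y`. -/
def trivialOn (ω : ι → V → V → ZMod 2) (Y : Set V) : Submodule (ZMod 2) (ι → ZMod 2) :=
  (coloringSpace ω Y).map (LinearMap.fst _ _ _)

lemma mem_trivialOn {ω : ι → V → V → ZMod 2} {Y : Set V} {a : ι → ZMod 2} :
    a ∈ trivialOn ω Y ↔ ∃ u, IsColoring ω Y a u := by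
  constructor
  · rintro ⟨⟨b, u⟩, h, rfl⟩
    exact ⟨u, h⟩
  · rintro ⟨u, h⟩
    exact ⟨(a, u), h, rfl⟩

lemma IsColoring.mono {ω : ι → V → V → ZMod 2} {Y Y' : Set V} {a : ι → ZMod 2} {u : V → ZMod 2}
    (h : IsColoring ω Y a u) (hY : Y' ⊆ Y) : IsColoring ω Y' a u :=
  fun p hp => (h p (hY hp)).filter_mono (nhdsWithin_mono _ hY)

lemma trivialOn_anti (ω : ι → V → V → ZMod 2) {Y Y' : Set V} (hY : Y' ⊆ Y) :
    trivialOn ω Y ≤ trivialOn ω Y' := fun a ha => by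
  obtain ⟨u, hu⟩ := mem_trivialOn.1 ha
  exact mem_trivialOn.2 ⟨u, hu.mono hY⟩

/-- A radius on which `ω j p` is a primitive. -/
def IsRadius (ω : ι → V → V → ZMod 2) (p : V) (ρ : ℝ) : Prop :=
  ∀ q ∈ ball p ρ, ∀ᶠ x in 𝓝 q, ∀ j, ω j q x - ω j q q = ω j p x - ω j p q

lemma eq_of_isPreconnected_of_eventually {C : Set V} (hC : IsPreconnected C) {g : V → ZMod 2}
    (hg : ∀ q ∈ C, ∀ᶠ x in 𝓝[C] q, g x = g q) {x y : V} (hx : x ∈ C) (hy : y ∈ C) :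
    g x = g y := by
  have hcont : ContinuousOn g C := fun q hq =>
    (tendsto_const_nhds (x := g q)).congr' ((hg q hq).mono fun x hx => hx.symm)
  exact hC.constant_of_mapsTo (T := Set.univ) (isDiscrete_univ_iff.2 inferInstance) hcont
    (fun _ _ => Set.mem_univ _) hx hy

lemma IsColoring.sub_combo_eq {ω : ι → V → V → ZMod 2} {Y : Set V} {a : ι → ZMod 2}
    {u : V → ZMod 2} (h : IsColoring ω Y a u) {p : V} {ρ : ℝ} (hρ : IsRadius ω p ρ)
    {C : Set V} (hC : IsPreconnected C) (hCY : C ⊆ Y) (hCp : C ⊆ ball p ρ) {x y : V}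
    (hx : x ∈ C) (hy : y ∈ C) : u x - combo ω a p x = u y - combo ω a p y := by
  refine eq_of_isPreconnected_of_eventually (g := fun x => u x - combo ω a p x) hC ?_ hx hy
  intro q hq
  filter_upwards [(h q (hCY hq)).filter_mono (nhdsWithin_mono _ hCY),
    (hρ q (hCp hq)).filter_mono nhdsWithin_le_nhds] with z h1 h2
  have h3 : combo ω a q z - combo ω a q q = combo ω a p z - combo ω a p q := by
    simp [combo_sub, h2]
  linear_combination h1 + h3

lemma isColoring_combo {ω : ι → V → V → ZMod 2} (a : ι → ZMod 2) {p : V} {ρ : ℝ}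
    (hρ : IsRadius ω p ρ) : IsColoring ω (ball p ρ) a (combo ω a p) := by
  intro q hq
  filter_upwards [(hρ q hq).filter_mono nhdsWithin_le_nhds] with z h2
  simp [combo_sub, h2]

variable [NormedSpace ℝ V]

/-- A primitive on a compact set extends to a neighbourhood. -/
lemma IsColoring.exists_thickening {ω : ι → V → V → ZMod 2} {U K : Set V} (hω : IsCocycle ω U)
    (hK : IsCompact K) (hKU : K ⊆ U) {a : ι → ZMod 2} {u : V → ZMod 2}
    (h : IsColoring ω K a u) : ∃ δ > 0, ∃ v, IsColoring ω (thickening δ K) a v := by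
  have hloc : ∀ p ∈ K, ∃ r > 0, ball p r ⊆ U ∧ IsRadius ω p r ∧
      ∀ x ∈ K ∩ ball p r, u x - combo ω a p x = u p - combo ω a p p := by
    intro p hp
    obtain ⟨ρ, hρ, hU, hr⟩ := hω p (hKU hp)
    obtain ⟨r, hr0, hr1⟩ := Metric.mem_nhdsWithin_iff.1 (h p hp)
    have hsub : ball p (min ρ r) ⊆ ball p ρ := ball_subset_ball (min_le_left _ _)
    refine ⟨min ρ r, lt_min hρ hr0, hsub.trans hU, fun q hq => hr q (hsub hq), ?_⟩
    rintro x ⟨hxK, hx⟩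
    have : u x - u p = combo ω a p x - combo ω a p p :=
      hr1 ⟨ball_subset_ball (min_le_right _ _) hx, hxK⟩
    linear_combination this
  choose! r hr0 hrU hrad hru using hloc
  obtain ⟨δ, hδ, hleb⟩ := lebesgue_number_lemma_of_metric (ι := K)
    (c := fun p => ball (p : V) (r p)) hK
    (fun _ => isOpen_ball) (fun p hp => Set.mem_iUnion.2 ⟨⟨p, hp⟩, mem_ball_self (hr0 p hp)⟩)
  have hleb' : ∀ y ∈ K, ∃ p ∈ K, ball y δ ⊆ ball p (r p) := fun y hy => by
    obtain ⟨p, hp⟩ := hleb y hy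
    exact ⟨p, p.2, hp⟩
  choose! P hPK hP using hleb'
  have hnear : ∀ x ∈ thickening (δ / 4) K, ∃ y ∈ K, dist x y < δ / 4 := fun x hx =>
    mem_thickening_iff.1 hx
  choose! Y hYK hYd using hnear
  refine ⟨δ / 4, by positivity,
    fun x => u (Y x) + combo ω a (P (Y x)) x - combo ω a (P (Y x)) (Y x), ?_⟩
  intro x₀ hx₀
  set y₀ := Y x₀ with hy₀
  set p₀ : V := P y₀ with hp₀
  have hy₀K : y₀ ∈ K := hYK x₀ hx₀
  have hxy₀ : dist x₀ y₀ < δ / 4 := hYd x₀ hx₀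
  have hx₀p₀ : x₀ ∈ ball p₀ (r p₀) := hP y₀ hy₀K (by rw [mem_ball]; linarith)
  filter_upwards [(hrad p₀ (hPK y₀ hy₀K) x₀ hx₀p₀).filter_mono nhdsWithin_le_nhds,
    self_mem_nhdsWithin, mem_nhdsWithin_of_mem_nhds (ball_mem_nhds x₀
      (show 0 < δ / 4 by positivity))]
    with x h1 hx hxx₀
  set y := Y x with hy
  set p : V := P y with hp
  have hyK : y ∈ K := hYK x hx
  have hxy : dist x y < δ / 4 := hYd x hx
  rw [mem_ball] at hxx₀
  have hyy₀ : dist y y₀ < δ := by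
    have := dist_triangle y x y₀
    have := dist_triangle x x₀ y₀
    rw [dist_comm y x] at *
    linarith
  have hxy₀' : dist x y₀ < δ := by
    have := dist_triangle x x₀ y₀
    linarith
  have e1 : combo ω a p x - combo ω a p₀ x = combo ω a p y - combo ω a p₀ y := by
    refine (isColoring_combo a (hrad p (hPK y hyK))).sub_combo_eq (hrad p₀ (hPK y₀ hy₀K))
      (C := ball y δ ∩ ball y₀ δ) ((convex_ball _ _).inter (convex_ball _ _)).isPreconnected
      (Set.inter_subset_left.trans (hP y hyK)) (Set.inter_subset_right.trans (hP y₀ hy₀K))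
      ⟨?_, ?_⟩ ⟨?_, ?_⟩
    · rw [mem_ball]; linarith
    · exact hxy₀'
    · exact mem_ball_self hδ
    · exact hyy₀
  have e2 := hru p₀ (hPK y₀ hy₀K) y ⟨hyK, hP y₀ hy₀K hyy₀⟩
  have e3 := hru p₀ (hPK y₀ hy₀K) y₀ ⟨hy₀K, hP y₀ hy₀K (mem_ball_self hδ)⟩
  have e4 : combo ω a x₀ x - combo ω a x₀ x₀ = combo ω a p₀ x - combo ω a p₀ x₀ := by
    simp [combo_sub, h1]
  linear_combination e1 + e2 - e3 - e4

/-- A cocycle which is trivial on the compact subsets of an open set is trivial on it. -/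
lemma exists_isColoring_of_isCompact {ω : ι → V → V → ZMod 2} {U O : Set V} (hω : IsCocycle ω U)
    (hO : IsOpen O) (hOU : O ⊆ U) {a : ι → ZMod 2}
    (h : ∀ Q ⊆ O, IsCompact Q → ∃ u, IsColoring ω Q a u) : ∃ u, IsColoring ω O a u := by
  classical
  have hloc : ∀ p ∈ O, ∃ r > 0, ball p r ⊆ O ∧ IsRadius ω p r := by
    intro p hp
    obtain ⟨ρ, hρ, hU, hr⟩ := hω p (hOU hp)
    obtain ⟨r, hr0, hr1⟩ := Metric.isOpen_iff.1 hO p hp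
    exact ⟨min ρ r, lt_min hρ hr0, (ball_subset_ball (min_le_right _ _)).trans hr1,
      fun q hq => hr q (ball_subset_ball (min_le_left _ _) hq)⟩
  choose! r hr0 hrO hrad using hloc
  let S := {px : V × V // px.1 ∈ O ∧ px.2 ∈ ball px.1 (r px.1)}
  have hne : (⋂ s : S, {u : V → ZMod 2 | u s.1.2 - u s.1.1 =
      combo ω a s.1.1 s.1.2 - combo ω a s.1.1 s.1.1}).Nonempty := by
    refine CompactSpace.iInter_nonempty (fun s => ?_) fun t => ?_
    · exact isClosed_eq (by fun_prop) continuous_const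
    · have hseg : ∀ s : S, segment ℝ s.1.1 s.1.2 ⊆ ball s.1.1 (r s.1.1) := fun s =>
        (convex_ball _ _).segment_subset (mem_ball_self (hr0 _ s.2.1)) s.2.2
      obtain ⟨u, hu⟩ := h (⋃ s ∈ t, segment ℝ s.1.1 s.1.2)
        (Set.iUnion₂_subset fun s _ => (hseg s).trans (hrO _ s.2.1))
        (t.isCompact_biUnion fun s _ => by
          rw [segment_eq_image]
          exact isCompact_Icc.image (by fun_prop))
      refine ⟨u, Set.mem_iInter₂.2 fun s hs => ?_⟩
      have := hu.sub_combo_eq (hrad _ s.2.1) (convex_segment s.1.1 s.1.2).isPreconnected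
        (fun x hx => Set.mem_iUnion₂.2 ⟨s, hs, hx⟩) (hseg s) (right_mem_segment ℝ _ _)
        (left_mem_segment ℝ _ _)
      change u s.1.2 - u s.1.1 = _
      linear_combination this
  obtain ⟨u, hu⟩ := hne
  refine ⟨u, fun p hp => ?_⟩
  filter_upwards [mem_nhdsWithin_of_mem_nhds (ball_mem_nhds p (hr0 p hp))] with x hx
  exact Set.mem_iInter.1 hu ⟨(p, x), hp, hx⟩

/-- Near `p`, the set `X` is covered by preconnected subsets indexed by `κ`. -/
def LocallyCovered (κ : Type*) (X : Set V) (p : V) : Prop :=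
  ∀ r > 0, ∃ r' > 0, ∃ G : κ → Set V,
    (∀ k, IsPreconnected (G k) ∧ G k ⊆ X ∩ ball p r) ∧ X ∩ ball p r' ⊆ ⋃ k, G k

/-- Passing from `X` to `K ⊆ closure X ∪ Cr` destroys at most `κ` trivial cocycles for each
point of `Cr`. -/
lemma finrank_trivialOn_le {ω : ι → V → V → ZMod 2} {U X K : Set V} (hω : IsCocycle ω U)
    (hKU : K ⊆ U) (κ : Type*) [Fintype κ] (Cr : Finset V)
    (hN : ∀ p ∈ K, p ∉ Cr → p ∈ closure X ∧ LocallyCovered Unit X p)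
    (hC : ∀ p ∈ Cr, p ∈ K ∧ LocallyCovered κ X p) :
    Module.finrank (ZMod 2) (trivialOn ω X) ≤
      Module.finrank (ZMod 2) (trivialOn ω K) + Fintype.card κ * Cr.card := by
  classical
  -- small radii
  have hrad : ∀ p ∈ K, ∃ r > 0, IsRadius ω p r ∧ ∀ q ∈ Cr, q ∈ ball p r → q = p := by
    intro p hp
    obtain ⟨ρ, hρ, -, hr⟩ := hω p (hKU hp)
    have : ∀ᶠ r in 𝓝[>] (0 : ℝ), ∀ q ∈ Cr, q ∈ ball p r → q = p := by
      rw [Filter.eventually_all_finset]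
      intro q hq
      by_cases hqp : q = p
      · exact .of_forall fun _ _ => hqp
      · have h0 : 0 < dist q p := dist_pos.2 hqp
        have h1 : ∀ᶠ r in 𝓝 (0 : ℝ), r < dist q p := eventually_lt_nhds h0
        filter_upwards [h1.filter_mono nhdsWithin_le_nhds] with r hr hq'
        exact absurd (mem_ball.1 hq') (not_lt.2 hr.le)
    have h2 : ∀ᶠ r in 𝓝[>] (0 : ℝ), r < ρ :=
      (eventually_lt_nhds hρ).filter_mono nhdsWithin_le_nhds
    obtain ⟨r, ⟨h1, h2⟩, h3⟩ := ((this.and h2).and self_mem_nhdsWithin).exists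
    exact ⟨r, h3, fun q hq => hr q (ball_subset_ball h2.le hq), h1⟩
  choose! ρ hρ0 hρ hρC using hrad
  have hC' : ∀ p ∈ Cr, ∃ r' > 0, ∃ G : κ → Set V,
      (∀ k, IsPreconnected (G k) ∧ G k ⊆ X ∩ ball p (ρ p)) ∧ X ∩ ball p r' ⊆ ⋃ k, G k :=
    fun p hp => (hC p hp).2 _ (hρ0 p (hC p hp).1)
  choose! r' hr'0 G hG hGcov using hC'
  let e : V → κ → V := fun p k => if h : (G p k).Nonempty then h.some else 0
  have he : ∀ p k, (G p k).Nonempty → e p k ∈ G p k := fun p k h => by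
    simp only [e, dif_pos h]
    exact h.some_mem
  -- a linear choice of colorings
  let π : coloringSpace ω X →ₗ[ZMod 2] trivialOn ω X :=
    (LinearMap.fst _ _ _).restrict fun x hx => ⟨x, hx, rfl⟩
  have hπ : Function.Surjective π := by
    rintro ⟨a, x, hx, rfl⟩
    exact ⟨⟨x, hx⟩, rfl⟩
  obtain ⟨s, hs⟩ := π.exists_rightInverse_of_surjective (LinearMap.range_eq_top.2 hπ)
  have hs1 : ∀ a, (s a).1.1 = a.1 := fun a => congrArg Subtype.val (DFunLike.congr_fun hs a)
  let Λ : trivialOn ω X →ₗ[ZMod 2] (Cr × κ → ZMod 2) :=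
    { toFun := fun a pk => (s a).1.2 (e pk.1 pk.2) - combo ω a.1 pk.1 (e pk.1 pk.2)
      map_add' := fun a b => by
        ext pk
        simp [combo_add]
        ring
      map_smul' := fun c a => by
        ext pk
        simp [combo_smul, mul_sub] }
  have hker : (LinearMap.ker Λ).map (trivialOn ω X).subtype ≤ trivialOn ω K := by
    rintro _ ⟨a, ha, rfl⟩
    have ha' : ∀ p ∈ Cr, ∀ k, (s a).1.2 (e p k) = combo ω a.1 p (e p k) := fun p hp k =>
      sub_eq_zero.1 (congrFun (LinearMap.mem_ker.1 ha) (⟨p, hp⟩, k))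
    have hu : IsColoring ω X a.1 (s a).1.2 := by
      have := (s a).2
      rw [← hs1 a]
      exact this
    set u := (s a).1.2
    have hloc : ∀ p ∈ K, ∃ r > 0, r ≤ ρ p ∧ ∃ κ : ZMod 2,
        ∀ x ∈ X ∩ ball p r, u x - combo ω a.1 p x = κ := by
      intro p hp
      by_cases hpC : p ∈ Cr
      · refine ⟨min (r' p) (ρ p), lt_min (hr'0 p hpC) (hρ0 p hp), min_le_right _ _, 0, ?_⟩
        rintro x ⟨hxX, hx⟩
        obtain ⟨k, hk⟩ := Set.mem_iUnion.1
          (hGcov p hpC ⟨hxX, ball_subset_ball (min_le_left _ _) hx⟩)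
        obtain ⟨h1, h2⟩ := hG p hpC k
        rw [hu.sub_combo_eq (hρ p hp) h1 (h2.trans Set.inter_subset_left)
          (h2.trans Set.inter_subset_right) hk (he p k ⟨x, hk⟩), ha' p hpC k, sub_self]
      · obtain ⟨t, ht0, H, hH, hcov⟩ := (hN p hp hpC).2 _ (hρ0 p hp)
        obtain ⟨h1, h2⟩ := hH ()
        by_cases hne : (H ()).Nonempty
        · obtain ⟨z, hz⟩ := hne
          refine ⟨min t (ρ p), lt_min ht0 (hρ0 p hp), min_le_right _ _, u z - combo ω a.1 p z, ?_⟩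
          rintro x ⟨hxX, hx⟩
          obtain ⟨k, hk⟩ := Set.mem_iUnion.1 (hcov ⟨hxX, ball_subset_ball (min_le_left _ _) hx⟩)
          exact hu.sub_combo_eq (hρ p hp) h1 (h2.trans Set.inter_subset_left)
            (h2.trans Set.inter_subset_right) hk hz
        · refine ⟨min t (ρ p), lt_min ht0 (hρ0 p hp), min_le_right _ _, 0, ?_⟩
          rintro x ⟨hxX, hx⟩
          obtain ⟨k, hk⟩ := Set.mem_iUnion.1 (hcov ⟨hxX, ball_subset_ball (min_le_left _ _) hx⟩)
          exact absurd ⟨x, hk⟩ hne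
    choose! r hr0 hrρ κ' hκ using hloc
    refine mem_trivialOn.2 ⟨fun p => κ' p + combo ω a.1 p p, fun p hp => ?_⟩
    filter_upwards [self_mem_nhdsWithin, mem_nhdsWithin_of_mem_nhds (ball_mem_nhds p (hr0 p hp))]
      with q hq hqp
    by_cases hqe : q = p
    · subst hqe; simp
    have hqC : q ∉ Cr := fun hqC => hqe (hρC p hp q hqC (ball_subset_ball (hrρ p hp) hqp))
    obtain ⟨z, hz, hzX⟩ := mem_closure_iff.1 (hN q hq hqC).1 (ball p (r p) ∩ ball q (r q))
      (isOpen_ball.inter isOpen_ball) ⟨hqp, mem_ball_self (hr0 q hq)⟩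
    have e1 := hκ p hp z ⟨hzX, hz.1⟩
    have e2 := hκ q hq z ⟨hzX, hz.2⟩
    have e3 : combo ω a.1 p z - combo ω a.1 q z = combo ω a.1 p q - combo ω a.1 q q :=
      (isColoring_combo a.1 (hρ p hp)).sub_combo_eq (hρ q hq) (C := ball p (r p) ∩ ball q (r q))
        ((convex_ball _ _).inter (convex_ball _ _)).isPreconnected
        (Set.inter_subset_left.trans (ball_subset_ball (hrρ p hp)))
        (Set.inter_subset_right.trans (ball_subset_ball (hrρ q hq))) hz
        ⟨hqp, mem_ball_self (hr0 q hq)⟩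
    simp only [Submodule.coe_subtype] at *
    linear_combination e1 - e2 + e3
  have h1 := Λ.finrank_range_add_finrank_ker
  have h2 : Module.finrank (ZMod 2) (LinearMap.range Λ) ≤ Fintype.card κ * Cr.card := by
    refine (Submodule.finrank_le _).trans ?_
    simp [mul_comm]
  have h3 := Submodule.finrank_mono hker
  rw [(Submodule.equivMapOfInjective _ (trivialOn ω X).injective_subtype
    (LinearMap.ker Λ)).finrank_eq.symm] at h3
  omega

end Colorings

section Sweep

open Topology Metric

variable {V ι : Type*} [Fintype ι] [NormedAddCommGroup V] [NormedSpace ℝ V]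

lemma locallyCovered_of_isOpen {X : Set V} (hX : IsOpen X) {p : V} (hp : p ∈ X) :
    LocallyCovered Unit X p := by
  intro r hr
  obtain ⟨s, hs, hsX⟩ := Metric.isOpen_iff.1 hX p hp
  refine ⟨min s r, lt_min hs hr, fun _ => ball p (min s r), fun _ =>
    ⟨(convex_ball _ _).isPreconnected, Set.subset_inter
      ((ball_subset_ball (min_le_left _ _)).trans hsX) (ball_subset_ball (min_le_right _ _))⟩, ?_⟩
  rintro x ⟨-, hx⟩
  exact Set.mem_iUnion.2 ⟨(), hx⟩

lemma trivialOn_le_of_isCompact {ω : ι → V → V → ZMod 2} {U : Set V} (hω : IsCocycle ω U)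
    {h : V → ℝ} (hh : Continuous h) (hKU : {x | 0 ≤ h x} ⊆ U)
    (hK : IsCompact {x | 0 ≤ h x}) {c : ℝ} (hc : 0 < c) :
    ∃ c' < c, 0 ≤ c' ∧ trivialOn ω {x | c ≤ h x} ≤ trivialOn ω {x | c' ≤ h x} := by
  have hsub : {x | c ≤ h x} ⊆ {x | 0 ≤ h x} := fun x hx => hc.le.trans hx
  have hKc : IsCompact {x | c ≤ h x} :=
    hK.of_isClosed_subset (isClosed_le continuous_const hh) hsub
  have key : ∀ a ∈ trivialOn ω {x | c ≤ h x}, ∀ᶠ c' in 𝓝[<] c,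
      a ∈ trivialOn ω {x | c' ≤ h x} := by
    intro a ha
    obtain ⟨u, hu⟩ := mem_trivialOn.1 ha
    obtain ⟨δ, hδ, v, hv⟩ := hu.exists_thickening hω hKc (hsub.trans hKU)
    have hQ : IsCompact ({x | 0 ≤ h x} \ thickening δ {x | c ≤ h x}) :=
      hK.diff isOpen_thickening
    obtain ⟨c₁, hc₁, hlt⟩ : ∃ c₁ < c,
        ∀ x ∈ {x | 0 ≤ h x} \ thickening δ {x | c ≤ h x}, h x ≤ c₁ := by
      rcases Set.eq_empty_or_nonempty ({x | 0 ≤ h x} \ thickening δ {x | c ≤ h x}) with he | hne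
      · exact ⟨c - 1, by linarith, fun x hx => by rw [he] at hx; exact hx.elim⟩
      · obtain ⟨z, hz, hmax⟩ := hQ.exists_isMaxOn hne hh.continuousOn
        refine ⟨h z, ?_, fun x hx => hmax hx⟩
        by_contra hcz
        exact hz.2 (self_subset_thickening hδ _ (not_lt.1 hcz))
    filter_upwards [Ioo_mem_nhdsLT (max_lt hc₁ hc)] with c' hc'
    refine mem_trivialOn.2 ⟨v, hv.mono fun x hx => ?_⟩
    by_contra hxt
    have h0 : 0 ≤ h x := ((le_max_right _ _).trans hc'.1.le).trans hx
    have := hlt x ⟨h0, hxt⟩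
    have := (le_max_left c₁ 0).trans_lt hc'.1
    have : c' ≤ h x := hx
    linarith
  have hall : ∀ᶠ c' in 𝓝[<] c, ∀ a ∈ trivialOn ω {x | c ≤ h x},
      a ∈ trivialOn ω {x | c' ≤ h x} := by
    classical
    rw [Filter.eventually_all]
    intro a
    by_cases ha : a ∈ trivialOn ω {x | c ≤ h x}
    · filter_upwards [key a ha] with c' hc' _ using hc'
    · exact .of_forall fun _ h => absurd h ha
  obtain ⟨c', h1, h2⟩ := (hall.and (Ioo_mem_nhdsLT hc)).exists
  exact ⟨c', h2.2, h2.1.le, h1⟩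

lemma trivialOn_le_superlevel {ω : ι → V → V → ZMod 2} {U : Set V} (hω : IsCocycle ω U)
    {h : V → ℝ} (hh : Continuous h) {c : ℝ} (hU : {x | c < h x} ⊆ U) :
    ∃ c' > c, trivialOn ω {x | c' ≤ h x} ≤ trivialOn ω {x | c < h x} := by
  classical
  let N : Set ℕ := {n | ∃ c' > c, Module.finrank (ZMod 2) (trivialOn ω {x | c' ≤ h x}) = n}
  have hN : N.Nonempty := ⟨_, c + 1, by linarith, rfl⟩
  obtain ⟨c₁, hc₁, hc₁N⟩ := Nat.sInf_mem hN
  have hle : ∀ c' > c, trivialOn ω {x | c₁ ≤ h x} ≤ trivialOn ω {x | c' ≤ h x} := by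
    intro c' hc'
    rcases le_total c₁ c' with h1 | h1
    · exact trivialOn_anti ω fun x hx => h1.trans hx
    · have h2 : trivialOn ω {x | c' ≤ h x} ≤ trivialOn ω {x | c₁ ≤ h x} :=
        trivialOn_anti ω fun x hx => h1.trans hx
      refine (Submodule.eq_of_le_of_finrank_le h2 ?_).ge
      rw [hc₁N]
      exact Nat.sInf_le ⟨c', hc', rfl⟩
  refine ⟨c₁, hc₁, fun a ha => mem_trivialOn.2 ?_⟩
  refine exists_isColoring_of_isCompact hω (isOpen_lt continuous_const hh) hU fun Q hQ hQc => ?_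
  rcases Q.eq_empty_or_nonempty with rfl | hne
  · exact ⟨0, fun p hp => hp.elim⟩
  · obtain ⟨z, hz, hmin⟩ := hQc.exists_isMinOn hne hh.continuousOn
    obtain ⟨u, hu⟩ := mem_trivialOn.1 (hle (h z) (hQ hz) ha)
    exact ⟨u, hu.mono fun x hx => hmin hx⟩

/-- Sweeping through the superlevel sets of a function with the finite set `Cr` of critical
points: the rank of a cocycle family is at most `κ` times the number of critical points. -/
lemma card_le_finrank_trivialOn {ω : ι → V → V → ZMod 2} {U : Set V} (hω : IsCocycle ω U)
    {h : V → ℝ} (hh : Continuous h) (hKU : {x | 0 ≤ h x} ⊆ U)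
    (hK : IsCompact {x | 0 ≤ h x}) (κ : Type*) [Fintype κ] (Cr : Finset V)
    (hN : ∀ p, 0 ≤ h p → p ∉ Cr →
      p ∈ closure {x | h p < h x} ∧ LocallyCovered Unit {x | h p < h x} p)
    (hC : ∀ p ∈ Cr, LocallyCovered κ {x | h p < h x} p) :
    Fintype.card ι ≤ Module.finrank (ZMod 2) (trivialOn ω {x | 0 ≤ h x}) +
      Fintype.card κ * Cr.card := by
  classical
  let P : ℝ → Prop := fun c => Fintype.card ι ≤
    Module.finrank (ZMod 2) (trivialOn ω {x | c ≤ h x}) +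
      Fintype.card κ * (Cr.filter fun p => c ≤ h p).card
  let S : Set ℝ := {c | 0 ≤ c ∧ ∀ c' ≥ c, P c'}
  have hSne : S.Nonempty := by
    obtain ⟨M, hM⟩ := (hK.image hh).bddAbove
    refine ⟨max (M + 1) 0, le_max_right _ _, fun c hc => ?_⟩
    have he : {x | c ≤ h x} = (∅ : Set V) := by
      refine Set.eq_empty_iff_forall_notMem.2 fun x hx => ?_
      have h1 : c ≤ h x := hx
      have h2 := hM ⟨x, ((le_max_right (M + 1) 0).trans hc).trans h1, rfl⟩
      have h3 := (le_max_left (M + 1) 0).trans hc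
      linarith
    have ht : trivialOn ω (∅ : Set V) = ⊤ :=
      eq_top_iff.2 fun a _ => mem_trivialOn.2 ⟨0, fun p hp => hp.elim⟩
    have h1 : Module.finrank (ZMod 2) (trivialOn ω {x | c ≤ h x}) = Fintype.card ι := by
      rw [he, ht, finrank_top, Module.finrank_fintype_fun_eq_card]
    exact h1.ge.trans (Nat.le_add_right _ _)
  have hSbdd : BddBelow S := ⟨0, fun c hc => hc.1⟩
  set c₀ := sInf S with hc₀
  have hc₀0 : 0 ≤ c₀ := le_csInf hSne fun c hc => hc.1
  have habove : ∀ c > c₀, P c := fun c hc => by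
    obtain ⟨s, hs, hsc⟩ := exists_lt_of_csInf_lt hSne hc
    exact hs.2 c hsc.le
  have hPc₀ : P c₀ := by
    have hKU' : {x | c₀ ≤ h x} ⊆ U := fun x hx => hKU (hc₀0.trans hx)
    have hXK : {x | c₀ < h x} ⊆ {x | c₀ ≤ h x} := fun x (hx : c₀ < h x) => hx.le
    obtain ⟨c₁, hc₁, hle⟩ := trivialOn_le_superlevel hω hh (hXK.trans hKU')
    have h1 := habove c₁ hc₁
    have h2 := Submodule.finrank_mono hle
    have h3 := finrank_trivialOn_le hω hKU' κ (X := {x | c₀ < h x})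
      (Cr.filter fun p => c₀ = h p) (by
        intro p hp hpC
        rcases eq_or_lt_of_le (show c₀ ≤ h p from hp) with he | hlt
        · rw [he]
          exact hN p (he ▸ hc₀0) fun hpC' => hpC (Finset.mem_filter.2 ⟨hpC', he⟩)
        · exact ⟨subset_closure hlt, locallyCovered_of_isOpen (isOpen_lt continuous_const hh) hlt⟩)
      (by
        intro p hp
        obtain ⟨hpC, he⟩ := Finset.mem_filter.1 hp
        refine ⟨he.le, ?_⟩
        rw [he]
        exact hC p hpC)
    have h4 : (Cr.filter fun p => c₁ ≤ h p).card + (Cr.filter fun p => c₀ = h p).card ≤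
        (Cr.filter fun p => c₀ ≤ h p).card := by
      rw [← Finset.card_union_of_disjoint]
      · refine Finset.card_le_card fun p hp => ?_
        simp only [Finset.mem_union, Finset.mem_filter] at hp ⊢
        rcases hp with ⟨h5, h6⟩ | ⟨h5, h6⟩
        · exact ⟨h5, hc₁.le.trans h6⟩
        · exact ⟨h5, h6.le⟩
      · refine Finset.disjoint_left.2 fun p hp hp' => ?_
        have h5 := (Finset.mem_filter.1 hp).2
        have h6 := (Finset.mem_filter.1 hp').2
        linarith
    have h5 := Nat.mul_le_mul_left (Fintype.card κ) h4
    rw [Nat.mul_add] at h5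
    simp only [P] at h1 ⊢
    omega
  have hS : c₀ ∈ S := ⟨hc₀0, fun c hc => by
    rcases eq_or_lt_of_le hc with he | hlt
    · exact he ▸ hPc₀
    · exact habove c hlt⟩
  have hzero : c₀ = 0 := by
    by_contra hne
    obtain ⟨c₂, hc₂, hc₂0, hle⟩ :=
      trivialOn_le_of_isCompact hω hh hKU hK (lt_of_le_of_ne hc₀0 (Ne.symm hne))
    refine absurd (csInf_le hSbdd (show c₂ ∈ S from ⟨hc₂0, fun c hc => ?_⟩)) (not_le.2 hc₂)
    rcases lt_or_ge c c₀ with hlt | hge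
    · have hsub : {x | c ≤ h x} ⊆ {x | c₂ ≤ h x} := fun x hx => le_trans hc hx
      have h1 := Submodule.finrank_mono (hle.trans (trivialOn_anti ω hsub))
      have h2 : (Cr.filter fun p => c₀ ≤ h p).card ≤ (Cr.filter fun p => c ≤ h p).card :=
        Finset.card_le_card fun p hp => by
          simp only [Finset.mem_filter] at hp ⊢
          exact ⟨hp.1, hlt.le.trans hp.2⟩
      have h3 := Nat.mul_le_mul_left (Fintype.card κ) h2
      simp only [P] at hPc₀ ⊢
      omega
    · exact hS.2 c hge
  have h1 := hPc₀
  simp only [P, hzero] at h1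
  have h2 := Nat.mul_le_mul_left (Fintype.card κ)
    (Finset.card_le_card (Finset.filter_subset (fun p => 0 ≤ h p) Cr))
  omega

end Sweep

section LocalStructure

open Topology Metric

lemma isPreconnected_union_iUnion {X α : Type*} [TopologicalSpace X] {B : Set X}
    (hB : IsPreconnected B) (hne : B.Nonempty) {S : α → Set X} (hS : ∀ a, IsPreconnected (S a))
    (hSB : ∀ a, (S a ∩ B).Nonempty) : IsPreconnected (B ∪ ⋃ a, S a) := by
  obtain ⟨b, hb⟩ := hne
  refine isPreconnected_of_forall b fun y hy => ?_
  rcases hy with hy | hy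
  · exact ⟨B, Set.subset_union_left, hb, hy, hB⟩
  · obtain ⟨a, ha⟩ := Set.mem_iUnion.1 hy
    obtain ⟨z, hzS, hzB⟩ := hSB a
    exact ⟨B ∪ S a, Set.union_subset_union_right _ (Set.subset_iUnion S a), Or.inl hb, Or.inr ha,
      hB.union z hzB hzS (hS a)⟩

variable {V : Type*} [NormedAddCommGroup V] [NormedSpace ℝ V]

lemma strictMonoOn_line {h : V → ℝ} (hh : Differentiable ℝ h) {x v : V} {τ : ℝ}
    (hpos : ∀ s ∈ Set.Icc 0 τ, 0 < fderiv ℝ h (x + s • v) v) :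
    StrictMonoOn (fun s : ℝ => h (x + s • v)) (Set.Icc 0 τ) := by
  have hd : ∀ s : ℝ, HasDerivAt (fun s : ℝ => h (x + s • v)) (fderiv ℝ h (x + s • v) v) s := by
    intro s
    have h1 : HasDerivAt (fun s : ℝ => x + s • v) v s := by
      simpa using ((hasDerivAt_id s).smul_const v).const_add x
    exact (hh (x + s • v)).hasFDerivAt.comp_hasDerivAt s h1
  refine strictMonoOn_of_deriv_pos (convex_Icc _ _)
    (fun s _ => (hd s).continuousAt.continuousWithinAt) fun s hs => ?_
  rw [(hd s).deriv]
  exact hpos s (interior_subset hs)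

lemma lt_of_mem_segment_line {h : V → ℝ} (hh : Differentiable ℝ h) {x v : V} {τ : ℝ} (hτ : 0 ≤ τ)
    (hpos : ∀ s ∈ Set.Icc 0 τ, 0 < fderiv ℝ h (x + s • v) v) {c : ℝ} (hx : c < h x) {s : ℝ}
    (hs : s ∈ Set.Icc 0 τ) : c < h (x + s • v) := by
  have := (strictMonoOn_line hh hpos).monotoneOn ⟨le_rfl, hτ⟩ hs hs.1
  simp only [zero_smul, add_zero] at this
  linarith

/-- At a noncritical point, strict superlevel sets are locally connected at the boundary. -/
lemma locallyCovered_of_fderiv_ne_zero {h : V → ℝ} (hh : ContDiff ℝ 1 h) {p : V}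
    (hp : fderiv ℝ h p ≠ 0) :
    p ∈ closure {x | h p < h x} ∧ LocallyCovered Unit {x | h p < h x} p := by
  have hd : Differentiable ℝ h := hh.differentiable one_ne_zero
  obtain ⟨v, hv⟩ : ∃ v, 0 < fderiv ℝ h p v := by
    obtain ⟨v, hv⟩ := DFunLike.ne_iff.1 hp
    rcases lt_or_gt_of_ne hv with h1 | h1
    · exact ⟨-v, by simpa using h1⟩
    · exact ⟨v, h1⟩
  obtain ⟨R, hR, hRpos⟩ : ∃ R > 0, ∀ x ∈ ball p R, 0 < fderiv ℝ h x v := by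
    have hc : Continuous fun x => fderiv ℝ h x v :=
      (hh.continuous_fderiv one_ne_zero).clm_apply continuous_const
    exact Metric.eventually_nhds_iff_ball.1 ((hc.tendsto p).eventually_const_lt hv)
  have hmain : ∀ r > 0, r ≤ R → ∃ τ > (0 : ℝ), (∀ x ∈ ball p (r / 2), ∀ s ∈ Set.Icc (0 : ℝ) τ,
      x + s • v ∈ ball p r) ∧ h p < h (p + τ • v) := by
    intro r hr hrR
    refine ⟨r / 2 / (‖v‖ + 1), by positivity, ?_, ?_⟩
    · intro x hx s hs
      have h1 : s * ‖v‖ ≤ r / 2 := by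
        calc s * ‖v‖ ≤ r / 2 / (‖v‖ + 1) * (‖v‖ + 1) := by
              gcongr
              · exact hs.2
              · linarith
          _ = r / 2 := by field_simp
      rw [mem_ball, dist_eq_norm] at hx ⊢
      calc ‖x + s • v - p‖ = ‖(x - p) + s • v‖ := by congr 1; abel
        _ ≤ ‖x - p‖ + ‖s • v‖ := norm_add_le _ _
        _ = ‖x - p‖ + s * ‖v‖ := by rw [norm_smul, Real.norm_of_nonneg hs.1]
        _ < r := by linarith
    · have hτ : 0 < r / 2 / (‖v‖ + 1) := by positivity
      have := strictMonoOn_line hd (x := p) (v := v) (τ := r / 2 / (‖v‖ + 1)) (fun s hs => by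
        refine hRpos _ ?_
        have h1 : s * ‖v‖ ≤ r / 2 := by
          calc s * ‖v‖ ≤ r / 2 / (‖v‖ + 1) * (‖v‖ + 1) := by
                gcongr
                · exact hs.2
                · linarith
            _ = r / 2 := by field_simp
        rw [mem_ball, dist_eq_norm, add_sub_cancel_left, norm_smul, Real.norm_of_nonneg hs.1]
        linarith) ⟨le_rfl, hτ.le⟩ ⟨hτ.le, le_rfl⟩ hτ
      simpa using this
  refine ⟨Metric.mem_closure_iff.2 fun r hr => ?_, fun r hr => ?_⟩
  · obtain ⟨τ, hτ, h1, h2⟩ := hmain (min r R) (lt_min hr hR) (min_le_right _ _)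
    refine ⟨p + τ • v, h2, ?_⟩
    have := h1 p (mem_ball_self (by positivity)) τ ⟨hτ.le, le_rfl⟩
    rw [dist_comm]
    exact (mem_ball.1 this).trans_le (min_le_left _ _)
  · set r₁ := min r R
    have hr₁ : 0 < r₁ := lt_min hr hR
    obtain ⟨τ, hτ, h1, h2⟩ := hmain r₁ hr₁ (min_le_right _ _)
    have hz : p + τ • v ∈ {x | h p < h x} ∩ ball p r₁ :=
      ⟨h2, h1 p (mem_ball_self (by positivity)) τ ⟨hτ.le, le_rfl⟩⟩
    obtain ⟨r₂, hr₂, hsub⟩ := Metric.isOpen_iff.1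
      ((isOpen_lt continuous_const hh.continuous).inter isOpen_ball) _ hz
    let A := {x // x ∈ {x | h p < h x} ∩ ball p (min r₂ (r₁ / 2))}
    refine ⟨min r₂ (r₁ / 2), lt_min hr₂ (by positivity), fun _ => ball (p + τ • v) r₂ ∪
      ⋃ x : A, (fun s : ℝ => x.1 + s • v) '' Set.Icc 0 τ, fun _ => ⟨?_, ?_⟩, ?_⟩
    · refine isPreconnected_union_iUnion (convex_ball _ _).isPreconnected
        ⟨_, mem_ball_self hr₂⟩ (fun x => isPreconnected_Icc.image _ (by fun_prop)) fun x => ?_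
      refine ⟨x.1 + τ • v, ⟨τ, ⟨hτ.le, le_rfl⟩, rfl⟩, ?_⟩
      have := x.2.2
      rw [mem_ball] at this ⊢
      rw [dist_add_right]
      exact this.trans_le (min_le_left _ _)
    · refine Set.union_subset (hsub.trans (Set.inter_subset_inter_right _
        (ball_subset_ball (min_le_left _ _)))) (Set.iUnion_subset fun x => ?_)
      rintro _ ⟨s, hs, rfl⟩
      have hx : x.1 ∈ ball p (r₁ / 2) := ball_subset_ball (min_le_right _ _) x.2.2
      refine ⟨lt_of_mem_segment_line hd hτ.le (fun t ht => ?_) x.2.1 hs,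
        ball_subset_ball (min_le_left _ _) (h1 _ hx s hs)⟩
      exact hRpos _ (ball_subset_ball (min_le_right _ _) (h1 _ hx t ht))
    · intro x hx
      exact Set.mem_iUnion.2 ⟨(), Or.inr (Set.mem_iUnion.2 ⟨⟨x, hx⟩, 0, ⟨le_rfl, hτ.le⟩,
        by simp⟩)⟩

end LocalStructure

section QuadraticCriticalPoint

open Topology Metric

/-- A function whose gradient is close to that of the quadratic form `½ ∑ wᵢ yᵢ²`. -/
def HasModelGradient (w : Fin 3 → ℝ) (g : (Fin 3 → ℝ) → ℝ) (R : ℝ) : Prop :=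
  ∀ y : Fin 3 → ℝ, ‖y‖ < R → ∀ i, |fderiv ℝ g y (Pi.single i 1) - w i * y i| ≤ 1 / 24 * ‖y‖

lemma HasModelGradient.abs_sub_le {w : Fin 3 → ℝ} {g : (Fin 3 → ℝ) → ℝ} {R : ℝ}
    (hw : HasModelGradient w g R) (hg : Differentiable ℝ g) (h0 : g 0 = 0) {y : Fin 3 → ℝ}
    (hy : ‖y‖ < R) : |g y - 1 / 2 * ∑ i, w i * y i ^ 2| ≤ 1 / 8 * ‖y‖ ^ 2 := by
  have hd : ∀ t ∈ Set.Icc (0 : ℝ) 1, HasDerivWithinAt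
      (fun t : ℝ => g (t • y) - t ^ 2 * (1 / 2 * ∑ i, w i * y i ^ 2))
      (fderiv ℝ g (t • y) y - t * ∑ i, w i * y i ^ 2) (Set.Icc 0 1) t := by
    intro t _
    have h1 : HasDerivAt (fun t : ℝ => t • y) y t := by
      simpa using (hasDerivAt_id t).smul_const y
    have h2 := (hg (t • y)).hasFDerivAt.comp_hasDerivAt t h1
    have h3 := ((hasDerivAt_pow 2 t).mul_const (1 / 2 * ∑ i, w i * y i ^ 2))
    refine (h2.sub h3).hasDerivWithinAt.congr_deriv ?_
    norm_num
    ring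
  have hb : ∀ t ∈ Set.Ico (0 : ℝ) 1,
      ‖fderiv ℝ g (t • y) y - t * ∑ i, w i * y i ^ 2‖ ≤ 1 / 8 * ‖y‖ ^ 2 := by
    intro t ht
    have hty : ‖t • y‖ ≤ ‖y‖ := by
      rw [norm_smul, Real.norm_of_nonneg ht.1]
      exact mul_le_of_le_one_left (norm_nonneg _) ht.2.le
    have hexp : fderiv ℝ g (t • y) y - t * ∑ i, w i * y i ^ 2
        = ∑ i, y i * (fderiv ℝ g (t • y) (Pi.single i 1) - w i * (t • y) i) := by
      have : fderiv ℝ g (t • y) y = ∑ i, y i * fderiv ℝ g (t • y) (Pi.single i 1) := by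
        have h := LinearMap.pi_apply_eq_sum_univ (fderiv ℝ g (t • y)).toLinearMap y
        simp only [smul_eq_mul, ContinuousLinearMap.coe_coe] at h
        rw [h]
        refine Finset.sum_congr rfl fun i _ => ?_
        congr 2
        ext j
        simp [Pi.single_apply, eq_comm]
      rw [this, Finset.mul_sum, ← Finset.sum_sub_distrib]
      refine Finset.sum_congr rfl fun i _ => ?_
      simp only [Pi.smul_apply, smul_eq_mul]
      ring
    rw [hexp]
    calc _ ≤ ∑ i, ‖y i * (fderiv ℝ g (t • y) (Pi.single i 1) - w i * (t • y) i)‖ :=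
          norm_sum_le _ _
      _ ≤ ∑ _i : Fin 3, ‖y‖ * (1 / 24 * ‖y‖) := by
          refine Finset.sum_le_sum fun i _ => ?_
          rw [norm_mul]
          refine mul_le_mul (norm_le_pi_norm y i) ?_ (norm_nonneg _) (norm_nonneg _)
          exact (hw (t • y) (hty.trans_lt hy) i).trans (by gcongr)
      _ = 1 / 8 * ‖y‖ ^ 2 := by
          simp only [Finset.sum_const, Finset.card_univ, Fintype.card_fin, nsmul_eq_mul]
          push_cast
          ring
  have := norm_image_sub_le_of_norm_deriv_le_segment_01' hd hb
  simpa [h0] using this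

lemma HasModelGradient.exists_positive_direction {w : Fin 3 → ℝ} {g : (Fin 3 → ℝ) → ℝ} {R : ℝ}
    (hw : HasModelGradient w g R) (hw1 : ∀ i, w i = -1 ∨ w i = 1) (hg : Differentiable ℝ g)
    (h0 : g 0 = 0) {y : Fin 3 → ℝ} (hy : ‖y‖ < R) (hpos : 0 < g y) :
    ∃ i, w i = 1 ∧ y i ≠ 0 ∧ ‖y‖ ≤ 3 * |y i| := by
  have hy0 : y ≠ 0 := fun h => by simp [h, h0] at hpos
  have hn : 0 < ‖y‖ := norm_pos_iff.2 hy0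
  by_contra! hcon
  have hsmall : ∀ i, w i = 1 → |y i| ≤ ‖y‖ / 3 := by
    intro i hi
    by_cases h : y i = 0
    · rw [h, abs_zero]; positivity
    · linarith [hcon i hi h]
  obtain ⟨j, hj⟩ : ∃ j, ‖y j‖ = ‖y‖ := by
    obtain ⟨j, -, hj⟩ := Finset.exists_mem_eq_sup' Finset.univ_nonempty (fun i => ‖y i‖)
    refine ⟨j, le_antisymm (norm_le_pi_norm y j) ?_⟩
    rw [← hj, pi_norm_le_iff_of_nonneg (hj ▸ norm_nonneg _)]
    exact fun i => Finset.le_sup' (fun i => ‖y i‖) (Finset.mem_univ i)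
  have hwj : w j = -1 := by
    refine (hw1 j).resolve_right fun h => ?_
    have := hsmall j h
    rw [← Real.norm_eq_abs, hj] at this
    linarith
  have hterm : ∀ i, w i * y i ^ 2 ≤ ‖y‖ ^ 2 / 9 := by
    intro i
    rcases hw1 i with h | h
    · rw [h]; nlinarith [sq_nonneg (y i), sq_nonneg ‖y‖]
    · rw [h, one_mul, ← sq_abs]
      calc |y i| ^ 2 ≤ (‖y‖ / 3) ^ 2 := by gcongr; exact hsmall i h
        _ = _ := by ring
  have htj : w j * y j ^ 2 = - ‖y‖ ^ 2 := by
    rw [hwj, ← sq_abs, ← Real.norm_eq_abs, hj]; ring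
  have hsum : ∑ i, w i * y i ^ 2 ≤ - ‖y‖ ^ 2 + 2 * (‖y‖ ^ 2 / 9) := by
    rw [← Finset.add_sum_erase _ _ (Finset.mem_univ j), htj]
    gcongr
    calc _ ≤ (Finset.univ.erase j).card • (‖y‖ ^ 2 / 9) :=
          Finset.sum_le_card_nsmul _ _ _ fun i _ => hterm i
      _ = _ := by simp [Finset.card_erase_of_mem]
  have := (abs_le.1 (hw.abs_sub_le hg h0 hy)).2
  nlinarith [sq_pos_of_pos hn]

lemma HasModelGradient.pos_of_mem_box {w : Fin 3 → ℝ} {g : (Fin 3 → ℝ) → ℝ} {R : ℝ}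
    (hw : HasModelGradient w g R) (hw1 : ∀ i, w i = -1 ∨ w i = 1) (hg : Differentiable ℝ g)
    (h0 : g 0 = 0) {r : ℝ} (hr : 0 < r) (hrR : r < R) {z : Fin 3 → ℝ} {i : Fin 3} (hi : w i = 1)
    (hz : |z i| = r) (hz' : ∀ j, j ≠ i → |z j| ≤ r / 4) : ‖z‖ ≤ r ∧ 0 < g z := by
  have hzr : ‖z‖ ≤ r := by
    rw [pi_norm_le_iff_of_nonneg hr.le]
    intro j
    rw [Real.norm_eq_abs]
    rcases eq_or_ne j i with rfl | h
    · exact hz.le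
    · linarith [hz' j h]
  refine ⟨hzr, ?_⟩
  have hsum : r ^ 2 + 2 * (-(r ^ 2 / 16)) ≤ ∑ i, w i * z i ^ 2 := by
    rw [← Finset.add_sum_erase _ _ (Finset.mem_univ i), hi, one_mul, ← sq_abs (z i), hz]
    gcongr
    calc _ = (Finset.univ.erase i).card • (-(r ^ 2 / 16)) := by
            simp [Finset.card_erase_of_mem]
      _ ≤ _ := by
            refine Finset.card_nsmul_le_sum _ _ _ fun j hj => ?_
            have h1 : z j ^ 2 ≤ r ^ 2 / 16 := by
              rw [← sq_abs]
              calc |z j| ^ 2 ≤ (r / 4) ^ 2 := by gcongr; exact hz' j (Finset.ne_of_mem_erase hj)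
                _ = _ := by ring
            rcases hw1 j with h | h <;> rw [h] <;> nlinarith [sq_nonneg (z j)]
  have h1 := (abs_le.1 (hw.abs_sub_le hg h0 (hzr.trans_lt hrR))).1
  have h2 : ‖z‖ ^ 2 ≤ r ^ 2 := by gcongr
  nlinarith [sq_pos_of_pos hr]

/-- At a nondegenerate critical point in Morse coordinates, the strict superlevel set is locally
covered by six preconnected pieces, one for each half-axis. -/
lemma HasModelGradient.locallyCovered {w : Fin 3 → ℝ} {g : (Fin 3 → ℝ) → ℝ} {R : ℝ} (hR : 0 < R)
    (hw : HasModelGradient w g R) (hw1 : ∀ i, w i = -1 ∨ w i = 1) (hg : Differentiable ℝ g)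
    (h0 : g 0 = 0) : LocallyCovered (Fin 3 × Bool) {y | 0 < g y} 0 := by
  intro r hr
  set r₀ := min R r / 2 with hr₀
  have hr₀pos : 0 < r₀ := by have := lt_min hR hr; positivity
  have hr₀R : r₀ < R := by have := lt_min hR hr; have := min_le_left R r; linarith
  have hr₀r : r₀ < r := by have := lt_min hR hr; have := min_le_right R r; linarith
  let sg : Bool → ℝ := fun b => if b then 1 else -1
  have hsg : ∀ b, sg b * sg b = 1 := by intro b; cases b <;> simp [sg]
  have hsgabs : ∀ b, |sg b| = 1 := by intro b; cases b <;> simp [sg]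
  let B : Fin 3 × Bool → Set (Fin 3 → ℝ) := fun k =>
    {z | z k.1 = sg k.2 * r₀ ∧ ∀ j, j ≠ k.1 → |z j| ≤ r₀ / 4}
  let A : Fin 3 × Bool → Type := fun k =>
    {y : Fin 3 → ℝ // y k.1 ≠ 0 ∧ 0 < sg k.2 * y k.1 ∧ ‖y‖ ≤ 3 * |y k.1| ∧ ‖y‖ < r₀ / 4 ∧ 0 < g y}
  let S : (k : Fin 3 × Bool) → A k → Set (Fin 3 → ℝ) := fun k y =>
    (fun s : ℝ => y.1 + s • Pi.single k.1 (sg k.2)) '' Set.Icc 0 (r₀ - |y.1 k.1|)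
  have habs : ∀ k (y : A k), |y.1 k.1| = sg k.2 * y.1 k.1 := by
    intro k y
    rw [← abs_of_pos y.2.2.1, abs_mul, hsgabs, one_mul]
  have hyk : ∀ k (y : A k), |y.1 k.1| ≤ ‖y.1‖ := fun k y => norm_le_pi_norm y.1 k.1
  have hcoord : ∀ k (y : A k) (s : ℝ),
      (y.1 + s • Pi.single k.1 (sg k.2) : Fin 3 → ℝ) k.1 = sg k.2 * (|y.1 k.1| + s) := by
    intro k y s
    rw [habs k y]
    simp only [Pi.add_apply, Pi.smul_apply, Pi.single_eq_same, smul_eq_mul]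
    linear_combination - y.1 k.1 * hsg k.2
  have hcoord' : ∀ k (y : A k) (s : ℝ) j, j ≠ k.1 →
      (y.1 + s • Pi.single k.1 (sg k.2) : Fin 3 → ℝ) j = y.1 j := by
    intro k y s j hj
    simp [hj]
  have hBB : ∀ k, w k.1 = 1 → ∀ z ∈ B k, ‖z‖ ≤ r₀ ∧ 0 < g z := by
    intro k hk z hz
    refine hw.pos_of_mem_box hw1 hg h0 hr₀pos hr₀R hk ?_ hz.2
    rw [hz.1, abs_mul, hsgabs, one_mul, abs_of_pos hr₀pos]
  have hline : ∀ k (y : A k), ∀ s ∈ Set.Icc 0 (r₀ - |y.1 k.1|),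
      ‖(y.1 + s • Pi.single k.1 (sg k.2) : Fin 3 → ℝ)‖ ≤ r₀ ∧
      ‖(y.1 + s • Pi.single k.1 (sg k.2) : Fin 3 → ℝ)‖ ≤ 3 * (|y.1 k.1| + s) := by
    intro k y s hs
    have h1 := y.2.2.2.1
    have h2 := y.2.2.2.2.1
    have h3 := hs.1
    have h4 := hs.2
    have h5 := abs_nonneg (y.1 k.1)
    constructor <;>
    · rw [pi_norm_le_iff_of_nonneg (by linarith)]
      intro j
      rcases eq_or_ne j k.1 with rfl | hj
      · rw [hcoord, norm_mul, Real.norm_eq_abs, hsgabs, Real.norm_of_nonneg (by linarith)]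
        linarith
      · rw [hcoord' k y s j hj]
        linarith [norm_le_pi_norm y.1 j]
  have hderiv : ∀ k (y : A k), w k.1 = 1 → ∀ s ∈ Set.Icc 0 (r₀ - |y.1 k.1|),
      0 < fderiv ℝ g (y.1 + s • Pi.single k.1 (sg k.2)) (Pi.single k.1 (sg k.2)) := by
    intro k y hk s hs
    obtain ⟨h1, h2⟩ := hline k y s hs
    have h3 := hw _ (h1.trans_lt hr₀R) k.1
    rw [hk, one_mul, hcoord] at h3
    have h4 : (Pi.single k.1 (sg k.2) : Fin 3 → ℝ) = sg k.2 • Pi.single k.1 1 := by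
      rw [← Pi.single_smul, smul_eq_mul, mul_one]
    set d := fderiv ℝ g (y.1 + s • Pi.single k.1 (sg k.2)) (Pi.single k.1 1) with hd
    have h5 : fderiv ℝ g (y.1 + s • Pi.single k.1 (sg k.2)) (Pi.single k.1 (sg k.2))
        = sg k.2 * d := by
      rw [hd, ← smul_eq_mul, ← map_smul, ← h4]
    rw [h5]
    have h6 : |sg k.2 * d - (|y.1 k.1| + s)| ≤ 1 / 24 * (3 * (|y.1 k.1| + s)) := by
      calc _ = |sg k.2 * (d - sg k.2 * (|y.1 k.1| + s))| := by
            congr 1; linear_combination (|y.1 k.1| + s) * hsg k.2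
        _ ≤ _ := by
            rw [abs_mul, hsgabs, one_mul]
            exact h3.trans (by gcongr)
    have h7 := (abs_le.1 h6).1
    have h8 := abs_pos.2 y.2.1
    have h9 := hs.1
    linarith
  refine ⟨r₀ / 4, by positivity, fun k => if w k.1 = 1 then B k ∪ ⋃ y : A k, S k y else ∅,
    fun k => ?_, ?_⟩
  · by_cases hk : w k.1 = 1
    swap
    · simp [hk, isPreconnected_empty]
    simp only [if_pos hk]
    have hconv : Convex ℝ (B k) := by
      intro z hz z' hz' a b ha hb hab
      refine ⟨?_, fun j hj => ?_⟩
      · simp only [Pi.add_apply, Pi.smul_apply, smul_eq_mul, hz.1, hz'.1]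
        rw [← add_mul, hab, one_mul]
      · simp only [Pi.add_apply, Pi.smul_apply, smul_eq_mul]
        calc |a * z j + b * z' j| ≤ a * |z j| + b * |z' j| := by
              refine (abs_add_le _ _).trans ?_
              rw [abs_mul, abs_mul, abs_of_nonneg ha, abs_of_nonneg hb]
          _ ≤ a * (r₀ / 4) + b * (r₀ / 4) := by
              gcongr
              · exact hz.2 j hj
              · exact hz'.2 j hj
          _ = r₀ / 4 := by rw [← add_mul, hab, one_mul]
    refine ⟨isPreconnected_union_iUnion hconv.isPreconnected
      ⟨Pi.single k.1 (sg k.2 * r₀), by simp, fun j hj => by simp [hj]; positivity⟩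
      (fun y => isPreconnected_Icc.image _ (by fun_prop)) fun y => ?_,
      Set.union_subset ?_ (Set.iUnion_subset ?_)⟩
    · have h1 := hyk k y
      have h2 := y.2.2.2.2.1
      refine ⟨_, ⟨r₀ - |y.1 k.1|, ⟨by linarith, le_rfl⟩, rfl⟩, ?_, fun j hj => ?_⟩
      · exact (hcoord k y _).trans (by ring)
      · refine (congrArg abs (hcoord' k y _ j hj)).trans_le ?_
        exact (norm_le_pi_norm y.1 j).trans h2.le
    · intro z hz
      exact ⟨(hBB k hk z hz).2, mem_ball_zero_iff.2 ((hBB k hk z hz).1.trans_lt hr₀r)⟩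
    · rintro y _ ⟨s, hs, rfl⟩
      exact ⟨lt_of_mem_segment_line hg (hs.1.trans hs.2) (hderiv k y hk) y.2.2.2.2.2 hs,
        mem_ball_zero_iff.2 ((hline k y s hs).1.trans_lt hr₀r)⟩
  · rintro y ⟨hy, hyr⟩
    rw [mem_ball_zero_iff] at hyr
    obtain ⟨i, hi, hyi, hn⟩ := hw.exists_positive_direction hw1 hg h0 (hyr.trans (by linarith)) hy
    obtain ⟨b, hb⟩ : ∃ b, 0 < sg b * y i := by
      rcases lt_or_gt_of_ne hyi with h | h
      · exact ⟨false, by simpa [sg] using h⟩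
      · exact ⟨true, by simpa [sg] using h⟩
    refine Set.mem_iUnion.2 ⟨(i, b), ?_⟩
    simp only [if_pos hi]
    refine Or.inr (Set.mem_iUnion.2 ⟨⟨y, hyi, hb, hn, hyr, hy⟩, 0, ⟨le_rfl, ?_⟩, by simp⟩)
    have := norm_le_pi_norm y i
    rw [Real.norm_eq_abs] at this
    change 0 ≤ r₀ - |y i|
    linarith

end QuadraticCriticalPoint

section NondegenerateCriticalPoints

open Topology Metric

lemma LocallyCovered.image_homeomorph {V W κ : Type*} [NormedAddCommGroup V]
    [NormedAddCommGroup W] (Φ : V ≃ₜ W) {X : Set W} {v : V}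
    (h : LocallyCovered κ (Φ ⁻¹' X) v) : LocallyCovered κ X (Φ v) := by
  intro r hr
  obtain ⟨r₁, hr₁, h₁⟩ := Metric.continuousAt_iff.1 Φ.continuous.continuousAt r hr
  obtain ⟨r₂, hr₂, G, hG, hcov⟩ := h r₁ hr₁
  obtain ⟨r₃, hr₃, h₃⟩ := Metric.continuousAt_iff.1
    (Φ.symm.continuous.continuousAt (x := Φ v)) r₂ hr₂
  refine ⟨r₃, hr₃, fun k => Φ '' G k,
    fun k => ⟨(hG k).1.image _ Φ.continuous.continuousOn, ?_⟩, ?_⟩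
  · rintro _ ⟨y, hy, rfl⟩
    exact ⟨((hG k).2 hy).1, h₁ ((hG k).2 hy).2⟩
  · rintro x ⟨hx, hxr⟩
    have h4 := h₃ hxr
    rw [Φ.symm_apply_apply] at h4
    obtain ⟨k, hk⟩ := Set.mem_iUnion.1 (hcov ⟨by simpa using hx, h4⟩ :
      Φ.symm x ∈ ⋃ k, G k)
    exact Set.mem_iUnion.2 ⟨k, _, hk, Φ.apply_symm_apply x⟩

/-- Sylvester's law of inertia for a nondegenerate symmetric bilinear form on `ℝ³`. -/
lemma exists_linearEquiv_diagonal (B : LinearMap.BilinForm ℝ (Fin 3 → ℝ))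
    (hB : ∀ x y, B x y = B y x) (hn : ∀ x, (∀ y, B x y = 0) → x = 0) :
    ∃ (w : Fin 3 → ℝ) (L : (Fin 3 → ℝ) ≃ₗ[ℝ] (Fin 3 → ℝ)), (∀ i, w i = -1 ∨ w i = 1) ∧
      ∀ y i, B (L y) (L (Pi.single i 1)) = w i * y i := by
  have hass : QuadraticMap.associated (R := ℝ) B.toQuadraticMap = B :=
    QuadraticMap.associated_left_inverse ℝ hB
  have key := QuadraticForm.equivalent_one_neg_one_weighted_sum_squared B.toQuadraticMap
    (by rw [hass]; exact hn)
  have hfin : Module.finrank ℝ (Fin 3 → ℝ) = 3 := by simp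
  rw [hfin] at key
  obtain ⟨w, hw, ⟨e⟩⟩ := key
  refine ⟨w, e.symm.toLinearEquiv, hw, fun y i => ?_⟩
  have hQ : ∀ y : Fin 3 → ℝ, B (e.symm y) (e.symm y) = ∑ i, w i * (y i * y i) := by
    intro y
    have h1 : B (e.symm y) (e.symm y) = QuadraticMap.weightedSumSquares ℝ w y :=
      e.symm.map_app y
    rw [h1, QuadraticMap.weightedSumSquares_apply]
    simp only [smul_eq_mul]
  have hpol : ∀ y z : Fin 3 → ℝ, 2 * B (e.symm y) (e.symm z) = ∑ i, 2 * (w i * (y i * z i)) := by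
    intro y z
    have h1 := hQ (y + z)
    rw [map_add, map_add B, LinearMap.add_apply, map_add, map_add, hQ y, hQ z,
      hB (e.symm z) (e.symm y)] at h1
    have h2 : ∑ i, w i * ((y + z) i * (y + z) i) = ∑ i, w i * (y i * y i)
        + ∑ i, w i * (z i * z i) + ∑ i, 2 * (w i * (y i * z i)) := by
      rw [← Finset.sum_add_distrib, ← Finset.sum_add_distrib]
      refine Finset.sum_congr rfl fun i _ => ?_
      simp only [Pi.add_apply]
      ring
    linarith
  have h3 := hpol y (Pi.single i 1)
  rw [← Finset.mul_sum] at h3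
  have h4 : B (e.symm y) (e.symm (Pi.single i 1)) =
      ∑ j, w j * (y j * (Pi.single i 1 : Fin 3 → ℝ) j) := by
    linarith
  simpa [Pi.single_apply] using h4

/-- The second derivative of `h` at `p` is nondegenerate. -/
def NondegenerateAt {V : Type*} [NormedAddCommGroup V] [NormedSpace ℝ V] (h : V → ℝ) (p : V) :
    Prop :=
  ∀ u, fderiv ℝ (fderiv ℝ h) p u = 0 → u = 0

lemma locallyCovered_of_nondegenerateAt {h : (Fin 3 → ℝ) → ℝ} (hh : ContDiff ℝ 2 h)
    {p : Fin 3 → ℝ} (hp : fderiv ℝ h p = 0) (hn : NondegenerateAt h p) :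
    LocallyCovered (Fin 3 × Bool) {x | h p < h x} p := by
  have hd : Differentiable ℝ h := hh.differentiable two_ne_zero
  have hF : HasFDerivAt (fderiv ℝ h) (fderiv ℝ (fderiv ℝ h) p) p :=
    ((hh.fderiv_right (m := 1) (by norm_num)).differentiable one_ne_zero p).hasFDerivAt
  set F' := fderiv ℝ (fderiv ℝ h) p with hF'
  have hsymm : ∀ x y, F' x y = F' y x :=
    hh.contDiffAt.isSymmSndFDerivAt (by simp)
  obtain ⟨w, L₀, hw, hL₀⟩ := exists_linearEquiv_diagonal
    (LinearMap.mk₂ ℝ (fun x y => F' x y) (by simp) (by simp) (by simp) (by simp))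
    hsymm (fun x hx => hn x (ContinuousLinearMap.ext hx))
  let L : (Fin 3 → ℝ) ≃L[ℝ] (Fin 3 → ℝ) := L₀.toContinuousLinearEquiv
  have hL : ∀ y i, F' (L y) (L (Pi.single i 1)) = w i * y i := hL₀
  let N : ℝ := ‖(L : (Fin 3 → ℝ) →L[ℝ] (Fin 3 → ℝ))‖
  have hLN : ∀ y, ‖L y‖ ≤ N * ‖y‖ := fun y =>
    (L : (Fin 3 → ℝ) →L[ℝ] (Fin 3 → ℝ)).le_opNorm y
  have hN : 0 ≤ N := norm_nonneg _
  let Φ : (Fin 3 → ℝ) ≃ₜ (Fin 3 → ℝ) := L.toHomeomorph.trans (Homeomorph.addLeft p)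
  have hΦ : ∀ y, Φ y = p + L y := fun y => rfl
  have hc : 0 < 1 / (24 * (N + 1) ^ 2) := by positivity
  obtain ⟨δ, hδ, hδF⟩ := Metric.eventually_nhds_iff_ball.1
    ((hasFDerivAt_iff_isLittleO_nhds_zero.1 hF).def hc)
  let g : (Fin 3 → ℝ) → ℝ := fun y => h (p + L y) - h p
  have hgd : ∀ y, HasFDerivAt g ((fderiv ℝ h (p + L y)).comp (L : (Fin 3 → ℝ) →L[ℝ] (Fin 3 → ℝ)))
      y := fun y =>
    ((hd (p + L y)).hasFDerivAt.comp y (L.hasFDerivAt.const_add p)).sub_const _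
  have hmodel : HasModelGradient w g (δ / (N + 1)) := by
    intro y hy i
    have hLy : ‖L y‖ < δ := by
      calc ‖L y‖ ≤ N * ‖y‖ := hLN y
        _ ≤ (N + 1) * ‖y‖ := by gcongr; linarith
        _ < (N + 1) * (δ / (N + 1)) := by gcongr
        _ = δ := by field_simp
    have h1 := hδF (L y) (mem_ball_zero_iff.2 hLy)
    rw [hp, sub_zero] at h1
    rw [(hgd y).fderiv, ← hL y i]
    have h2 : ‖L (Pi.single i 1)‖ ≤ N + 1 := by
      refine (hLN _).trans ?_
      rw [Pi.norm_single, norm_one]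
      linarith
    calc |fderiv ℝ h (p + L y) (L (Pi.single i 1)) - F' (L y) (L (Pi.single i 1))|
        = ‖(fderiv ℝ h (p + L y) - F' (L y)) (L (Pi.single i 1))‖ := rfl
      _ ≤ ‖fderiv ℝ h (p + L y) - F' (L y)‖ * ‖L (Pi.single i 1)‖ :=
          ContinuousLinearMap.le_opNorm _ _
      _ ≤ (1 / (24 * (N + 1) ^ 2) * ((N + 1) * ‖y‖)) * (N + 1) := by
          refine mul_le_mul (h1.trans ?_) h2 (norm_nonneg _) (by positivity)
          gcongr
          exact (hLN y).trans (by gcongr; linarith)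
      _ = 1 / 24 * ‖y‖ := by field_simp
  have hcov := hmodel.locallyCovered (by positivity) hw (fun y => (hgd y).differentiableAt)
    (by simp [g])
  have hset : Φ ⁻¹' {x | h p < h x} = {y | 0 < g y} := by
    ext y
    simp [g, hΦ]
  have := LocallyCovered.image_homeomorph (κ := Fin 3 × Bool) Φ (X := {x | h p < h x}) (v := 0)
    (by rw [hset]; exact hcov)
  simpa [hΦ] using this

open MeasureTheory in
/-- Sard's lemma for gradients: a generic linear perturbation has only nondegenerate critical
points. -/
lemma exists_linear_nondegenerateAt {h : (Fin 3 → ℝ) → ℝ} (hh : ContDiff ℝ 2 h) {δ : ℝ}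
    (hδ : 0 < δ) : ∃ ℓ : Fin 3 → ℝ, (∀ i, |ℓ i| < δ) ∧
      ∀ x, (∀ i, fderiv ℝ h x (Pi.single i 1) = ℓ i) → NondegenerateAt h x := by
  let T : ((Fin 3 → ℝ) →L[ℝ] ℝ) →L[ℝ] (Fin 3 → ℝ) :=
    ContinuousLinearMap.pi fun i => ContinuousLinearMap.apply ℝ ℝ (Pi.single i 1)
  have hT : ∀ φ, T φ = 0 → φ = 0 := by
    intro φ hφ
    refine ContinuousLinearMap.coe_injective ((Pi.basisFun ℝ (Fin 3)).ext fun i => ?_)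
    simpa [T] using congrFun hφ i
  have hG : ∀ x, HasFDerivAt (fun x => T (fderiv ℝ h x)) (T.comp (fderiv ℝ (fderiv ℝ h) x)) x :=
    fun x => T.hasFDerivAt.comp x
      ((hh.fderiv_right (m := 1) (by norm_num)).differentiable one_ne_zero x).hasFDerivAt
  have hnull := addHaar_image_eq_zero_of_det_fderivWithin_eq_zero
    (volume : Measure (Fin 3 → ℝ))
    (s := {x | (T.comp (fderiv ℝ (fderiv ℝ h) x)).det = 0})
    (fun x _ => (hG x).hasFDerivWithinAt) (fun x hx => hx)
  obtain ⟨ℓ, hℓ, hℓ'⟩ : ∃ ℓ ∈ ball (0 : Fin 3 → ℝ) δ, ℓ ∉ (fun x => T (fderiv ℝ h x)) ''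
      {x | (T.comp (fderiv ℝ (fderiv ℝ h) x)).det = 0} := by
    by_contra! hcon
    exact (measure_ball_pos volume (0 : Fin 3 → ℝ) hδ).ne' (measure_mono_null hcon hnull)
  refine ⟨ℓ, fun i => (norm_le_pi_norm ℓ i).trans_lt (mem_ball_zero_iff.1 hℓ),
    fun x hx u hu => ?_⟩
  have hdet : LinearMap.det (T.comp (fderiv ℝ (fderiv ℝ h) x)).toLinearMap ≠ 0 :=
    fun h0 => hℓ' ⟨x, h0, funext hx⟩
  by_contra hu0
  refine hdet (LinearMap.det_eq_zero_iff_ker_ne_bot.2 fun hker => hu0 ?_)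
  have : u ∈ LinearMap.ker (T.comp (fderiv ℝ (fderiv ℝ h) x)).toLinearMap := by
    simp [hu]
  rw [hker] at this
  exact this

end NondegenerateCriticalPoints

section CountingBound

open MvPolynomial Topology Metric

lemma contDiff_eval {σ : Type*} [Fintype σ] (f : MvPolynomial σ ℝ) (n : WithTop ℕ∞) :
    ContDiff ℝ n fun x : σ → ℝ => eval x f :=
  (AnalyticOnNhd.eval_mvPolynomial f).contDiff

lemma abs_lt_one_add_even_pow (t : ℝ) (D : ℕ) : |t| < 1 + t ^ (2 * D + 2) := by
  have h0 : 0 ≤ t ^ (2 * D + 2) := Even.pow_nonneg ⟨D + 1, by ring⟩ _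
  rcases lt_or_ge |t| 1 with h | h
  · linarith
  · have h1 : |t| ≤ |t| ^ (2 * D + 2) := le_self_pow₀ h (by positivity)
    have h2 : |t| ^ (2 * D + 2) = t ^ (2 * D + 2) := Even.pow_abs ⟨D + 1, by ring⟩ _
    linarith

variable {f : MvPolynomial (Fin 3) ℝ} {D : ℕ} {ε : ℝ} {ℓ : Fin 3 → ℝ}

lemma superlevel_pert_subset (hε : 0 < ε) (hℓ : ∀ i, |ℓ i| < ε / 6) :
    {x | 0 ≤ eval x (pert f D ε ℓ)} ⊆ {x | eval x f ≠ 0} := by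
  intro x hx hfx
  have hx' : 0 ≤ eval x (pert f D ε ℓ) := hx
  rw [eval_pert, hfx] at hx'
  have h1 : -∑ i, ℓ i * x i ≤ ∑ i, ε / 6 * (1 + x i ^ (2 * D + 2)) := by
    rw [← Finset.sum_neg_distrib]
    refine Finset.sum_le_sum fun i _ => ?_
    calc -(ℓ i * x i) ≤ |ℓ i| * |x i| := by rw [← abs_mul]; exact neg_le_abs _
      _ ≤ ε / 6 * (1 + x i ^ (2 * D + 2)) :=
          mul_le_mul (hℓ i).le (abs_lt_one_add_even_pow _ _).le (abs_nonneg _) (by positivity)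
  rw [← Finset.mul_sum, Finset.sum_add_distrib] at h1
  have h2 := sum_even_pow_nonneg D x
  simp only [Finset.sum_const, Finset.card_univ, Fintype.card_fin, nsmul_eq_mul] at h1
  push_cast at h1
  nlinarith

lemma exists_pert_nonneg_on_isCompact {Q : Set (Fin 3 → ℝ)} (hQ : IsCompact Q)
    (hQf : Q ⊆ {x | eval x f ≠ 0}) :
    ∃ ε > 0, ∀ ℓ : Fin 3 → ℝ, (∀ i, |ℓ i| < ε / 6) → Q ⊆ {x | 0 ≤ eval x (pert f D ε ℓ)} := by
  rcases Q.eq_empty_or_nonempty with rfl | hne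
  · exact ⟨1, one_pos, fun _ _ => Set.empty_subset _⟩
  have hcM : Continuous fun x : Fin 3 → ℝ => 2 * ∑ i, x i ^ (2 * D + 2) := by fun_prop
  obtain ⟨x₀, hx₀, hmin⟩ := hQ.exists_isMinOn hne
    ((continuous_eval f).pow 2).continuousOn
  obtain ⟨x₁, hx₁, hmax⟩ := hQ.exists_isMaxOn hne hcM.continuousOn
  have hm : 0 < eval x₀ f ^ 2 := by
    have : eval x₀ f ≠ 0 := hQf hx₀
    positivity
  set m := eval x₀ f ^ 2
  have hM : 0 ≤ 2 * ∑ i, x₁ i ^ (2 * D + 2) := by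
    have := sum_even_pow_nonneg D x₁
    positivity
  set M := 2 * ∑ i, x₁ i ^ (2 * D + 2)
  refine ⟨m / (M + 2), by positivity, fun ℓ hℓ x hx => ?_⟩
  set ε := m / (M + 2) with hε
  have hεpos : 0 < ε := by positivity
  have h1 : ∑ i, ℓ i * x i ≤ ∑ i, ε / 6 * (1 + x i ^ (2 * D + 2)) := by
    refine Finset.sum_le_sum fun i _ => ?_
    calc ℓ i * x i ≤ |ℓ i| * |x i| := by rw [← abs_mul]; exact le_abs_self _
      _ ≤ ε / 6 * (1 + x i ^ (2 * D + 2)) :=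
          mul_le_mul (hℓ i).le (abs_lt_one_add_even_pow _ _).le (abs_nonneg _) (by positivity)
  rw [← Finset.mul_sum, Finset.sum_add_distrib] at h1
  have h2 := sum_even_pow_nonneg D x
  simp only [Finset.sum_const, Finset.card_univ, Fintype.card_fin, nsmul_eq_mul] at h1
  push_cast at h1
  have h3 : m ≤ eval x f ^ 2 := hmin hx
  have h4 : 2 * ∑ i, x i ^ (2 * D + 2) ≤ M := hmax hx
  have h5 : ε * (M + 2) = m := by rw [hε]; field_simp
  change 0 ≤ eval x (pert f D ε ℓ)
  rw [eval_pert]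
  nlinarith

lemma exists_pert_nondegenerateAt (f : MvPolynomial (Fin 3) ℝ) (D : ℕ) (hε : 0 < ε) :
    ∃ ℓ : Fin 3 → ℝ, (∀ i, |ℓ i| < ε / 6) ∧
      ∀ x ∈ critSet (pert f D ε ℓ), NondegenerateAt (fun x => eval x (pert f D ε ℓ)) x := by
  obtain ⟨ℓ, hℓ, hnd⟩ := exists_linear_nondegenerateAt (contDiff_eval (pert f D ε 0) 2)
    (δ := ε / 6) (by positivity)
  refine ⟨ℓ, hℓ, fun x hx => ?_⟩
  let φ : (Fin 3 → ℝ) →L[ℝ] ℝ := ∑ i, ℓ i • ContinuousLinearMap.proj (R := ℝ) (φ := fun _ => ℝ) i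
  have hφ : ∀ x, φ x = ∑ i, ℓ i * x i := fun x => by simp [φ]
  have heq : (fun x => eval x (pert f D ε ℓ)) = fun x => eval x (pert f D ε 0) - φ x := by
    ext x
    rw [hφ, eval_pert, eval_pert]
    simp
  have hfd : fderiv ℝ (fun x => eval x (pert f D ε ℓ)) =
      fun x => fderiv ℝ (fun x => eval x (pert f D ε 0)) x - φ := by
    ext1 x
    rw [heq]
    exact (((contDiff_eval (pert f D ε 0) 2).differentiable two_ne_zero x).hasFDerivAt.sub
      φ.hasFDerivAt).fderiv
  intro u hu
  rw [hfd, fderiv_sub_const] at hu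
  refine hnd x (fun i => ?_) u hu
  have h1 := (mem_critSet_iff_fderiv _ _).1 hx
  rw [hfd, sub_eq_zero] at h1
  rw [h1, hφ]
  simp [Pi.single_apply]

/-- A linearly independent family of classes on `{f ≠ 0}` has at most `6 (2 * D + 1)³` members. -/
lemma card_le_of_trivialOn_eq_bot {ι : Type*} [Fintype ι] (hf : f.totalDegree ≤ D)
    {ω : ι → (Fin 3 → ℝ) → (Fin 3 → ℝ) → ZMod 2} (hω : IsCocycle ω {x | eval x f ≠ 0})
    (hbot : trivialOn ω {x | eval x f ≠ 0} = ⊥) : Fintype.card ι ≤ 6 * (2 * D + 1) ^ 3 := by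
  classical
  have hU : IsOpen {x : Fin 3 → ℝ | eval x f ≠ 0} :=
    isOpen_ne_fun (continuous_eval f) continuous_const
  have hQa : ∀ a : ι → ZMod 2, ∃ Q ⊆ {x : Fin 3 → ℝ | eval x f ≠ 0}, IsCompact Q ∧
      (a ∈ trivialOn ω Q → a = 0) := by
    intro a
    by_contra! hcon
    have ha : a ≠ 0 := (hcon ∅ (Set.empty_subset _) isCompact_empty).2
    have : a ∈ trivialOn ω {x | eval x f ≠ 0} := mem_trivialOn.2
      (exists_isColoring_of_isCompact hω hU subset_rfl fun Q hQ hQc =>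
        mem_trivialOn.1 (hcon Q hQ hQc).1)
    rw [hbot] at this
    exact ha this
  choose Q hQf hQc hQ using hQa
  obtain ⟨ε, hε, hεQ⟩ := exists_pert_nonneg_on_isCompact (D := D) (isCompact_iUnion hQc)
    (Set.iUnion_subset hQf)
  obtain ⟨ℓ, hℓ, hnd⟩ := exists_pert_nondegenerateAt f D hε
  have htriv : trivialOn ω {x | 0 ≤ eval x (pert f D ε ℓ)} = ⊥ := by
    refine (Submodule.eq_bot_iff _).2 fun a ha => hQ a ?_
    exact trivialOn_anti ω ((Set.subset_iUnion Q a).trans (hεQ ℓ hℓ)) ha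
  obtain ⟨hfin, hcard⟩ := critSet_pert_finite hf hε.ne' ℓ
  have key := card_le_finrank_trivialOn hω (continuous_eval (pert f D ε ℓ))
    (superlevel_pert_subset hε hℓ) (isCompact_superlevel_pert hf hε ℓ 0) (Fin 3 × Bool)
    hfin.toFinset
    (fun p _ hp => locallyCovered_of_fderiv_ne_zero (contDiff_eval _ 1) fun h =>
      hp (hfin.mem_toFinset.2 ((mem_critSet_iff_fderiv _ _).2 h)))
    (fun p hp => locallyCovered_of_nondegenerateAt (contDiff_eval _ 2)
      ((mem_critSet_iff_fderiv _ _).1 (hfin.mem_toFinset.1 hp)) (hnd p (hfin.mem_toFinset.1 hp)))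
  rw [htriv, finrank_bot, zero_add, ← Set.ncard_eq_toFinset_card _ hfin] at key
  refine key.trans ?_
  rw [Fintype.card_fin] at hcard
  have h6 : Fintype.card (Fin 3 × Bool) = 6 := by simp
  rw [h6]
  exact Nat.mul_le_mul_left _ hcard

end CountingBound

section Sheets

open Topology Metric

lemma exists_pos_le_of_finite {ι : Type*} [Finite ι] {r : ι → ℝ} (hr : ∀ j, 0 < r j) :
    ∃ ρ > 0, ∀ j, ρ ≤ r j := by
  have h : ∀ᶠ ρ in 𝓝[>] (0 : ℝ), ∀ j, ρ ≤ r j := Filter.eventually_all.2 fun j =>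
    nhdsWithin_le_nhds ((eventually_lt_nhds (hr j)).mono fun _ => le_of_lt)
  obtain ⟨ρ, h1, h2⟩ := (h.and self_mem_nhdsWithin).exists
  exact ⟨ρ, h2, h1⟩

variable {V : Type*} [NormedAddCommGroup V]

/-- A relatively open subset `s` of the two-sided hypersurface `φ = 0` which is relatively closed
in `U`. -/
structure IsSheet (U s : Set V) (φ : V → ℝ) : Prop where
  continuous : Continuous φ
  subset : s ⊆ U
  eq_zero : ∀ x ∈ s, φ x = 0
  exists_mem : ∀ p ∈ s, ∃ r > 0, ∀ x ∈ ball p r, φ x = 0 → x ∈ s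
  exists_notMem : ∀ p ∈ U, p ∉ s → ∃ r > 0, ∀ x ∈ ball p r, x ∉ s
  mem_closure_pos : ∀ p ∈ s, p ∈ closure {x | 0 < φ x}
  mem_closure_neg : ∀ p ∈ s, p ∈ closure {x | φ x < 0}

open Classical in
/-- The cocycle dual to a sheet, which jumps when crossing the sheet. -/
noncomputable def sheetCocycle {ι : Type*} (s : ι → Set V) (φ : ι → V → ℝ) (j : ι) (p x : V) :
    ZMod 2 :=
  if p ∈ s j ∧ 0 ≤ φ j x then 1 else 0

lemma isCocycle_sheetCocycle {ι : Type*} [Fintype ι] {U : Set V} (hU : IsOpen U) {s : ι → Set V}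
    {φ : ι → V → ℝ} (hs : ∀ j, IsSheet U (s j) (φ j)) : IsCocycle (sheetCocycle s φ) U := by
  intro p hp
  have hloc : ∀ j, ∃ r > 0, (p ∈ s j → ∀ x ∈ ball p r, φ j x = 0 → x ∈ s j) ∧
      (p ∉ s j → ∀ x ∈ ball p r, x ∉ s j) := by
    intro j
    by_cases h : p ∈ s j
    · obtain ⟨r, hr, h1⟩ := (hs j).exists_mem p h
      exact ⟨r, hr, fun _ => h1, fun h' => absurd h h'⟩
    · obtain ⟨r, hr, h1⟩ := (hs j).exists_notMem p hp h
      exact ⟨r, hr, fun h' => absurd h' h, fun _ => h1⟩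
  choose r hr h1 h2 using hloc
  obtain ⟨r₀, hr₀, hball⟩ := Metric.isOpen_iff.1 hU p hp
  obtain ⟨ρ, hρ, hρr⟩ := exists_pos_le_of_finite hr
  refine ⟨min r₀ ρ, lt_min hr₀ hρ, (ball_subset_ball (min_le_left _ _)).trans hball,
    fun q hq => Filter.eventually_all.2 fun j => ?_⟩
  have hqj : q ∈ ball p (r j) := ball_subset_ball ((min_le_right _ _).trans (hρr j)) hq
  by_cases hpj : p ∈ s j
  · by_cases hqs : q ∈ s j
    · exact .of_forall fun x => by simp [sheetCocycle, hpj, hqs]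
    · have hne : φ j q ≠ 0 := fun h => hqs (h1 j hpj q hqj h)
      have hc := (hs j).continuous.tendsto q
      rcases lt_or_gt_of_ne hne with h | h
      · filter_upwards [hc.eventually_lt_const h] with x hx
        simp [sheetCocycle, hqs, hx.not_ge, h.not_ge]
      · filter_upwards [hc.eventually_const_lt h] with x hx
        simp [sheetCocycle, hqs, hpj, hx.le, h.le]
  · have hqs := h2 j hpj q hqj
    exact .of_forall fun x => by simp [sheetCocycle, hpj, hqs]

/-- The cocycles dual to non-disconnecting sheets are linearly independent. -/
lemma trivialOn_sheetCocycle_eq_bot [NormedSpace ℝ V] {ι : Type*} [Fintype ι] [LinearOrder ι]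
    {U : Set V}
    (hU : IsOpen U) {s : ι → Set V} {φ : ι → V → ℝ} (hs : ∀ j, IsSheet U (s j) (φ j))
    (hdisj : ∀ i j, i ≠ j → Disjoint (s i) (s j)) (hne : ∀ i, (s i).Nonempty) (I : Set ι)
    (hI : ∀ i ∈ I, ∀ x ∈ s i,
      IsPreconnected (connectedComponentIn (U \ ⋃ (j : ι) (_ : j < i), s j) x \ s i)) :
    ∀ [Fintype I],
    trivialOn (sheetCocycle (fun i : I => s i) (fun i : I => φ i)) U = ⊥ := by
  intro _
  refine (Submodule.eq_bot_iff _).2 fun a ha => ?_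
  obtain ⟨u, hu⟩ := mem_trivialOn.1 ha
  by_contra hane
  obtain ⟨i, hai, himax⟩ : ∃ i : I, a i ≠ 0 ∧ ∀ j : I, i < j → a j = 0 := by
    obtain ⟨i₀, hi₀⟩ := Function.ne_iff.1 hane
    obtain ⟨i, hi, hmax⟩ := Finset.exists_max_image (Finset.univ.filter fun j : I => a j ≠ 0) id
      ⟨i₀, by simpa using hi₀⟩
    refine ⟨i, (Finset.mem_filter.1 hi).2, fun j hj => ?_⟩
    by_contra h
    exact absurd (hmax j (by simpa using h)) (not_le.2 hj)
  obtain ⟨x, hx⟩ := hne i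
  set W := U \ ⋃ (j : ι) (_ : j < i), s j
  have hxs : ∀ j, j ≠ (i : ι) → x ∉ s j := fun j hj h =>
    Set.disjoint_left.1 (hdisj j i hj) h hx
  have hxU := (hs i).subset hx
  obtain ⟨ρ, hρ, hρW⟩ : ∃ ρ > 0, ball x ρ ⊆ W := by
    have hloc : ∀ j, ∃ r > 0, j ≠ (i : ι) → ∀ y ∈ ball x r, y ∉ s j := by
      intro j
      by_cases h : j = (i : ι)
      · exact ⟨1, one_pos, fun h' => absurd h h'⟩
      · obtain ⟨r, hr, h1⟩ := (hs j).exists_notMem x hxU (hxs j h)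
        exact ⟨r, hr, fun _ => h1⟩
    choose r hr h1 using hloc
    obtain ⟨r₀, hr₀, hball⟩ := Metric.isOpen_iff.1 hU x hxU
    obtain ⟨ρ, hρ, hρr⟩ := exists_pos_le_of_finite hr
    refine ⟨min r₀ ρ, lt_min hr₀ hρ, fun y hy =>
      ⟨hball (ball_subset_ball (min_le_left _ _) hy), ?_⟩⟩
    simp only [Set.mem_iUnion, not_exists]
    exact fun j hj => h1 j hj.ne y
      (ball_subset_ball ((min_le_right _ _).trans (hρr j)) hy)
  have hcomp : ball x ρ ⊆ connectedComponentIn W x :=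
    (convex_ball x ρ).isPreconnected.subset_connectedComponentIn (mem_ball_self hρ) hρW
  have hcompW := connectedComponentIn_subset W x
  have hYU : connectedComponentIn W x \ s i ⊆ U := fun y hy => (hcompW hy.1).1
  have hzero : ∀ p ∈ connectedComponentIn W x \ s i, ∀ y,
      combo (sheetCocycle (fun i : I => s i) (fun i : I => φ i)) a p y = 0 := by
    intro p hp y
    refine Finset.sum_eq_zero fun j _ => ?_
    rcases lt_trichotomy j i with h | h | h
    · have : p ∉ s j := fun h' => (hcompW hp.1).2 (Set.mem_iUnion₂.2 ⟨j, h, h'⟩)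
      simp [sheetCocycle, this]
    · simp [sheetCocycle, h, hp.2]
    · simp [himax j h]
  have hconst : ∀ y ∈ connectedComponentIn W x \ s i, ∀ z ∈ connectedComponentIn W x \ s i,
      u y = u z := by
    refine fun y hy z hz => eq_of_isPreconnected_of_eventually (hI i i.2 x hx)
      (fun p hp => ?_) hy hz
    filter_upwards [nhdsWithin_mono p hYU (hu p (hYU hp))] with y hy
    rwa [hzero p hp, hzero p hp, sub_zero, sub_eq_zero] at hy
  have hnear := hu x hxU
  rw [nhdsWithin_eq_nhds.2 (hU.mem_nhds hxU)] at hnear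
  have hcombo : ∀ y, combo (sheetCocycle (fun i : I => s i) (fun i : I => φ i)) a x y =
      a i * if 0 ≤ φ i y then 1 else 0 := by
    intro y
    rw [combo, Finset.sum_eq_single i]
    · simp [sheetCocycle, hx]
    · intro j _ hj
      simp [sheetCocycle, hxs j (fun h => hj (Subtype.ext h))]
    · simp
  obtain ⟨η, hη, hη'⟩ := Metric.eventually_nhds_iff_ball.1
    (hnear.and (ball_mem_nhds x hρ))
  obtain ⟨y, hy, hyx⟩ := Metric.mem_closure_iff.1 ((hs i).mem_closure_pos x hx) η hη
  obtain ⟨z, hz, hzx⟩ := Metric.mem_closure_iff.1 ((hs i).mem_closure_neg x hx) η hη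
  rw [dist_comm] at hyx hzx
  obtain ⟨hy1, hy2⟩ := hη' y hyx
  obtain ⟨hz1, hz2⟩ := hη' z hzx
  have hyz := hconst y ⟨hcomp hy2, fun h => hy.ne' ((hs i).eq_zero y h)⟩
    z ⟨hcomp hz2, fun h => hz.ne ((hs i).eq_zero z h)⟩
  rw [hcombo, hcombo, (hs i).eq_zero x hx, if_pos le_rfl] at hy1 hz1
  rw [if_pos hy.le] at hy1
  rw [if_neg (not_le.2 hz), ← hyz, hy1] at hz1
  apply hai
  simpa using hz1.symm

end Sheets

section Slices

open Topology Metric MvPolynomial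

lemma IsNonVerticalTriangle.isCompact {T : Set (Fin 3 → ℝ)} (hT : IsNonVerticalTriangle T) :
    IsCompact T := by
  obtain ⟨a, b, c, -, rfl, -⟩ := hT
  exact (Set.toFinite _).isCompact_convexHull ℝ

/-- A parametrization of the plane spanned by a triangle. -/
lemma IsNonVerticalTriangle.exists_parametrization {T : Set (Fin 3 → ℝ)}
    (hT : IsNonVerticalTriangle T) :
    ∃ (a : Fin 3 → ℝ) (L : (Fin 2 → ℝ) →ₗ[ℝ] (Fin 3 → ℝ)), Function.Injective L ∧
      ∀ x, x ∈ affineSpan ℝ T ↔ ∃ y, a + L y = x := by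
  obtain ⟨a, b, c, hind, rfl, -⟩ := hT
  have hli : LinearIndependent ℝ ![b - a, c - a] := by
    have h1 := (affineIndependent_iff_linearIndependent_vsub ℝ _ (0 : Fin 3)).1 hind
    have h2 := h1.comp (fun i : Fin 2 => (⟨i.succ, i.succ_ne_zero⟩ : {x : Fin 3 // x ≠ 0}))
      (fun i j h => Fin.succ_injective _ (congrArg Subtype.val h))
    have h3 : ![b - a, c - a] = (fun i : {x : Fin 3 // x ≠ 0} => ![a, b, c] i -ᵥ ![a, b, c] 0) ∘
        fun i : Fin 2 => (⟨i.succ, i.succ_ne_zero⟩ : {x : Fin 3 // x ≠ 0}) := by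
      funext i
      fin_cases i <;> rfl
    rw [h3]
    exact h2
  refine ⟨a, Fintype.linearCombination ℝ ![b - a, c - a],
    hli.fintypeLinearCombination_injective, fun x => ?_⟩
  rw [affineSpan_convexHull]
  have ha : a ∈ affineSpan ℝ ({a, b, c} : Set (Fin 3 → ℝ)) := mem_affineSpan ℝ (by simp)
  have hdir : (affineSpan ℝ ({a, b, c} : Set (Fin 3 → ℝ))).direction =
      LinearMap.range (Fintype.linearCombination ℝ ![b - a, c - a]) := by
    rw [direction_affineSpan, vectorSpan_eq_span_vsub_set_right ℝ (p := a) (by simp),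
      Fintype.range_linearCombination]
    simp [Set.image_insert_eq, Matrix.range_cons, Submodule.span_insert_zero,
      Set.pair_comm (c - a)]
  rw [← AffineSubspace.vsub_right_mem_direction_iff_mem ha, hdir, LinearMap.mem_range]
  simp only [vsub_eq_sub, eq_sub_iff_add_eq']

/-- An affine equation of the plane spanned by a triangle. -/
lemma IsNonVerticalTriangle.exists_equation {T : Set (Fin 3 → ℝ)} (hT : IsNonVerticalTriangle T) :
    ∃ (φ : (Fin 3 → ℝ) →ₗ[ℝ] ℝ) (k : ℝ), φ ≠ 0 ∧ ∀ x, x ∈ affineSpan ℝ T ↔ φ x = k := by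
  obtain ⟨a, L, hL, hspan⟩ := hT.exists_parametrization
  have hrank : Module.finrank ℝ (LinearMap.range L) = 2 := by
    rw [LinearMap.finrank_range_of_inj hL]; simp
  have hlt : LinearMap.range L < ⊤ := by
    refine lt_top_iff_ne_top.2 fun h => ?_
    rw [h, finrank_top] at hrank
    simp at hrank
  obtain ⟨φ, hφ, hker⟩ := Submodule.exists_le_ker_of_lt_top _ hlt
  have heq : LinearMap.range L = LinearMap.ker φ := by
    refine Submodule.eq_of_le_of_finrank_le hker ?_
    have h1 := LinearMap.finrank_range_add_finrank_ker φ
    rw [LinearMap.range_eq_top.2 (LinearMap.surjective hφ), finrank_top] at h1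
    simp at h1
    omega
  refine ⟨φ, φ a, hφ, fun x => ?_⟩
  rw [hspan, ← sub_eq_zero, ← map_sub, ← LinearMap.mem_ker, ← heq, LinearMap.mem_range]
  simp only [eq_sub_iff_add_eq']

lemma exists_ball_of_mem_intrinsicInterior {T : Set (Fin 3 → ℝ)} {p : Fin 3 → ℝ}
    (hp : p ∈ intrinsicInterior ℝ T) :
    ∃ r > 0, ∀ x ∈ ball p r, x ∈ affineSpan ℝ T → x ∈ T := by
  obtain ⟨y, hy, rfl⟩ := mem_intrinsicInterior.1 hp
  obtain ⟨r, hr, h⟩ := Metric.isOpen_iff.1 isOpen_interior y hy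
  refine ⟨r, hr, fun x hx hxs => ?_⟩
  have hxT : (⟨x, hxs⟩ : affineSpan ℝ T) ∈ ((↑) ⁻¹' T : Set (affineSpan ℝ T)) :=
    interior_subset (h hx)
  exact hxT

/-- A slice of `T`: a component of `T \ Z(f)` whose closure lies in the relative interior. -/
def IsSlice (T : Set (Fin 3 → ℝ)) (f : MvPolynomial (Fin 3) ℝ) (σ : Set (Fin 3 → ℝ)) : Prop :=
  ∃ x, x ∈ T \ ZeroSet f ∧ σ = connectedComponentIn (T \ ZeroSet f) x ∧
    closure σ ⊆ intrinsicInterior ℝ T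

variable {T : Set (Fin 3 → ℝ)} {f : MvPolynomial (Fin 3) ℝ} {σ τ : Set (Fin 3 → ℝ)}

lemma IsSlice.nonempty (h : IsSlice T f σ) : σ.Nonempty := by
  obtain ⟨x, hx, rfl, -⟩ := h
  exact ⟨x, mem_connectedComponentIn hx⟩

lemma IsSlice.subset (h : IsSlice T f σ) : σ ⊆ T \ ZeroSet f := by
  obtain ⟨x, hx, rfl, -⟩ := h
  exact connectedComponentIn_subset _ _

lemma IsSlice.closure_subset (h : IsSlice T f σ) : closure σ ⊆ intrinsicInterior ℝ T := by
  obtain ⟨x, hx, rfl, h⟩ := h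
  exact h

lemma IsSlice.isPreconnected (h : IsSlice T f σ) : IsPreconnected σ := by
  obtain ⟨x, hx, rfl, -⟩ := h
  exact isPreconnected_connectedComponentIn

lemma IsSlice.subset_of_isPreconnected (h : IsSlice T f σ) {A : Set (Fin 3 → ℝ)}
    (hA : IsPreconnected A) (hAT : A ⊆ T \ ZeroSet f) (hne : (A ∩ σ).Nonempty) : A ⊆ σ := by
  obtain ⟨x, hx, rfl, -⟩ := h
  obtain ⟨p, hpA, hp⟩ := hne
  rw [connectedComponentIn_eq hp]
  exact hA.subset_connectedComponentIn hpA hAT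

lemma IsSlice.disjoint (hσ : IsSlice T f σ) (hτ : IsSlice T f τ) (hne : σ ≠ τ) :
    Disjoint σ τ := by
  by_contra h
  rw [Set.not_disjoint_iff_nonempty_inter] at h
  refine hne ((hτ.subset_of_isPreconnected hσ.isPreconnected hσ.subset h).antisymm
    (hσ.subset_of_isPreconnected hτ.isPreconnected hτ.subset (by rwa [Set.inter_comm])))

lemma IsSlice.exists_mem (h : IsSlice T f σ) {p : Fin 3 → ℝ} (hp : p ∈ σ) :
    ∃ r > 0, ∀ x ∈ ball p r, x ∈ affineSpan ℝ T → x ∈ σ := by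
  obtain ⟨r₁, hr₁, h₁⟩ := exists_ball_of_mem_intrinsicInterior (h.closure_subset
    (subset_closure hp))
  have hpf : eval p f ≠ 0 := (h.subset hp).2
  obtain ⟨r₂, hr₂, h₂⟩ := Metric.isOpen_iff.1
    (isOpen_ne_fun (MvPolynomial.continuous_eval f) continuous_const) p hpf
  refine ⟨min r₁ r₂, lt_min hr₁ hr₂, fun x hx hxs => ?_⟩
  have hA : IsPreconnected (ball p (min r₁ r₂) ∩ affineSpan ℝ T) :=
    ((convex_ball _ _).inter (affineSpan ℝ T).convex).isPreconnected
  refine h.subset_of_isPreconnected hA (fun y hy => ⟨?_, ?_⟩)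
    ⟨p, ⟨mem_ball_self (lt_min hr₁ hr₂), subset_affineSpan ℝ T (h.subset hp).1⟩, hp⟩ ⟨hx, hxs⟩
  · exact h₁ y (ball_subset_ball (min_le_left _ _) hy.1) hy.2
  · exact h₂ (ball_subset_ball (min_le_right _ _) hy.1)

lemma IsSlice.mem_of_mem_closure (h : IsSlice T f σ) {p : Fin 3 → ℝ} (hp : p ∈ closure σ)
    (hpf : eval p f ≠ 0) : p ∈ σ := by
  have hsub : insert p σ ⊆ closure σ := Set.insert_subset hp subset_closure
  obtain ⟨q, hq⟩ := h.nonempty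
  exact h.subset_of_isPreconnected (h.isPreconnected.subset_closure (Set.subset_insert _ _) hsub)
    (Set.insert_subset ⟨intrinsicInterior_subset (h.closure_subset hp), hpf⟩ h.subset)
    ⟨q, Set.mem_insert_of_mem _ hq, hq⟩ (Set.mem_insert _ _)

lemma IsSlice.exists_isSheet (hT : IsNonVerticalTriangle T) (h : IsSlice T f σ) :
    ∃ φ : (Fin 3 → ℝ) → ℝ, IsSheet {x | eval x f ≠ 0} σ φ := by
  obtain ⟨φ, k, hφ, hspan⟩ := hT.exists_equation
  have hzero : ∀ x ∈ σ, φ x = k := fun x hx => (hspan x).1 (subset_affineSpan ℝ T (h.subset hx).1)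
  obtain ⟨v, hv⟩ : ∃ v, 0 < φ v := by
    obtain ⟨v, hv⟩ := DFunLike.ne_iff.1 hφ
    rcases lt_or_gt_of_ne hv with h1 | h1
    · exact ⟨-v, by simpa using h1⟩
    · exact ⟨v, h1⟩
  have hlim : ∀ (p w : Fin 3 → ℝ), Filter.Tendsto (fun t : ℝ => p + t • w) (𝓝[>] 0) (𝓝 p) := by
    intro p w
    have : Continuous fun t : ℝ => p + t • w := by fun_prop
    simpa using (this.tendsto 0).mono_left nhdsWithin_le_nhds
  refine ⟨fun x => φ x - k, ?_, fun x hx => (h.subset hx).2, ?_, ?_, ?_, ?_, ?_⟩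
  · exact φ.continuous_of_finiteDimensional.sub continuous_const
  · exact fun x hx => sub_eq_zero.2 (hzero x hx)
  · intro p hp
    obtain ⟨r, hr, h1⟩ := h.exists_mem hp
    exact ⟨r, hr, fun x hx hx0 => h1 x hx ((hspan x).2 (sub_eq_zero.1 hx0))⟩
  · intro p hpU hp
    have hpc : p ∈ (closure σ)ᶜ := fun hpc => hp (h.mem_of_mem_closure hpc hpU)
    obtain ⟨r, hr, h1⟩ := Metric.isOpen_iff.1 isClosed_closure.isOpen_compl p hpc
    exact ⟨r, hr, fun x hx hxσ => h1 hx (subset_closure hxσ)⟩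
  · intro p hp
    refine mem_closure_of_tendsto (hlim p v) ?_
    filter_upwards [self_mem_nhdsWithin] with t ht
    have : 0 < t * φ v := mul_pos ht hv
    simpa [hzero p hp] using this
  · intro p hp
    refine mem_closure_of_tendsto (hlim p (-v)) ?_
    filter_upwards [self_mem_nhdsWithin] with t ht
    have : 0 < t * φ v := mul_pos ht hv
    simpa [hzero p hp] using this

end Slices

section Finiteness

open Topology Metric MvPolynomial

/-- Pulling a polynomial back along an affine map. -/
lemma exists_eval_add_linearMap {m n : Type*} [Fintype m] [DecidableEq m]
    (f : MvPolynomial n ℝ) (a : n → ℝ) (L : (m → ℝ) →ₗ[ℝ] (n → ℝ)) :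
    ∃ g : MvPolynomial m ℝ, ∀ y, eval y g = eval (a + L y) f := by
  refine ⟨bind₁ (fun i => C (a i) + ∑ j, C (L (fun k => if j = k then 1 else 0) i) * X j) f,
    fun y => ?_⟩
  rw [← aeval_eq_eval, ← aeval_eq_eval]
  change aeval y (bind₁ _ f) = aeval (a + L y) f
  rw [aeval_bind₁]
  congr 2
  funext i
  rw [L.pi_apply_eq_sum_univ y]
  simp [Finset.sum_apply, mul_comm]

variable {T : Set (Fin 3 → ℝ)} {f : MvPolynomial (Fin 3) ℝ} {σ : Set (Fin 3 → ℝ)}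

lemma IsSlice.isOpen_preimage {a : Fin 3 → ℝ} {L : (Fin 2 → ℝ) →ₗ[ℝ] (Fin 3 → ℝ)}
    (hspan : ∀ x, x ∈ affineSpan ℝ T ↔ ∃ y, a + L y = x) (h : IsSlice T f σ) :
    IsOpen ((fun y => a + L y) ⁻¹' σ) := by
  have hc : Continuous fun y => a + L y :=
    continuous_const.add L.continuous_of_finiteDimensional
  refine isOpen_iff_mem_nhds.2 fun y hy => ?_
  obtain ⟨r, hr, hb⟩ := h.exists_mem hy
  filter_upwards [hc.continuousAt.preimage_mem_nhds (ball_mem_nhds _ hr)] with z hz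
  exact hb _ hz ((hspan _).2 ⟨z, rfl⟩)

lemma IsSlice.isBounded_preimage (hT : IsNonVerticalTriangle T) {a : Fin 3 → ℝ}
    {L : (Fin 2 → ℝ) →ₗ[ℝ] (Fin 3 → ℝ)} (hL : Function.Injective L) (h : IsSlice T f σ) :
    Bornology.IsBounded ((fun y => a + L y) ⁻¹' σ) := by
  obtain ⟨K, -, hK⟩ := L.injective_iff_antilipschitz.1 hL
  have hK' : AntilipschitzWith K fun y => a + L y := fun x y => by
    simpa only [edist_add_left] using hK x y
  exact hK'.isBounded_preimage (hT.isCompact.isBounded.subset fun x hx => (h.subset hx).1)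

lemma IsSlice.eval_eq_zero_of_mem_frontier {a : Fin 3 → ℝ} {L : (Fin 2 → ℝ) →ₗ[ℝ] (Fin 3 → ℝ)}
    (hspan : ∀ x, x ∈ affineSpan ℝ T ↔ ∃ y, a + L y = x) (h : IsSlice T f σ) {y : Fin 2 → ℝ}
    (hy : y ∈ frontier ((fun y => a + L y) ⁻¹' σ)) : eval (a + L y) f = 0 := by
  have hc : Continuous fun y => a + L y :=
    continuous_const.add L.continuous_of_finiteDimensional
  rw [(h.isOpen_preimage hspan).frontier_eq] at hy
  by_contra hne
  exact hy.2 (h.mem_of_mem_closure (hc.closure_preimage_subset _ hy.1) hne)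

lemma IsSlice.preimage_nonempty {a : Fin 3 → ℝ} {L : (Fin 2 → ℝ) →ₗ[ℝ] (Fin 3 → ℝ)}
    (hspan : ∀ x, x ∈ affineSpan ℝ T ↔ ∃ y, a + L y = x) (h : IsSlice T f σ) :
    ((fun y => a + L y) ⁻¹' σ).Nonempty := by
  obtain ⟨x, hx⟩ := h.nonempty
  obtain ⟨y, rfl⟩ := (hspan x).1 (subset_affineSpan ℝ T (h.subset hx).1)
  exact ⟨y, hx⟩

lemma IsNonVerticalTriangle.finite_setOf_isSlice (hT : IsNonVerticalTriangle T)
    (f : MvPolynomial (Fin 3) ℝ) : {σ | IsSlice T f σ}.Finite := by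
  obtain ⟨a, L, hL, hspan⟩ := hT.exists_parametrization
  obtain ⟨g, hg⟩ := exists_eval_add_linearMap f a L
  have hinj : Set.InjOn (fun σ => (fun y => a + L y) ⁻¹' σ) {σ | IsSlice T f σ} := by
    intro σ hσ τ hτ hστ
    by_contra hne
    obtain ⟨y, hy⟩ := IsSlice.preimage_nonempty hspan hσ
    exact Set.disjoint_left.1 (IsSlice.disjoint hσ hτ hne) hy ((Set.ext_iff.1 hστ y).1 hy)
  refine Set.Finite.of_finite_image (finite_of_frontier_subset_zeros g _ ?_ ?_) hinj
  · rintro _ ⟨σ, hσ, rfl⟩ _ ⟨τ, hτ, rfl⟩ hne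
    exact (IsSlice.disjoint hσ hτ fun h => hne (h ▸ rfl)).preimage _
  · rintro _ ⟨σ, hσ, rfl⟩
    refine ⟨hσ.isOpen_preimage hspan, hσ.isBounded_preimage hT hL, ?_, fun y hy => ?_⟩
    · obtain ⟨y, hy⟩ := hσ.preimage_nonempty hspan
      exact ⟨y, hy, by rw [hg]; exact (hσ.subset hy).2⟩
    · rw [hg]
      exact hσ.eval_eq_zero_of_mem_frontier hspan hy

lemma IsNonVerticalTriangle.not_isSlice (hT : IsNonVerticalTriangle T)
    (hf : ∀ x, eval x f ≠ 0) : ¬ IsSlice T f σ := by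
  intro h
  obtain ⟨a, L, hL, hspan⟩ := hT.exists_parametrization
  have hclopen : IsClopen ((fun y => a + L y) ⁻¹' σ) := by
    rw [isClopen_iff_frontier_eq_empty]
    exact Set.eq_empty_of_forall_notMem fun y hy => hf _ (h.eval_eq_zero_of_mem_frontier hspan hy)
  have huniv := hclopen.eq_univ (h.preimage_nonempty hspan)
  exact NormedSpace.unbounded_univ ℝ (Fin 2 → ℝ) (huniv ▸ h.isBounded_preimage hT hL)

end Finiteness

/-- **ordering the slices.** There is an absolute constant `C` with the
following property. Let `T 0, …, T (n-1)` be pairwise disjoint non-vertical triangles and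
let `f` be a nonzero squarefree polynomial of degree at most `D`. A *slice* is a connected
component of `T i \ Z(f)` whose closure is contained in the relative interior of `T i`.
Then the slices can be enumerated as `s 0, …, s (t-1)` so that the number of indices `i`
for which `s i` is non-disconnecting is at most `C·D³`; here `s i` is non-disconnecting if
`U_i \ s i` is connected, where `U_i` is the connected component of
`(ℝ³ \ Z(f)) \ (s 0 ∪ ⋯ ∪ s (i-1))` containing `s i`. -/
theorem ordering_slices_few_nondisconnecting :
    ∃ C : ℕ, ∀ (n : ℕ) (T : Fin n → Set (Fin 3 → ℝ)),
      (∀ i, IsNonVerticalTriangle (T i)) →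
      (∀ i j, i ≠ j → Disjoint (T i) (T j)) →
      ∀ (D : ℕ) (f : MvPolynomial (Fin 3) ℝ), f ≠ 0 → Squarefree f →
        f.totalDegree ≤ D →
        ∃ (t : ℕ) (s : Fin t → Set (Fin 3 → ℝ)),
          Function.Injective s ∧
          -- `s` enumerates exactly the slices:
          Set.range s = {σ | ∃ (i : Fin n) (x : Fin 3 → ℝ),
              x ∈ T i \ ZeroSet f ∧
              σ = connectedComponentIn (T i \ ZeroSet f) x ∧
              closure σ ⊆ intrinsicInterior ℝ (T i)} ∧
          Nat.card {i : Fin t |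
              ∀ x ∈ s i,
                IsConnected
                  ((connectedComponentIn
                      ({p | MvPolynomial.eval p f ≠ 0} \ ⋃ (j : Fin t) (_ : j < i), s j) x)
                    \ s i)} ≤ C * D ^ 3 := by
  classical
  refine ⟨162, fun n T hT hTdisj D f hf _ hD => ?_⟩
  have hSfin : {σ | ∃ i, IsSlice (T i) f σ}.Finite := by
    rw [Set.ofPred_exists]
    exact Set.finite_iUnion fun i => (hT i).finite_setOf_isSlice f
  have := hSfin.to_subtype
  obtain ⟨t, ⟨e⟩⟩ := Finite.exists_equiv_fin {σ | ∃ i, IsSlice (T i) f σ}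
  let s : Fin t → Set (Fin 3 → ℝ) := fun j => e.symm j
  have hinj : Function.Injective s := Subtype.val_injective.comp e.symm.injective
  have hrange : Set.range s = {σ | ∃ i, IsSlice (T i) f σ} := by
    rw [show s = Subtype.val ∘ e.symm from rfl, e.symm.surjective.range_comp, Subtype.range_coe]
  have hslice : ∀ j, ∃ i, IsSlice (T i) f (s j) := fun j => (e.symm j).2
  refine ⟨t, s, hinj, hrange, ?_⟩
  choose τ hτ using hslice
  choose φ hφ using fun j => (hτ j).exists_isSheet (hT (τ j))
  have hdisj : ∀ i j, i ≠ j → Disjoint (s i) (s j) := by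
    intro i j hij
    by_cases h : τ i = τ j
    · exact (hτ i).disjoint (h ▸ hτ j) (hinj.ne hij)
    · exact (hTdisj _ _ h).mono (fun x hx => ((hτ i).subset hx).1)
        fun x hx => ((hτ j).subset hx).1
  have hU : IsOpen {p : Fin 3 → ℝ | MvPolynomial.eval p f ≠ 0} :=
    isOpen_ne_fun (MvPolynomial.continuous_eval f) continuous_const
  set I : Set (Fin t) := {i | ∀ x ∈ s i, IsConnected ((connectedComponentIn
    ({p | MvPolynomial.eval p f ≠ 0} \ ⋃ (j : Fin t) (_ : j < i), s j) x) \ s i)} with hI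
  rcases Nat.eq_zero_or_pos D with rfl | hDpos
  · obtain ⟨c, rfl⟩ : ∃ c, f = MvPolynomial.C c :=
      ⟨_, MvPolynomial.totalDegree_eq_zero_iff_eq_C.1 (Nat.le_zero.1 hD)⟩
    have hempty : IsEmpty I := ⟨fun i => (hT _).not_isSlice
      (fun x => by simpa using hf) (hτ i)⟩
    simp
  · have hbot := trivialOn_sheetCocycle_eq_bot hU hφ hdisj (fun j => (hτ j).nonempty) I
      fun i hi x hx => (hi x hx).isPreconnected
    have hcard := card_le_of_trivialOn_eq_bot (ι := I) hD
      (isCocycle_sheetCocycle hU fun i : I => hφ i) hbot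
    rw [Nat.card_eq_fintype_card]
    calc Fintype.card I ≤ 6 * (2 * D + 1) ^ 3 := hcard
      _ ≤ 6 * (3 * D) ^ 3 := by gcongr; omega
      _ = 162 * D ^ 3 := by ring
end
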